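/- arXiv:0904.2422 — 2 statements merged into one kernel-verified Lean document; each statement's English description precedes it below -/
import Mathlib

section
/- Let B̄ and B̲ be open balls in ℝ³ with the closure of B̄ contained in B̲, and let 1 < p < ∞. Then there exist a constant C > 0 and a family of constants C_{d,q} > 0 (indexed by integers d, q ≥ 0), all depending only on p, B̄, B̲, such that the following holds. Let R ∈ L¹(B̲) and let A : B̲ → ℝ^{3×3} be a symmetric-matrix-valued function in L^p(B̲) satisfying −∫_{B̲} R(x) Δψ(x) dx = ∫_{B̲} Σ_{i,j} A_{ij}(x) ∂ᵢ∂ⱼψ(x) dx for every ψ ∈ C_c^∞(B̲). Then there exist R₁ ∈ L^p(B̄) and R₂ ∈ C^∞(B̄) with R = R₁ + R₂ almost everywhere on B̄, (∫_{B̄} |R₁|^p)^{1/p} ≤ C (∫_{B̲} |A|^p)^{1/p}, and for all integers d, q ≥ 0: sup_{x ∈ B̄} |∇^d R₂(x)| ≤ C_{d,q} ( ∫_{B̲} |A| dx + N_q(R) ), where N_q(R) := sup { |∫_{B̲} R ψ dx| : ψ ∈ C_c^∞(B̲), sup_x |∇^j ψ(x)| ≤ 1 for all 0 ≤ j ≤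 q }. -/
open MeasureTheory Set Metric
open scoped ENNReal NNReal

noncomputable section

/-- `ℝ³` with the Euclidean norm. -/
abbrev E3 := EuclideanSpace ℝ (Fin 3)

/-- Spatial partial derivative `∂ⱼ f` of a scalar function. -/
def pd (f : E3 → ℝ) (j : Fin 3) (x : E3) : ℝ :=
  fderiv ℝ f x (EuclideanSpace.single j 1)

/-- `|∇f|² = Σ_{i,j} |∂ⱼ fᵢ|²`. -/
def gradSq (f : E3 → E3) (x : E3) : ℝ :=
  ∑ i, ∑ j, (pd (fun y => f y i) j x) ^ 2

/-- `(u,P)` is a smooth solution of the incompressible Navier–Stokes equations on the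
open set `U ⊆ ℝ × ℝ³`: `u` and `P` are infinitely differentiable on `U`, and on `U` one has
`∂ₜuᵢ + Σⱼ uⱼ ∂ⱼuᵢ + ∂ᵢP − Δuᵢ = 0` and `div u = 0`. -/
def IsNSSolution (u : ℝ → E3 → E3) (P : ℝ → E3 → ℝ) (U : Set (ℝ × E3)) : Prop :=
  ContDiffOn ℝ (⊤ : ℕ∞) (fun q : ℝ × E3 => u q.1 q.2) U ∧
  ContDiffOn ℝ (⊤ : ℕ∞) (fun q : ℝ × E3 => P q.1 q.2) U ∧
  (∀ q ∈ U, ∀ i : Fin 3,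
    deriv (fun s => u s q.2 i) q.1
      + (∑ j, u q.1 q.2 j * pd (fun y => u q.1 y i) j q.2)
      + pd (fun y => P q.1 y) i q.2
      - ∑ j, pd (pd (fun y => u q.1 y i) j) j q.2 = 0) ∧
  (∀ q ∈ U, ∑ i, pd (fun y => u q.1 y i) i q.2 = 0)

/-- A substitute for the `W^{−q,1}(B̲)` norm of `R`:
`N_q(R) = sup { |∫_{B̲} R ψ| : ψ ∈ C_c^∞(B̲), ‖∇ʲψ‖_∞ ≤ 1 for 0 ≤ j ≤ q }`. -/
def negSobNorm (Bd : Set E3) (q : ℕ) (R : E3 → ℝ) : ℝ :=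
  sSup {r : ℝ | ∃ ψ : E3 → ℝ, ContDiff ℝ (⊤ : ℕ∞) ψ ∧ tsupport ψ ⊆ Bd ∧
    (∀ j : ℕ, j ≤ q → ∀ x, ‖iteratedFDeriv ℝ j ψ x‖ ≤ 1) ∧
    r = |∫ x in Bd, R x * ψ x|}

/-- Huber function: quadratic on `[-6, 6]`, affine outside. -/
def huber (b : ℝ) : ℝ := if |b| ≤ 6 then b ^ 2 else 12 * |b| - 36

lemma huber_ge_tangent {c : ℝ} (hc : |c| ≤ 6) (b : ℝ) : 2 * c * b - c ^ 2 ≤ huber b := by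
  unfold huber
  split_ifs with h
  · nlinarith [sq_nonneg (b - c)]
  · have h1 : c * b ≤ |c| * |b| := by rw [← abs_mul]; exact le_abs_self _
    have h2 : c ^ 2 = |c| ^ 2 := (sq_abs c).symm
    nlinarith [mul_nonneg (sub_nonneg.2 hc) (sub_nonneg.2 (not_le.1 h).le)]

lemma huber_eq_tangent (b : ℝ) : ∃ c : ℝ, |c| ≤ 6 ∧ huber b = 2 * c * b - c ^ 2 := by
  unfold huber
  split_ifs with h
  · exact ⟨b, h, by ring⟩
  · rcases abs_cases b with ⟨hb, _⟩ | ⟨hb, _⟩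
    · exact ⟨6, by norm_num, by rw [hb]; ring⟩
    · exact ⟨-6, by norm_num, by rw [hb]; ring⟩

lemma huber_convexOn : ConvexOn ℝ univ huber := by
  refine ⟨convex_univ, fun x _ y _ s t hs ht hst => ?_⟩
  obtain ⟨c, hc, h⟩ := huber_eq_tangent (s • x + t • y)
  rw [h]
  have hx := mul_le_mul_of_nonneg_left (huber_ge_tangent hc x) hs
  have hy := mul_le_mul_of_nonneg_left (huber_ge_tangent hc y) ht
  simp only [smul_eq_mul]
  have : c ^ 2 = s * c ^ 2 + t * c ^ 2 := by rw [← add_mul, hst, one_mul]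
  linarith

lemma huber_of_abs_le {b : ℝ} (h : |b| ≤ 6) : huber b = b ^ 2 := if_pos h

lemma huber_le (b : ℝ) : huber b ≤ 12 * |b| := by
  unfold huber
  split_ifs with h
  · nlinarith [sq_abs b, abs_nonneg b]
  · linarith

lemma measurable_huber : Measurable huber :=
  Measurable.ite (measurableSet_le (by fun_prop) (by fun_prop)) (by fun_prop) (by fun_prop)

/-- A convex function which is strictly convex where `|b|` is comparable to `1`. -/
def bell (a b : ℝ) : ℝ := max 0 (a ^ 2 + huber b - 1)

lemma bell_convexOn : ConvexOn ℝ univ (fun z : ℝ × ℝ => bell z.1 z.2) := by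
  have h1 : ConvexOn ℝ univ (fun z : ℝ × ℝ => z.1 ^ 2) :=
    (even_two.convexOn_pow (𝕜 := ℝ)).comp_linearMap (LinearMap.fst ℝ ℝ ℝ)
  have h2 : ConvexOn ℝ univ (fun z : ℝ × ℝ => huber z.2) :=
    huber_convexOn.comp_linearMap (LinearMap.snd ℝ ℝ ℝ)
  have h3 := (convexOn_const (𝕜 := ℝ) (0 : ℝ) (convex_univ (E := ℝ × ℝ))).sup
    ((h1.add h2).add (convexOn_const (𝕜 := ℝ) (-1 : ℝ) (convex_univ (E := ℝ × ℝ))))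
  exact h3

lemma bell_gain {x y d e : ℝ} (h2 : 2 ≤ max |y| |e|) (h3 : max |y| |e| ≤ 3) :
    bell x y + |d| * |e| ≤ (bell (x + d) (y + e) + bell (x - d) (y - e)) / 2 := by
  have hy := (le_max_left _ _).trans h3
  have he := (le_max_right _ _).trans h3
  have hde : |d| * |e| ≤ (d ^ 2 + e ^ 2) / 2 := by
    nlinarith [sq_nonneg (|d| - |e|), sq_abs d, sq_abs e]
  have hp : |y + e| ≤ 6 := (abs_add_le _ _).trans (by linarith)
  have hm : |y - e| ≤ 6 := (abs_sub _ _).trans (by linarith)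
  unfold bell
  rw [huber_of_abs_le hp, huber_of_abs_le hm, huber_of_abs_le (hy.trans (by norm_num))]
  have k1 := le_max_right 0 ((x + d) ^ 2 + (y + e) ^ 2 - 1)
  have k2 := le_max_right 0 ((x - d) ^ 2 + (y - e) ^ 2 - 1)
  rcases le_total (x ^ 2 + y ^ 2 - 1) 0 with h | h
  · rw [max_eq_left h]
    have hy1 : |y| ≤ 1 := abs_le_one_iff_mul_self_le_one.2 (by nlinarith)
    have he2 : 2 ≤ |e| := by
      rcases le_max_iff.1 h2 with h | h
      · linarith
      · exact h
    nlinarith [sq_abs e]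
  · rw [max_eq_right h]
    nlinarith

lemma measurable_bell : Measurable (fun z : ℝ × ℝ => bell z.1 z.2) :=
  measurable_const.max (((measurable_fst.pow_const 2).add
    (measurable_huber.comp measurable_snd)).sub_const 1)

lemma bell_nonneg (a b : ℝ) : 0 ≤ bell a b := le_max_left _ _

lemma bell_le (a b : ℝ) : bell a b ≤ max 0 (a ^ 2 - 1 / 2) + max 0 (12 * |b| - 1 / 2) := by
  unfold bell
  have := huber_le b
  refine max_le (by positivity) ?_
  linarith [le_max_right 0 (a ^ 2 - 1 / 2), le_max_right 0 (12 * |b| - 1 / 2)]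

/-- `Q` is midpoint convex with gain `G`, and satisfies Jensen's inequality. -/
structure GainConvex (Q G : ℝ → ℝ → ℝ≥0∞) : Prop where
  meas : Measurable (fun z : ℝ × ℝ => Q z.1 z.2)
  meas_gain : Measurable (fun z : ℝ × ℝ => G z.1 z.2)
  gain : ∀ x y d e, Q x y + G d e ≤ 2⁻¹ * (Q (x + d) (y + e) + Q (x - d) (y - e))
  jensen : ∀ (ι : Type) [Fintype ι] [Nonempty ι] (a b : ι → ℝ),
    Q ((Fintype.card ι : ℝ)⁻¹ * ∑ k, a k) ((Fintype.card ι : ℝ)⁻¹ * ∑ k, b k)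
      ≤ (Fintype.card ι : ℝ≥0∞)⁻¹ * ∑ k, Q (a k) (b k)

lemma GainConvex.swap {Q G : ℝ → ℝ → ℝ≥0∞} (h : GainConvex Q G) :
    GainConvex (fun a b => Q b a) (fun a b => G b a) where
  meas := h.meas.comp measurable_swap
  meas_gain := h.meas_gain.comp measurable_swap
  gain x y d e := h.gain y x e d
  jensen ι _ _ a b := h.jensen ι b a

lemma jensen_average {f : ℝ → ℝ → ℝ} (hf : ConvexOn ℝ univ (fun z : ℝ × ℝ => f z.1 z.2))
    {ι : Type} [Fintype ι] [Nonempty ι] (a b : ι → ℝ) :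
    f ((Fintype.card ι : ℝ)⁻¹ * ∑ k, a k) ((Fintype.card ι : ℝ)⁻¹ * ∑ k, b k)
      ≤ (Fintype.card ι : ℝ)⁻¹ * ∑ k, f (a k) (b k) := by
  have := hf.map_sum_le (t := Finset.univ) (w := fun _ : ι => (Fintype.card ι : ℝ)⁻¹)
    (p := fun k => (a k, b k)) (fun _ _ => by positivity)
    (by simp) (fun _ _ => mem_univ _)
  simpa [Prod.fst_sum, Prod.snd_sum, ← Finset.mul_sum] using this

lemma ofReal_mean {ι : Type} [Fintype ι] [Nonempty ι] {f : ι → ℝ} (hf : ∀ k, 0 ≤ f k) :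
    ENNReal.ofReal ((Fintype.card ι : ℝ)⁻¹ * ∑ k, f k)
      = (Fintype.card ι : ℝ≥0∞)⁻¹ * ∑ k, ENNReal.ofReal (f k) := by
  rw [ENNReal.ofReal_mul (by positivity), ENNReal.ofReal_sum_of_nonneg (fun k _ => hf k),
    ENNReal.ofReal_inv_of_pos (by positivity), ENNReal.ofReal_natCast]

lemma gainConvex_sq : GainConvex (fun a b => ENNReal.ofReal (a ^ 2 + b ^ 2))
    (fun d e => ENNReal.ofReal (d ^ 2 + e ^ 2)) where
  meas := by fun_prop
  meas_gain := by fun_prop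
  gain x y d e := by
    rw [← ENNReal.ofReal_add (by positivity) (by positivity),
      ← ENNReal.ofReal_add (by positivity) (by positivity),
      show (2⁻¹ : ℝ≥0∞) = ENNReal.ofReal 2⁻¹ by
        rw [ENNReal.ofReal_inv_of_pos (by norm_num)]; simp,
      ← ENNReal.ofReal_mul (by positivity)]
    exact ENNReal.ofReal_le_ofReal (by nlinarith)
  jensen ι _ _ a b := by
    have h1 : ConvexOn ℝ univ (fun z : ℝ × ℝ => z.1 ^ 2) :=
      (even_two.convexOn_pow (𝕜 := ℝ)).comp_linearMap (LinearMap.fst ℝ ℝ ℝ)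
    have h2 : ConvexOn ℝ univ (fun z : ℝ × ℝ => z.2 ^ 2) :=
      (even_two.convexOn_pow (𝕜 := ℝ)).comp_linearMap (LinearMap.snd ℝ ℝ ℝ)
    rw [← ofReal_mean (fun k => by positivity)]
    exact ENNReal.ofReal_le_ofReal
      (jensen_average (f := fun a b => a ^ 2 + b ^ 2) (h1.add h2) a b)

/-- Superposition of rescaled copies of `bell`. -/
def bellman (q a b : ℝ) : ℝ≥0∞ :=
  ∫⁻ t in Ioi (0 : ℝ), ENNReal.ofReal (t ^ (q - 1) * bell (a / t ^ (q - 1)) (b / t))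

lemma measurable_bellman_integrand (q : ℝ) : Measurable (fun z : (ℝ × ℝ) × ℝ =>
    ENNReal.ofReal (z.2 ^ (q - 1) * bell (z.1.1 / z.2 ^ (q - 1)) (z.1.2 / z.2))) := by
  have h : Measurable (fun z : (ℝ × ℝ) × ℝ => z.2 ^ (q - 1)) := measurable_snd.pow_const _
  exact (h.mul (measurable_bell.comp
    ((measurable_fst.fst.div h).prodMk (measurable_fst.snd.div measurable_snd)))).ennreal_ofReal

lemma measurable_bellman_section (q a b : ℝ) : Measurable (fun t : ℝ =>
    ENNReal.ofReal (t ^ (q - 1) * bell (a / t ^ (q - 1)) (b / t))) :=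
  (measurable_bellman_integrand q).comp (measurable_prodMk_left (x := (a, b)))

lemma gainConvex_bellman (q : ℝ) :
    GainConvex (bellman q) (fun d e => ENNReal.ofReal (|d| * |e| / 3)) where
  meas := (measurable_bellman_integrand q).lintegral_prod_right'
  meas_gain := by fun_prop
  gain x y d e := by
    have hF := measurable_bellman_section q
    set m := max |y| |e| with hm
    have hG : ENNReal.ofReal (|d| * |e| / 3) ≤ ∫⁻ t in Ioi (0 : ℝ),
        (Icc (m / 3) (m / 2)).indicator (fun t => ENNReal.ofReal (|d| * |e| / t)) t := by
      by_cases hm0 : m = 0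
      · have he : |e| = 0 := le_antisymm ((le_max_right _ _).trans hm0.le) (abs_nonneg _)
        simp [he]
      have hmpos : 0 < m := lt_of_le_of_ne (le_max_of_le_left (abs_nonneg _)) (Ne.symm hm0)
      have hsub : Icc (m / 3) (m / 2) ⊆ Ioi 0 := fun t ht =>
        lt_of_lt_of_le (by positivity) ht.1
      rw [setLIntegral_indicator measurableSet_Icc, inter_eq_left.2 hsub]
      calc ENNReal.ofReal (|d| * |e| / 3)
          = ∫⁻ _ in Icc (m / 3) (m / 2), ENNReal.ofReal (|d| * |e| / (m / 2)) := by
            rw [setLIntegral_const, Real.volume_Icc, ← ENNReal.ofReal_mul (by positivity)]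
            congr 1
            field_simp
            norm_num
        _ ≤ _ := by
            refine setLIntegral_mono' measurableSet_Icc fun t ht => ENNReal.ofReal_le_ofReal ?_
            exact div_le_div_of_nonneg_left (by positivity) (hsub ht) ht.2
    refine (add_le_add_right hG _).trans ?_
    unfold bellman
    rw [← lintegral_add_left (hF _ _), ← lintegral_add_left (hF _ _),
      ← lintegral_const_mul' _ _ (by simp)]
    refine setLIntegral_mono' measurableSet_Ioi fun t ht => ?_
    have ht' : (0 : ℝ) < t := ht
    have htp : 0 < t ^ (q - 1) := Real.rpow_pos_of_pos ht' _
    rw [← ENNReal.ofReal_add (mul_nonneg htp.le (bell_nonneg _ _))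
      (mul_nonneg htp.le (bell_nonneg _ _)),
      show (2⁻¹ : ℝ≥0∞) = ENNReal.ofReal 2⁻¹ by
        rw [ENNReal.ofReal_inv_of_pos (by norm_num)]; simp,
      ← ENNReal.ofReal_mul (by positivity)]
    by_cases htI : t ∈ Icc (m / 3) (m / 2)
    · rw [indicator_of_mem htI, ← ENNReal.ofReal_add (mul_nonneg htp.le (bell_nonneg _ _))
        (by positivity)]
      refine ENNReal.ofReal_le_ofReal ?_
      have hmax : max |y / t| |e / t| = m / t := by
        rw [abs_div, abs_div, abs_of_pos ht', hm, max_div_div_right ht'.le]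
      have := bell_gain (x := x / t ^ (q - 1)) (y := y / t) (d := d / t ^ (q - 1))
        (e := e / t) (by rw [hmax, le_div_iff₀ ht']; linarith [htI.2])
        (by rw [hmax, div_le_iff₀ ht']; linarith [htI.1])
      rw [← add_div, ← add_div, ← sub_div, ← sub_div, abs_div, abs_div, abs_of_pos ht',
        abs_of_pos htp] at this
      have := mul_le_mul_of_nonneg_left this htp.le
      have h4 : t ^ (q - 1) * (|d| / t ^ (q - 1) * (|e| / t)) = |d| * |e| / t := by
        field_simp
      linarith
    · rw [indicator_of_notMem htI, add_zero]
      refine ENNReal.ofReal_le_ofReal ?_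
      have := bell_convexOn.2 (mem_univ ((x + d) / t ^ (q - 1), (y + e) / t))
        (mem_univ ((x - d) / t ^ (q - 1), (y - e) / t)) (show (0 : ℝ) ≤ 2⁻¹ by norm_num)
        (show (0 : ℝ) ≤ 2⁻¹ by norm_num) (by norm_num)
      simp only [Prod.smul_mk, Prod.mk_add_mk, smul_eq_mul] at this
      rw [show 2⁻¹ * ((x + d) / t ^ (q - 1)) + 2⁻¹ * ((x - d) / t ^ (q - 1)) = x / t ^ (q - 1) by
        ring, show 2⁻¹ * ((y + e) / t) + 2⁻¹ * ((y - e) / t) = y / t by ring] at this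
      have := mul_le_mul_of_nonneg_left this htp.le
      linarith
  jensen ι _ _ a b := by
    have hF := measurable_bellman_section q
    unfold bellman
    rw [← lintegral_finsetSum _ (fun k _ => hF (a k) (b k)), ← lintegral_const_mul _
      (Finset.measurable_fun_sum _ fun k _ => hF (a k) (b k))]
    refine setLIntegral_mono' measurableSet_Ioi fun t ht => ?_
    have htp : 0 < t ^ (q - 1) := Real.rpow_pos_of_pos ht _
    rw [← ofReal_mean (fun k => mul_nonneg htp.le (bell_nonneg _ _))]
    refine ENNReal.ofReal_le_ofReal ?_
    have := jensen_average bell_convexOn (fun k => a k / t ^ (q - 1)) (fun k => b k / t)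
    rw [← Finset.sum_div, ← Finset.sum_div, ← mul_div_assoc, ← mul_div_assoc] at this
    have := mul_le_mul_of_nonneg_left this htp.le
    rw [← Finset.mul_sum]
    linarith

lemma bellman_le {q : ℝ} (hq1 : 1 < q) (hq2 : q < 2) : ∃ C : ℝ, 0 < C ∧ ∀ a b : ℝ,
    bellman q a b ≤ ENNReal.ofReal C *
      (ENNReal.ofReal (|a| ^ (q / (q - 1))) + ENNReal.ofReal (|b| ^ q)) := by
  have key : ∀ (T c r : ℝ), 0 ≤ T → 0 ≤ c → 0 < r →
      ∫⁻ t in Ioi (0 : ℝ), (Ioc 0 T).indicator (fun t => ENNReal.ofReal (c * t ^ (r - 1))) t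
        = ENNReal.ofReal (c * (T ^ r / r)) := by
    intro T c r hT hc hr
    rw [setLIntegral_indicator measurableSet_Ioc, inter_eq_left.2 (fun t ht => ht.1),
      ← ofReal_integral_eq_lintegral_ofReal, ← intervalIntegral.integral_of_le hT,
      intervalIntegral.integral_const_mul, integral_rpow (Or.inl (by linarith))]
    · simp [Real.zero_rpow hr.ne']
    · exact ((intervalIntegral.intervalIntegrable_rpow' (by linarith)).1).const_mul c
    · refine (ae_restrict_iff' measurableSet_Ioc).2 (Filter.Eventually.of_forall fun t ht => ?_)
      have := ht.1
      positivity
  have hq0 : 0 < q - 1 := by linarith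
  set p := q / (q - 1)
  set s := 1 / (q - 1) with hs
  have hs0 : 0 < s := by positivity
  refine ⟨2 ^ (s * (2 - q)) / (2 - q) + 12 * 24 ^ (q - 1) / (q - 1), ?_, fun a b => ?_⟩
  · have : 0 < 2 - q := by linarith
    positivity
  set C1 := (2 : ℝ) ^ (s * (2 - q)) / (2 - q) with hC1
  set C2 := (12 : ℝ) * 24 ^ (q - 1) / (q - 1) with hC2
  have hC1p : 0 ≤ C1 := by
    have : 0 < 2 - q := by linarith
    positivity
  have hC2p : 0 ≤ C2 := by positivity
  have hpt : ∀ t ∈ Ioi (0 : ℝ), ENNReal.ofReal (t ^ (q - 1) * bell (a / t ^ (q - 1)) (b / t)) ≤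
      (Ioc 0 ((2 * |a|) ^ s)).indicator
        (fun t => ENNReal.ofReal (a ^ 2 * t ^ ((2 - q) - 1))) t +
      (Ioc 0 (24 * |b|)).indicator
        (fun t => ENNReal.ofReal ((12 * |b|) * t ^ ((q - 1) - 1))) t := by
    intro t ht
    have ht' : (0 : ℝ) < t := ht
    have htp : 0 < t ^ (q - 1) := Real.rpow_pos_of_pos ht' _
    refine (ENNReal.ofReal_le_ofReal (mul_le_mul_of_nonneg_left (bell_le _ _) htp.le)).trans ?_
    rw [mul_add, ENNReal.ofReal_add (by positivity) (by positivity)]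
    refine add_le_add ?_ ?_
    · by_cases h : t ∈ Ioc 0 ((2 * |a|) ^ s)
      · rw [indicator_of_mem h]
        refine ENNReal.ofReal_le_ofReal ?_
        have h1 : max 0 ((a / t ^ (q - 1)) ^ 2 - 1 / 2) ≤ (a / t ^ (q - 1)) ^ 2 :=
          max_le (by positivity) (by linarith)
        refine (mul_le_mul_of_nonneg_left h1 htp.le).trans (le_of_eq ?_)
        rw [show (2 - q) - 1 = -(q - 1) by ring, Real.rpow_neg ht'.le]
        field_simp
      · rw [indicator_of_notMem h]
        have h2 : (2 * |a|) ^ s < t := by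
          by_contra hc
          exact h ⟨ht', not_lt.1 hc⟩
        have h3 : 2 * |a| < t ^ (q - 1) := by
          have := Real.rpow_lt_rpow (by positivity) h2 hq0
          rwa [← Real.rpow_mul (by positivity), hs, one_div_mul_cancel hq0.ne',
            Real.rpow_one] at this
        have h4 : |a / t ^ (q - 1)| ≤ 1 / 2 := by
          rw [abs_div, abs_of_pos htp, div_le_iff₀ htp]
          linarith
        have h5 : (a / t ^ (q - 1)) ^ 2 - 1 / 2 ≤ 0 := by
          nlinarith [sq_abs (a / t ^ (q - 1)), abs_nonneg (a / t ^ (q - 1))]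
        rw [max_eq_left h5]
        simp
    · by_cases h : t ∈ Ioc 0 (24 * |b|)
      · rw [indicator_of_mem h]
        refine ENNReal.ofReal_le_ofReal ?_
        have h1 : max 0 (12 * |b / t| - 1 / 2) ≤ 12 * |b / t| :=
          max_le (by positivity) (by linarith)
        refine (mul_le_mul_of_nonneg_left h1 htp.le).trans (le_of_eq ?_)
        rw [abs_div, abs_of_pos ht', Real.rpow_sub_one ht'.ne' (q - 1)]
        ring
      · rw [indicator_of_notMem h]
        have h2 : 24 * |b| < t := by
          by_contra hc
          exact h ⟨ht', not_lt.1 hc⟩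
        have h4 : |b / t| ≤ 1 / 24 := by
          rw [abs_div, abs_of_pos ht', div_le_iff₀ ht']
          linarith
        rw [max_eq_left (by linarith)]
        simp
  calc bellman q a b ≤ _ := setLIntegral_mono' measurableSet_Ioi hpt
    _ = ENNReal.ofReal (a ^ 2 * (((2 * |a|) ^ s) ^ (2 - q) / (2 - q))) +
        ENNReal.ofReal ((12 * |b|) * ((24 * |b|) ^ (q - 1) / (q - 1))) := by
      rw [lintegral_add_left]
      · rw [key _ _ _ (by positivity) (by positivity) (by linarith),
          key _ _ _ (by positivity) (by positivity) (by linarith)]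
      · exact Measurable.indicator (by fun_prop) measurableSet_Ioc
    _ = ENNReal.ofReal C1 * ENNReal.ofReal (|a| ^ p) + ENNReal.ofReal C2 * ENNReal.ofReal (|b| ^ q) := by
      rw [← ENNReal.ofReal_mul hC1p, ← ENNReal.ofReal_mul hC2p]
      congr 2
      · rw [← Real.rpow_mul (by positivity), Real.mul_rpow (by norm_num) (abs_nonneg _), hC1]
        have : |a| ^ p = a ^ 2 * |a| ^ (s * (2 - q)) := by
          have e1 : p = 2 + s * (2 - q) := by
            simp only [p, hs]
            field_simp
            ring
          rw [e1, Real.rpow_add_of_nonneg (abs_nonneg _) (by norm_num)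
            (mul_nonneg hs0.le (by linarith)), Real.rpow_two, sq_abs]
        rw [this]
        ring
      · rw [Real.mul_rpow (by norm_num) (abs_nonneg _), hC2]
        have : |b| ^ q = |b| * |b| ^ (q - 1) := by
          conv_lhs => rw [show q = 1 + (q - 1) by ring]
          rw [Real.rpow_add_of_nonneg (abs_nonneg _) (by norm_num) hq0.le, Real.rpow_one]
        rw [this]
        ring
    _ ≤ _ := by
      rw [ENNReal.ofReal_add hC1p hC2p, mul_add]
      exact add_le_add (by gcongr; exact le_self_add) (by gcongr; exact le_add_self)

/-- Nazarov-Treil type Bellman functions exist for all pairs of conjugate exponents. -/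
lemma exists_gainConvex {q p : ℝ} (hqp : q.HolderConjugate p) :
    ∃ Q : ℝ → ℝ → ℝ≥0∞, GainConvex Q (fun d e => ENNReal.ofReal (|d| * |e| / 3)) ∧
      ∃ C : ℝ, 0 < C ∧ ∀ a b, Q a b ≤ ENNReal.ofReal C *
        (ENNReal.ofReal (|a| ^ q) + ENNReal.ofReal (|b| ^ p)) := by
  rcases lt_trichotomy q 2 with h | h | h
  · obtain ⟨C, hC, hb⟩ := bellman_le hqp.lt h
    refine ⟨fun a b => bellman q b a, by simpa only [mul_comm] using (gainConvex_bellman q).swap,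
      C, hC, fun a b => ?_⟩
    rw [hqp.conjugate_eq, add_comm]
    exact hb b a
  · subst h
    have hp : p = 2 := by rw [hqp.conjugate_eq]; norm_num
    subst hp
    refine ⟨fun a b => ENNReal.ofReal (a ^ 2 + b ^ 2), ⟨gainConvex_sq.meas, by fun_prop, fun x y d e => ?_, gainConvex_sq.jensen⟩,
      1, one_pos, fun a b => ?_⟩
    · refine le_trans (add_le_add_right (ENNReal.ofReal_le_ofReal ?_) _)
        (gainConvex_sq.gain x y d e)
      nlinarith [sq_nonneg (|d| - |e|), sq_abs d, sq_abs e]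
    · simp only [Real.rpow_two, sq_abs, ENNReal.ofReal_one, one_mul]
      rw [ENNReal.ofReal_add (by positivity) (by positivity)]
  · have hp2 : p < 2 := by
      rw [hqp.conjugate_eq, div_lt_iff₀ (by linarith)]
      linarith
    obtain ⟨C, hC, hb⟩ := bellman_le hqp.symm.lt hp2
    refine ⟨bellman p, gainConvex_bellman p, C, hC, fun a b => ?_⟩
    have := hb a b
    rwa [← hqp.symm.conjugate_eq] at this

section RandomWalk

variable {ι : Type} [Fintype ι]

/-- Average of `u` over the points `x ± σ k`. -/
def symMean (σ : ι → E3) (u : E3 → ℝ) (x : E3) : ℝ :=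
  (Fintype.card ι : ℝ)⁻¹ * ∑ k, (u (x + σ k) + u (x - σ k)) / 2

/-- Half the central difference of `u` in the direction `v`. -/
def halfDiff (v : E3) (u : E3 → ℝ) (x : E3) : ℝ := (u (x + v) - u (x - v)) / 2

lemma measurable_symMean (σ : ι → E3) {u : E3 → ℝ} (hu : Measurable u) :
    Measurable (symMean σ u) := by
  unfold symMean; fun_prop

lemma measurable_halfDiff (v : E3) {u : E3 → ℝ} (hu : Measurable u) :
    Measurable (halfDiff v u) := by
  unfold halfDiff; fun_prop

lemma lintegral_symMean_add_gain_le [Nonempty ι] {Q G : ℝ → ℝ → ℝ≥0∞} (h : GainConvex Q G)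
    (σ : ι → E3) {u v : E3 → ℝ} (hu : Measurable u) (hv : Measurable v) :
    (∫⁻ x, Q (symMean σ u x) (symMean σ v x))
      + (Fintype.card ι : ℝ≥0∞)⁻¹ * ∑ k, ∫⁻ x, G (halfDiff (σ k) u x) (halfDiff (σ k) v x)
      ≤ ∫⁻ x, Q (u x) (v x) := by
  have hcard : (Fintype.card ι : ℝ≥0∞) ≠ 0 := by simp
  have hcinv : (Fintype.card ι : ℝ≥0∞)⁻¹ ≠ ∞ := ENNReal.inv_ne_top.2 hcard
  have hQ : ∀ {f g : E3 → ℝ}, Measurable f → Measurable g → Measurable fun x => Q (f x) (g x) :=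
    fun hf hg => h.meas.comp (hf.prodMk hg)
  have hG : ∀ {f g : E3 → ℝ}, Measurable f → Measurable g → Measurable fun x => G (f x) (g x) :=
    fun hf hg => h.meas_gain.comp (hf.prodMk hg)
  have hGk := fun k => hG (measurable_halfDiff (σ k) hu) (measurable_halfDiff (σ k) hv)
  rw [← lintegral_finsetSum _ (fun k _ => hGk k), ← lintegral_const_mul' _ _ hcinv,
    ← lintegral_add_left (hQ (measurable_symMean σ hu) (measurable_symMean σ hv))]
  calc _ ≤ ∫⁻ x, (Fintype.card ι : ℝ≥0∞)⁻¹ * ∑ k, 2⁻¹ *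
          (Q (u (x + σ k)) (v (x + σ k)) + Q (u (x - σ k)) (v (x - σ k))) := by
        refine lintegral_mono fun x => ?_
        refine (add_le_add_left (h.jensen ι (fun k => (u (x + σ k) + u (x - σ k)) / 2)
          (fun k => (v (x + σ k) + v (x - σ k)) / 2)) _).trans ?_
        rw [← mul_add, ← Finset.sum_add_distrib]
        gcongr with k
        refine (h.gain _ _ _ _).trans (le_of_eq ?_)
        unfold halfDiff
        congr 3 <;> ring
    _ = ∫⁻ x, Q (u x) (v x) := by
        have hp : ∀ k, Measurable fun x => Q (u (x + σ k)) (v (x + σ k)) := fun k =>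
          hQ (by fun_prop) (by fun_prop)
        have hm : ∀ k, Measurable fun x => Q (u (x - σ k)) (v (x - σ k)) := fun k =>
          hQ (by fun_prop) (by fun_prop)
        have hpm : ∀ k, Measurable fun x =>
            2⁻¹ * (Q (u (x + σ k)) (v (x + σ k)) + Q (u (x - σ k)) (v (x - σ k))) :=
          fun k => ((hp k).add (hm k)).const_mul _
        rw [lintegral_const_mul' _ _ hcinv, lintegral_finsetSum _ (fun k _ => hpm k)]
        have : ∀ k, ∫⁻ x, 2⁻¹ * (Q (u (x + σ k)) (v (x + σ k)) + Q (u (x - σ k)) (v (x - σ k)))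
            = ∫⁻ x, Q (u x) (v x) := by
          intro k
          rw [lintegral_const_mul' _ _ (by simp), lintegral_add_left (hp k),
            lintegral_add_right_eq_self (fun x => Q (u x) (v x)),
            lintegral_sub_right_eq_self (fun x => Q (u x) (v x)), ← two_mul, ← mul_assoc,
            ENNReal.inv_mul_cancel (by simp) (by simp), one_mul]
        simp only [this, Finset.sum_const, Finset.card_univ, nsmul_eq_mul]
        rw [← mul_assoc, ENNReal.inv_mul_cancel hcard (by simp), one_mul]

lemma measurable_symMean_iterate (σ : ι → E3) {u : E3 → ℝ} (hu : Measurable u) (n : ℕ) :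
    Measurable ((symMean σ)^[n] u) := by
  induction n with
  | zero => exact hu
  | succ n ih => rw [Function.iterate_succ_apply']; exact measurable_symMean σ ih

lemma sum_lintegral_gain_le [Nonempty ι] {Q G : ℝ → ℝ → ℝ≥0∞} (h : GainConvex Q G)
    (σ : ι → E3) {u v : E3 → ℝ} (hu : Measurable u) (hv : Measurable v) (k : ι) (N : ℕ) :
    ∑ n ∈ Finset.range N, ∫⁻ x, G (halfDiff (σ k) ((symMean σ)^[n] u) x)
        (halfDiff (σ k) ((symMean σ)^[n] v) x)
      ≤ Fintype.card ι * ∫⁻ x, Q (u x) (v x) := by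
  have hcard : (Fintype.card ι : ℝ≥0∞) ≠ 0 := by simp
  have key : (∫⁻ x, Q ((symMean σ)^[N] u x) ((symMean σ)^[N] v x)) + (Fintype.card ι : ℝ≥0∞)⁻¹ *
      ∑ n ∈ Finset.range N, ∫⁻ x, G (halfDiff (σ k) ((symMean σ)^[n] u) x)
        (halfDiff (σ k) ((symMean σ)^[n] v) x) ≤ ∫⁻ x, Q (u x) (v x) := by
    induction N with
    | zero => simp
    | succ N ih =>
      refine le_trans ?_ ih
      rw [Finset.sum_range_succ, mul_add, add_comm (_ * ∑ n ∈ _, _), ← add_assoc]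
      gcongr
      refine le_trans ?_ (lintegral_symMean_add_gain_le h σ
        (measurable_symMean_iterate σ hu N) (measurable_symMean_iterate σ hv N))
      simp only [Function.iterate_succ_apply']
      gcongr
      exact Finset.single_le_sum (f := fun k => ∫⁻ x, G (halfDiff (σ k) ((symMean σ)^[N] u) x)
        (halfDiff (σ k) ((symMean σ)^[N] v) x)) (fun _ _ => zero_le) (Finset.mem_univ k)
  have := le_trans le_add_self key
  calc _ = Fintype.card ι * ((Fintype.card ι : ℝ≥0∞)⁻¹ * _) := by
        rw [← mul_assoc, ENNReal.mul_inv_cancel hcard (by simp), one_mul]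
    _ ≤ _ := by gcongr

lemma memLp_comp_add {u : E3 → ℝ} (hu : MemLp u 2) (v : E3) : MemLp (fun x => u (x + v)) 2 :=
  hu.comp_measurePreserving (measurePreserving_add_right volume v)

lemma memLp_comp_sub {u : E3 → ℝ} (hu : MemLp u 2) (v : E3) : MemLp (fun x => u (x - v)) 2 :=
  hu.comp_measurePreserving (measurePreserving_sub_right volume v)

lemma memLp_symMean (σ : ι → E3) {u : E3 → ℝ} (hu : MemLp u 2) : MemLp (symMean σ u) 2 := by
  have : symMean σ u = fun x => (Fintype.card ι : ℝ)⁻¹ *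
      ∑ k, (2⁻¹ : ℝ) * (u (x + σ k) + u (x - σ k)) := by
    funext x; simp only [symMean, div_eq_inv_mul]
  rw [this]
  exact (memLp_finsetSum _ fun k _ =>
    ((memLp_comp_add hu (σ k)).add (memLp_comp_sub hu (σ k))).const_mul _).const_mul _

lemma memLp_symMean_iterate (σ : ι → E3) {u : E3 → ℝ} (hu : MemLp u 2) (n : ℕ) :
    MemLp ((symMean σ)^[n] u) 2 := by
  induction n with
  | zero => exact hu
  | succ n ih => rw [Function.iterate_succ_apply']; exact memLp_symMean σ ih

lemma memLp_halfDiff (v : E3) {u : E3 → ℝ} (hu : MemLp u 2) : MemLp (halfDiff v u) 2 := by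
  have : halfDiff v u = fun x => (2⁻¹ : ℝ) * (u (x + v) - u (x - v)) := by
    funext x; simp only [halfDiff, div_eq_inv_mul]
  rw [this]
  exact ((memLp_comp_add hu v).sub (memLp_comp_sub hu v)).const_mul _

lemma integrable_mul_of_memLp {u v : E3 → ℝ} (hu : MemLp u 2) (hv : MemLp v 2) :
    Integrable (fun x => u x * v x) := hu.integrable_mul hv

lemma integral_symMean_mul (σ : ι → E3) {u v : E3 → ℝ} (hu : MemLp u 2) (hv : MemLp v 2) :
    ∫ x, symMean σ u x * v x = ∫ x, u x * symMean σ v x := by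
  have e1 : ∀ k, ∫ x, u (x + σ k) * v x = ∫ x, u x * v (x - σ k) := fun k => by
    rw [← integral_sub_right_eq_self (fun x => u (x + σ k) * v x) (σ k)]
    simp
  have e2 : ∀ k, ∫ x, u (x - σ k) * v x = ∫ x, u x * v (x + σ k) := fun k => by
    rw [← integral_add_right_eq_self (fun x => u (x - σ k) * v x) (σ k)]
    simp
  have i1 := fun k => integrable_mul_of_memLp (memLp_comp_add hu (σ k)) hv
  have i2 := fun k => integrable_mul_of_memLp (memLp_comp_sub hu (σ k)) hv
  have i3 := fun k => integrable_mul_of_memLp hu (memLp_comp_add hv (σ k))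
  have i4 := fun k => integrable_mul_of_memLp hu (memLp_comp_sub hv (σ k))
  calc ∫ x, symMean σ u x * v x
      = ∫ x, (Fintype.card ι : ℝ)⁻¹ * ∑ k, (2⁻¹ : ℝ) * (u (x + σ k) * v x + u (x - σ k) * v x) := by
        refine integral_congr_ae (Filter.Eventually.of_forall fun x => ?_)
        simp only [symMean, mul_assoc, Finset.sum_mul]
        congr 1
        exact Finset.sum_congr rfl fun k _ => by ring
    _ = ∫ x, (Fintype.card ι : ℝ)⁻¹ * ∑ k, (2⁻¹ : ℝ) * (u x * v (x + σ k) + u x * v (x - σ k)) := by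
        have j1 : ∀ k, Integrable fun x => (2⁻¹ : ℝ) * (u (x + σ k) * v x + u (x - σ k) * v x) :=
          fun k => ((i1 k).add (i2 k)).const_mul _
        have j2 : ∀ k, Integrable fun x => (2⁻¹ : ℝ) * (u x * v (x + σ k) + u x * v (x - σ k)) :=
          fun k => ((i3 k).add (i4 k)).const_mul _
        rw [integral_const_mul, integral_const_mul, integral_finsetSum _ (fun k _ => j1 k),
          integral_finsetSum _ (fun k _ => j2 k)]
        congr 1
        refine Finset.sum_congr rfl fun k _ => ?_
        rw [integral_const_mul, integral_const_mul, integral_add (i1 k) (i2 k),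
          integral_add (i3 k) (i4 k), e1, e2, add_comm]
    _ = _ := by
        refine integral_congr_ae (Filter.Eventually.of_forall fun x => ?_)
        simp only [symMean, Finset.mul_sum]
        exact Finset.sum_congr rfl fun k _ => by ring

lemma symMean_sub (σ : ι → E3) (u v : E3 → ℝ) :
    symMean σ (u - v) = symMean σ u - symMean σ v := by
  funext x
  simp only [symMean, Pi.sub_apply, ← mul_sub, ← Finset.sum_sub_distrib]
  congr 1
  exact Finset.sum_congr rfl fun k _ => by ring

lemma symMean_iterate_sub (σ : ι → E3) (u v : E3 → ℝ) (n : ℕ) :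
    (symMean σ)^[n] (u - v) = (symMean σ)^[n] u - (symMean σ)^[n] v := by
  induction n with
  | zero => rfl
  | succ n ih => simp only [Function.iterate_succ_apply', ih, symMean_sub]

lemma halfDiff_sub (w : E3) (u v : E3 → ℝ) :
    halfDiff w (u - v) = halfDiff w u - halfDiff w v := by
  funext x
  simp only [halfDiff, Pi.sub_apply]
  ring

lemma halfDiff_symMean (σ : ι → E3) (w : E3) (u : E3 → ℝ) :
    halfDiff w (symMean σ u) = symMean σ (halfDiff w u) := by
  funext x
  simp only [halfDiff, symMean, ← mul_sub, ← Finset.sum_sub_distrib, mul_div_assoc, Finset.sum_div]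
  congr 1
  refine Finset.sum_congr rfl fun k _ => ?_
  rw [add_right_comm x w, sub_add_eq_add_sub x w, add_sub_right_comm x w, sub_right_comm x w]
  ring

lemma abs_integral_halfDiff_mul_le [Nonempty ι] {q p : ℝ} (hqp : q.HolderConjugate p) :
    ∃ C : ℝ, 0 < C ∧ ∀ (σ : ι → E3) (k : ι) (φ g : E3 → ℝ), Measurable φ → Measurable g →
      MemLp φ 2 → MemLp g 2 →
      ENNReal.ofReal |∫ x, halfDiff (σ k) φ x * halfDiff (σ k) g x| ≤ ENNReal.ofReal C *
        ((∫⁻ x, ENNReal.ofReal (|symMean σ (symMean σ φ) x - φ x| ^ q))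
          + ∫⁻ x, ENNReal.ofReal (|g x| ^ p)) := by
  obtain ⟨Q, hQ, C, hC, hQC⟩ := exists_gainConvex hqp
  refine ⟨3 * Fintype.card ι * C, by positivity, fun σ k φ g mφ mg hφ hg => ?_⟩
  set M := symMean σ
  set D := halfDiff (σ k)
  set f : E3 → ℝ := M (M φ) - φ with hf
  have mf : Measurable f := (measurable_symMean σ (measurable_symMean σ mφ)).sub mφ
  have hfL : MemLp f 2 := (memLp_symMean σ (memLp_symMean σ hφ)).sub hφ
  have lφ := fun n => memLp_symMean_iterate σ hφ n
  have lg := fun n => memLp_symMean_iterate σ hg n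
  have lf := fun n => memLp_symMean_iterate σ hfL n
  set a : ℕ → ℝ := fun n => ∫ x, D (M^[n] φ) x * D (M^[n] g) x with ha
  set b : ℕ → ℝ := fun n => ∫ x, D (M^[n] f) x * D (M^[n] g) x with hb
  have hstep : ∀ n, a (n + 1) - a n = b n := by
    intro n
    have h1 : a (n + 1) = ∫ x, D (M (M (M^[n] φ))) x * D (M^[n] g) x := by
      simp only [ha, Function.iterate_succ_apply', D, M, halfDiff_symMean σ (σ k) (_^[n] g)]
      rw [← integral_symMean_mul σ (memLp_halfDiff _ (memLp_symMean σ (lφ n)))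
        (memLp_halfDiff _ (lg n)), ← halfDiff_symMean]
    have h2 : M^[n] f = M (M (M^[n] φ)) - M^[n] φ := by
      rw [hf, symMean_iterate_sub, ← Function.iterate_succ_apply, ← Function.iterate_succ_apply,
        Function.iterate_succ_apply', Function.iterate_succ_apply']
    rw [h1]
    simp only [ha, hb]
    rw [← integral_sub (integrable_mul_of_memLp
      (memLp_halfDiff _ (memLp_symMean σ (memLp_symMean σ (lφ n)))) (memLp_halfDiff _ (lg n)))
      (integrable_mul_of_memLp (memLp_halfDiff _ (lφ n)) (memLp_halfDiff _ (lg n))), h2]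
    refine integral_congr_ae (Filter.Eventually.of_forall fun x => ?_)
    simp only [D, halfDiff_sub, Pi.sub_apply]
    ring
  have htel : ∀ N, a N - a 0 = ∑ n ∈ Finset.range N, b n := fun N => by
    rw [← Finset.sum_range_sub]
    exact Finset.sum_congr rfl fun n _ => hstep n
  set X : ℝ≥0∞ := ENNReal.ofReal (3 * Fintype.card ι * C) *
        ((∫⁻ x, ENNReal.ofReal (|f x| ^ q)) + ∫⁻ x, ENNReal.ofReal (|g x| ^ p)) with hX
  have hbsum : ∀ N, ∑ n ∈ Finset.range N, ENNReal.ofReal |b n| ≤ X := by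
    intro N
    have h1 := sum_lintegral_gain_le hQ σ mf mg k N
    have h2 : ∀ n, ENNReal.ofReal |b n| ≤ 3 * ∫⁻ x, ENNReal.ofReal (|D (M^[n] f) x| *
        |D (M^[n] g) x| / 3) := by
      intro n
      rw [← lintegral_const_mul' _ _ (by simp)]
      rw [← Real.norm_eq_abs, ofReal_norm]
      refine (enorm_integral_le_lintegral_enorm _).trans (lintegral_mono fun x => ?_)
      rw [← ofReal_norm, Real.norm_eq_abs, abs_mul,
        show (3 : ℝ≥0∞) = ENNReal.ofReal 3 by simp, ← ENNReal.ofReal_mul (by norm_num)]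
      exact ENNReal.ofReal_le_ofReal (le_of_eq (by ring))
    calc _ ≤ ∑ n ∈ Finset.range N, 3 * ∫⁻ x, ENNReal.ofReal (|D (M^[n] f) x| *
        |D (M^[n] g) x| / 3) := Finset.sum_le_sum fun n _ => h2 n
      _ ≤ 3 * (Fintype.card ι * ∫⁻ x, Q (f x) (g x)) := by
        rw [← Finset.mul_sum]
        gcongr
      _ ≤ 3 * (Fintype.card ι * (ENNReal.ofReal C * ((∫⁻ x, ENNReal.ofReal (|f x| ^ q))
            + ∫⁻ x, ENNReal.ofReal (|g x| ^ p)))) := by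
        gcongr
        rw [← lintegral_add_left (by fun_prop), ← lintegral_const_mul' _ _ (by simp)]
        exact lintegral_mono fun x => hQC _ _
      _ = X := by
        rw [hX, ENNReal.ofReal_mul (by positivity), ENNReal.ofReal_mul (by positivity)]
        simp only [ENNReal.ofReal_natCast, ENNReal.ofReal_ofNat]
        ring
  have htail : Filter.Tendsto (fun N => ENNReal.ofReal |a N|) Filter.atTop (nhds 0) := by
    set c : ℕ → ℝ≥0∞ := fun n => ∫⁻ x, ENNReal.ofReal ((D (M^[n] φ) x) ^ 2 + (D (M^[n] g) x) ^ 2)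
    have hfin : ∫⁻ x, ENNReal.ofReal (φ x ^ 2 + g x ^ 2) ≠ ∞ := by
      have := (hφ.integrable_sq.add hg.integrable_sq).lintegral_lt_top
      exact this.ne
    have hc : ∑' n, c n ≠ ∞ := by
      refine ne_top_of_le_ne_top ?_ (ENNReal.tsum_le_of_sum_range_le
        (fun N => sum_lintegral_gain_le gainConvex_sq σ mφ mg k N))
      exact ENNReal.mul_ne_top (by simp) hfin
    refine tendsto_of_tendsto_of_tendsto_of_le_of_le tendsto_const_nhds
      (ENNReal.tendsto_atTop_zero_of_tsum_ne_top hc) (fun _ => zero_le) fun n => ?_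
    rw [← Real.norm_eq_abs, ofReal_norm]
    refine (enorm_integral_le_lintegral_enorm _).trans (lintegral_mono fun x => ?_)
    rw [← ofReal_norm, Real.norm_eq_abs, abs_mul]
    refine ENNReal.ofReal_le_ofReal ?_
    nlinarith [sq_nonneg (|D (M^[n] φ) x| - |D (M^[n] g) x|), sq_abs (D (M^[n] φ) x),
      sq_abs (D (M^[n] g) x)]
  have hle : ∀ N, ENNReal.ofReal |a 0| ≤ ENNReal.ofReal |a N| + X := by
    intro N
    refine le_trans ?_ (add_le_add_right (hbsum N) _)
    rw [← ENNReal.ofReal_sum_of_nonneg (fun _ _ => abs_nonneg _),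
      ← ENNReal.ofReal_add (abs_nonneg _) (Finset.sum_nonneg fun _ _ => abs_nonneg _)]
    refine ENNReal.ofReal_le_ofReal ?_
    have h1 := Finset.abs_sum_le_sum_abs b (Finset.range N)
    rw [← htel N] at h1
    have h2 := abs_sub_abs_le_abs_sub (a 0) (a N)
    rw [abs_sub_comm] at h2
    linarith
  have := ge_of_tendsto' (htail.add_const X) hle
  rw [zero_add] at this
  exact this

end RandomWalk

section SecondDifference

/-- Second derivative of `φ` at `x` in the directions `v` and `w`. -/
def hess (φ : E3 → ℝ) (x v w : E3) : ℝ := fderiv ℝ (fderiv ℝ φ) x v w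

/-- Second-order difference quotient of `φ` at `x` in the direction `v` with step `t`. -/
def sndQuot (φ : E3 → ℝ) (v : E3) (t : ℝ) (x : E3) : ℝ :=
  (t ^ 2)⁻¹ * (φ (x + t • v) + φ (x - t • v) - 2 * φ x)

variable {φ : E3 → ℝ}

lemma contDiff_fderiv_top {F : Type*} [NormedAddCommGroup F] [NormedSpace ℝ F] {φ : E3 → F}
    (h : ContDiff ℝ (⊤ : ℕ∞) φ) :
    ContDiff ℝ (⊤ : ℕ∞) (fderiv ℝ φ) :=
  h.fderiv_right (by norm_cast)

lemma hasFDerivAt_of_contDiff_top {F : Type*} [NormedAddCommGroup F] [NormedSpace ℝ F] {φ : E3 → F}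
    (h : ContDiff ℝ (⊤ : ℕ∞) φ) (x : E3) :
    HasFDerivAt φ (fderiv ℝ φ x) x :=
  (h.differentiable (by simp) x).hasFDerivAt

lemma continuous_hess (h : ContDiff ℝ (⊤ : ℕ∞) φ) (v w : E3) :
    Continuous fun x => hess φ x v w := by
  have := (contDiff_fderiv_top (contDiff_fderiv_top h)).continuous
  unfold hess
  fun_prop

lemma hess_symm (h : ContDiff ℝ (⊤ : ℕ∞) φ) (x v w : E3) : hess φ x v w = hess φ x w v :=
  (h.contDiffAt.isSymmSndFDerivAt (by simpa using (by norm_cast : ((2 : ℕ∞) : WithTop ℕ∞) ≤ (⊤ : ℕ∞)))) v w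

lemma pd_pd_eq_hess (h : ContDiff ℝ (⊤ : ℕ∞) φ) (i j : Fin 3) (x : E3) :
    pd (pd φ j) i x = hess φ x (EuclideanSpace.single i 1) (EuclideanSpace.single j 1) := by
  have h1 := (ContinuousLinearMap.apply ℝ ℝ (EuclideanSpace.single j (1 : ℝ) : E3)).hasFDerivAt.comp x
    (hasFDerivAt_of_contDiff_top (contDiff_fderiv_top h) x)
  have h2 : fderiv ℝ (pd φ j) x = _ := h1.fderiv
  simp only [pd, hess]
  change fderiv ℝ (pd φ j) x _ = _
  rw [h2]; rfl

lemma hasDerivAt_line (h : ContDiff ℝ (⊤ : ℕ∞) φ) (x v : E3) (s : ℝ) :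
    HasDerivAt (fun s : ℝ => φ (x + s • v)) (fderiv ℝ φ (x + s • v) v) s := by
  have h1 : HasDerivAt (fun s : ℝ => x + s • v) v s := by
    simpa using ((hasDerivAt_id s).smul_const v).const_add x
  exact (hasFDerivAt_of_contDiff_top h _).comp_hasDerivAt s h1

lemma hasDerivAt_line_fderiv (h : ContDiff ℝ (⊤ : ℕ∞) φ) (x v w : E3) (s : ℝ) :
    HasDerivAt (fun s : ℝ => fderiv ℝ φ (x + s • v) w) (hess φ (x + s • v) v w) s := by
  have h1 : HasDerivAt (fun s : ℝ => x + s • v) v s := by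
    simpa using ((hasDerivAt_id s).smul_const v).const_add x
  have h2 := (hasFDerivAt_of_contDiff_top (contDiff_fderiv_top h) _).comp_hasDerivAt s h1
  exact (ContinuousLinearMap.apply ℝ ℝ w).hasFDerivAt.comp_hasDerivAt s h2

lemma exists_sndQuot_eq (h : ContDiff ℝ (⊤ : ℕ∞) φ) (x v : E3) {t : ℝ} (ht : 0 < t) :
    ∃ s ∈ Ioo 0 t, sndQuot φ v t x = (hess φ (x + s • v) v v + hess φ (x + (-s) • v) v v) / 2 := by
  set H : ℝ → ℝ := fun s => φ (x + s • v) + φ (x + (-s) • v) - 2 * φ x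
  set H1 : ℝ → ℝ := fun s => fderiv ℝ φ (x + s • v) v - fderiv ℝ φ (x + (-s) • v) v
  have dH : ∀ s, HasDerivAt H (H1 s) s := fun s => by
    have := ((hasDerivAt_line h x v s).add
      ((hasDerivAt_line h x v (-s)).comp s (hasDerivAt_neg s))).sub_const (2 * φ x)
    exact this.congr_deriv (by simp only [H1]; ring)
  have dH1 : ∀ s, HasDerivAt H1 (hess φ (x + s • v) v v + hess φ (x + (-s) • v) v v) s :=
    fun s => by
    have := (hasDerivAt_line_fderiv h x v v s).sub
      ((hasDerivAt_line_fderiv h x v v (-s)).comp s (hasDerivAt_neg s))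
    exact this.congr_deriv (by ring)
  have d2 : ∀ s : ℝ, HasDerivAt (fun s : ℝ => s ^ 2) (2 * s) s := fun s => by
    simpa using hasDerivAt_pow 2 s
  obtain ⟨s, hs, e⟩ := exists_ratio_hasDerivAt_eq_ratio_slope H H1 ht
    (fun s _ => (dH s).continuousAt.continuousWithinAt) (fun s _ => dH s) (fun s => s ^ 2)
    (fun s => 2 * s) (fun s _ => (d2 s).continuousAt.continuousWithinAt) (fun s _ => d2 s)
  obtain ⟨r, hr, e'⟩ := exists_hasDerivAt_eq_slope H1 _ hs.1
    (fun s _ => (dH1 s).continuousAt.continuousWithinAt) (fun s _ => dH1 s)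
  refine ⟨r, ⟨hr.1, hr.2.trans hs.2⟩, ?_⟩
  have H0 : H 0 = 0 := by simp [H]; ring
  have H10 : H1 0 = 0 := by simp [H1]
  have hs0 := hs.1.ne'
  rw [e', H10]
  rw [H0] at e
  have hHt : sndQuot φ v t x = (t ^ 2)⁻¹ * H t := by simp [sndQuot, H, sub_eq_add_neg]
  rw [hHt]
  simp only [sub_zero] at e ⊢
  field_simp
  linarith

lemma tendsto_sndQuot (h : ContDiff ℝ (⊤ : ℕ∞) φ) (x v : E3) :
    Filter.Tendsto (fun n : ℕ => sndQuot φ v (1 / ((n : ℝ) + 1)) x) Filter.atTop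
      (nhds (hess φ x v v)) := by
  have hpos : ∀ n : ℕ, (0 : ℝ) < 1 / ((n : ℝ) + 1) := fun n => Nat.one_div_pos_of_nat
  choose s hs e using fun n => exists_sndQuot_eq h x v (hpos n)
  have hs0 : Filter.Tendsto s Filter.atTop (nhds 0) :=
    tendsto_of_tendsto_of_tendsto_of_le_of_le tendsto_const_nhds
      tendsto_one_div_add_atTop_nhds_zero_nat (fun n => (hs n).1.le) (fun n => (hs n).2.le)
  have hc : Continuous fun s : ℝ =>
      (hess φ (x + s • v) v v + hess φ (x + (-s) • v) v v) / 2 := by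
    have := continuous_hess h v v
    have h1 : Continuous fun s : ℝ => hess φ (x + s • v) v v := this.comp (by fun_prop)
    have h2 : Continuous fun s : ℝ => hess φ (x + (-s) • v) v v := this.comp (by fun_prop)
    fun_prop
  have := (hc.tendsto 0).comp hs0
  simp only [e]
  rw [neg_zero, zero_smul, add_zero, add_self_div_two] at this
  exact this

lemma hasCompactSupport_hess (hs : HasCompactSupport φ) (v w : E3) :
    HasCompactSupport fun x => hess φ x v w := by
  have := (hs.fderiv ℝ).fderiv ℝ
  exact this.comp_left (g := fun L => L v w) (by simp)

lemma exists_sndQuot_bound (h : ContDiff ℝ (⊤ : ℕ∞) φ) (hs : HasCompactSupport φ) (v : E3) :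
    ∃ (C r : ℝ), 0 ≤ C ∧ ∀ t, 0 < t → t ≤ 1 → ∀ x,
      |sndQuot φ v t x| ≤ (closedBall (0 : E3) r).indicator (fun _ => C) x := by
  obtain ⟨C, hC⟩ := (hasCompactSupport_hess hs v v).exists_bound_of_continuous
    (continuous_hess h v v)
  obtain ⟨r, hr⟩ := hs.isCompact.isBounded.subset_closedBall (0 : E3)
  have hz : ∀ y : E3, r < ‖y‖ → φ y = 0 := fun y hy => by
    by_contra hne
    have := hr (subset_tsupport _ hne)
    simp at this
    linarith
  refine ⟨C, r + ‖v‖, (norm_nonneg _).trans (hC 0), fun t ht ht1 x => ?_⟩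
  by_cases hx : x ∈ closedBall (0 : E3) (r + ‖v‖)
  · rw [indicator_of_mem hx]
    obtain ⟨s, -, e⟩ := exists_sndQuot_eq h x v ht
    rw [e, abs_le]
    have h1 := abs_le.1 (hC (x + s • v))
    have h2 := abs_le.1 (hC (x + (-s) • v))
    constructor <;> linarith [h1.1, h1.2, h2.1, h2.2]
  · rw [indicator_of_notMem hx]
    simp only [mem_closedBall, dist_zero_right, not_le] at hx
    have htv : ‖t • v‖ ≤ ‖v‖ := by
      rw [norm_smul, Real.norm_of_nonneg ht.le]
      exact mul_le_of_le_one_left (norm_nonneg _) ht1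
    have h1 : φ (x + t • v) = 0 := hz _ (by
      have := norm_sub_le (x + t • v) (t • v)
      simp at this
      linarith)
    have h2 : φ (x - t • v) = 0 := hz _ (by
      have := norm_add_le (x - t • v) (t • v)
      simp at this
      linarith)
    have h3 : φ x = 0 := hz _ (by linarith [norm_nonneg v])
    simp [sndQuot, h1, h2, h3]

end SecondDifference

section SecondOrderEstimate

variable {φ : E3 → ℝ}

lemma integrable_indicator_closedBall (r C : ℝ) :
    Integrable ((closedBall (0 : E3) r).indicator fun _ => C) :=
  (integrable_indicator_iff measurableSet_closedBall).2
    (integrableOn_const (isCompact_closedBall _ _).measure_lt_top.ne)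

lemma exists_sum_sndQuot_bound {α : Type} [Fintype α] (h : ContDiff ℝ (⊤ : ℕ∞) φ)
    (hs : HasCompactSupport φ) (c : α → ℝ) (v : α → E3) :
    ∃ (C r : ℝ), 0 ≤ C ∧ ∀ t, 0 < t → t ≤ 1 → ∀ x,
      |∑ a, c a * sndQuot φ (v a) t x| ≤ (closedBall (0 : E3) r).indicator (fun _ => C) x := by
  choose C r hC hb using fun a => exists_sndQuot_bound h hs (v a)
  refine ⟨∑ a, |c a| * C a, ∑ a, |r a|, Finset.sum_nonneg fun a _ =>
    mul_nonneg (abs_nonneg _) (hC a), fun t ht ht1 x => ?_⟩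
  have h1 : ∀ a, |c a * sndQuot φ (v a) t x| ≤
      (closedBall (0 : E3) (∑ a, |r a|)).indicator (fun _ => |c a| * C a) x := fun a => by
    rw [abs_mul]
    have hsub : closedBall (0 : E3) (r a) ⊆ closedBall 0 (∑ a, |r a|) :=
      closedBall_subset_closedBall ((le_abs_self _).trans
        (Finset.single_le_sum (f := fun a => |r a|) (fun _ _ => abs_nonneg _) (Finset.mem_univ a)))
    have := mul_le_mul_of_nonneg_left ((hb a t ht ht1 x).trans
      (indicator_le_indicator_of_subset hsub (fun _ => hC a) x)) (abs_nonneg (c a))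
    refine this.trans (le_of_eq ?_)
    by_cases hx : x ∈ closedBall (0 : E3) (∑ a, |r a|) <;> simp only [hx, indicator_of_mem,
      indicator_of_notMem, not_false_eq_true, mul_zero]
  refine (Finset.abs_sum_le_sum_abs _ _).trans ((Finset.sum_le_sum fun a _ => h1 a).trans
    (le_of_eq ?_))
  by_cases hx : x ∈ closedBall (0 : E3) (∑ a, |r a|) <;> simp only [hx, indicator_of_mem,
      indicator_of_notMem, not_false_eq_true, Finset.sum_const_zero]

lemma continuous_sndQuot (h : ContDiff ℝ (⊤ : ℕ∞) φ) (v : E3) (t : ℝ) :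
    Continuous (sndQuot φ v t) := by
  have := h.continuous
  unfold sndQuot
  fun_prop

lemma one_div_nat_pos_le (n : ℕ) : (0 : ℝ) < 1 / ((n : ℝ) + 1) ∧ 1 / ((n : ℝ) + 1) ≤ 1 := by
  refine ⟨Nat.one_div_pos_of_nat, ?_⟩
  rw [div_le_one (by positivity)]
  linarith [(Nat.cast_nonneg n : (0 : ℝ) ≤ n)]

lemma tendsto_sum_sndQuot {α : Type} [Fintype α] (h : ContDiff ℝ (⊤ : ℕ∞) φ)
    (c : α → ℝ) (v : α → E3) (x : E3) :
    Filter.Tendsto (fun n : ℕ => ∑ a, c a * sndQuot φ (v a) (1 / ((n : ℝ) + 1)) x) Filter.atTop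
      (nhds (∑ a, c a * hess φ x (v a) (v a))) :=
  tendsto_finsetSum _ fun a _ => (tendsto_sndQuot h x (v a)).const_mul _

lemma tendsto_integral_sndQuot_mul {α : Type} [Fintype α] (h : ContDiff ℝ (⊤ : ℕ∞) φ)
    (hs : HasCompactSupport φ) (c : α → ℝ) (v : α → E3) {g : E3 → ℝ} (hg : Integrable g) :
    Filter.Tendsto (fun n : ℕ => ∫ x, (∑ a, c a * sndQuot φ (v a) (1 / ((n : ℝ) + 1)) x) * g x)
      Filter.atTop (nhds (∫ x, (∑ a, c a * hess φ x (v a) (v a)) * g x)) := by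
  obtain ⟨C, r, hC, hb⟩ := exists_sum_sndQuot_bound h hs c v
  refine tendsto_integral_of_dominated_convergence (fun x => C * |g x|) (fun n => ?_)
    (hg.abs.const_mul C) (fun n => ?_) ?_
  · refine (Continuous.aestronglyMeasurable ?_).mul hg.aestronglyMeasurable
    exact continuous_finsetSum _ fun a _ => (continuous_sndQuot h _ _).const_mul _
  · refine Filter.Eventually.of_forall fun x => ?_
    rw [Real.norm_eq_abs, abs_mul]
    gcongr
    refine (hb _ (one_div_nat_pos_le n).1 (one_div_nat_pos_le n).2 x).trans ?_
    exact indicator_le_self' (fun _ _ => hC) x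
  · exact Filter.Eventually.of_forall fun x => (tendsto_sum_sndQuot h c v x).mul_const _

lemma tendsto_lintegral_sndQuot_rpow {α : Type} [Fintype α] (h : ContDiff ℝ (⊤ : ℕ∞) φ)
    (hs : HasCompactSupport φ) (c : α → ℝ) (v : α → E3) {q : ℝ} (hq : 0 < q) :
    Filter.Tendsto (fun n : ℕ => ∫⁻ x, ENNReal.ofReal
        (|∑ a, c a * sndQuot φ (v a) (1 / ((n : ℝ) + 1)) x| ^ q))
      Filter.atTop (nhds (∫⁻ x, ENNReal.ofReal (|∑ a, c a * hess φ x (v a) (v a)| ^ q))) := by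
  obtain ⟨C, r, hC, hb⟩ := exists_sum_sndQuot_bound h hs c v
  refine tendsto_lintegral_of_dominated_convergence
    (fun x => ENNReal.ofReal ((closedBall (0 : E3) r).indicator (fun _ => C ^ q) x))
    (fun n => ?_) (fun n => ?_) ?_ ?_
  · have : Continuous fun x => ∑ a, c a * sndQuot φ (v a) (1 / ((n : ℝ) + 1)) x :=
      continuous_finsetSum _ fun a _ => (continuous_sndQuot h _ _).const_mul _
    have := this.measurable
    fun_prop
  · refine Filter.Eventually.of_forall fun x => ENNReal.ofReal_le_ofReal ?_
    refine (Real.rpow_le_rpow (abs_nonneg _)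
      (hb _ (one_div_nat_pos_le n).1 (one_div_nat_pos_le n).2 x) hq.le).trans (le_of_eq ?_)
    by_cases hx : x ∈ closedBall (0 : E3) r <;> simp only [hx, indicator_of_mem,
      indicator_of_notMem, not_false_eq_true, Real.zero_rpow hq.ne']
  · exact (integrable_indicator_closedBall r (C ^ q)).lintegral_lt_top.ne
  · refine Filter.Eventually.of_forall fun x => ?_
    refine (ENNReal.continuous_ofReal.tendsto _).comp ?_
    exact ((tendsto_sum_sndQuot h c v x).abs).rpow_const (Or.inr hq.le)

lemma integral_halfDiff_mul (v : E3) {u g : E3 → ℝ} (hu : MemLp u 2) (hg : MemLp g 2) :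
    ∫ x, halfDiff v u x * g x = -∫ x, u x * halfDiff v g x := by
  have e1 : ∫ x, u (x + v) * g x = ∫ x, u x * g (x - v) := by
    rw [← integral_sub_right_eq_self (fun x => u (x + v) * g x) v]
    simp
  have e2 : ∫ x, u (x - v) * g x = ∫ x, u x * g (x + v) := by
    rw [← integral_add_right_eq_self (fun x => u (x - v) * g x) v]
    simp
  have i1 := integrable_mul_of_memLp (memLp_comp_add hu v) hg
  have i2 := integrable_mul_of_memLp (memLp_comp_sub hu v) hg
  have i3 := integrable_mul_of_memLp hu (memLp_comp_add hg v)
  have i4 := integrable_mul_of_memLp hu (memLp_comp_sub hg v)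
  calc ∫ x, halfDiff v u x * g x = ∫ x, (2⁻¹ : ℝ) * (u (x + v) * g x - u (x - v) * g x) := by
        refine integral_congr_ae (Filter.Eventually.of_forall fun x => ?_)
        simp only [halfDiff]; ring
    _ = -∫ x, (2⁻¹ : ℝ) * (u x * g (x + v) - u x * g (x - v)) := by
        rw [integral_const_mul, integral_const_mul, integral_sub i1 i2, integral_sub i3 i4, e1, e2]
        ring
    _ = _ := by
        congr 1
        refine integral_congr_ae (Filter.Eventually.of_forall fun x => ?_)
        simp only [halfDiff]; ring

lemma halfDiff_halfDiff_eq_sndQuot (φ : E3 → ℝ) (d x : E3) (t : ℝ) :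
    halfDiff (t • d) (halfDiff (t • d) fun y => (t ^ 2)⁻¹ * φ y) x
      = 4⁻¹ * sndQuot φ ((2 : ℝ) • d) t x := by
  have e1 : x + t • (2 : ℝ) • d = x + t • d + t • d := by module
  have e2 : x - t • (2 : ℝ) • d = x - t • d - t • d := by module
  simp only [halfDiff, sndQuot, e1, e2, add_sub_cancel_right, sub_add_cancel]
  ring

lemma symMean_symMean_sub_eq_sndQuot {ι : Type} [Fintype ι] [Nonempty ι] (σ : ι → E3)
    (φ : E3 → ℝ) (x : E3) (t : ℝ) :
    symMean (fun k => t • σ k) (symMean (fun k => t • σ k) fun y => (t ^ 2)⁻¹ * φ y) x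
        - (t ^ 2)⁻¹ * φ x
      = ∑ a : (ι × ι) × Bool, (((Fintype.card ι : ℝ) ^ 2)⁻¹ * 4⁻¹) *
          sndQuot φ (cond a.2 (σ a.1.1 + σ a.1.2) (σ a.1.1 - σ a.1.2)) t x := by
  have hm : (Fintype.card ι : ℝ) ≠ 0 := by simp
  have hconst : (t ^ 2)⁻¹ * φ x = ∑ k : ι, ∑ l : ι,
      ((Fintype.card ι : ℝ) ^ 2)⁻¹ * ((t ^ 2)⁻¹ * φ x) := by
    simp only [Finset.sum_const, Finset.card_univ, nsmul_eq_mul]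
    field_simp
  rw [hconst]
  simp only [Fintype.sum_prod_type, Fintype.sum_bool, cond_true, cond_false, symMean,
    Finset.mul_sum]
  rw [← Finset.sum_sub_distrib]
  refine Finset.sum_congr rfl fun k _ => ?_
  rw [← Finset.sum_add_distrib, Finset.sum_div, Finset.mul_sum, ← Finset.sum_sub_distrib]
  refine Finset.sum_congr rfl fun l _ => ?_
  have e1 : x + t • (σ k + σ l) = x + t • σ k + t • σ l := by module
  have e2 : x - t • (σ k + σ l) = x - t • σ k - t • σ l := by module
  have e3 : x + t • (σ k - σ l) = x + t • σ k - t • σ l := by module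
  have e4 : x - t • (σ k - σ l) = x - t • σ k + t • σ l := by module
  simp only [sndQuot, e1, e2, e3, e4]
  field_simp
  ring

/-- The vectors `eᵢ ± eⱼ`. -/
def diagDir (a : Fin 3 × Fin 3 × Bool) : E3 :=
  cond a.2.2 (EuclideanSpace.single a.1 1 + EuclideanSpace.single a.2.1 1)
    (EuclideanSpace.single a.1 1 - EuclideanSpace.single a.2.1 1)

lemma hess_add_add (h : ContDiff ℝ (⊤ : ℕ∞) φ) (x v w : E3) :
    hess φ x (v + w) (v + w) = hess φ x v v + 2 * hess φ x v w + hess φ x w w := by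
  have := hess_symm h x v w
  simp only [hess, map_add, add_apply] at this ⊢
  rw [← this]; ring

lemma hess_sub_sub (h : ContDiff ℝ (⊤ : ℕ∞) φ) (x v w : E3) :
    hess φ x (v - w) (v - w) = hess φ x v v - 2 * hess φ x v w + hess φ x w w := by
  have := hess_symm h x v w
  simp only [hess, map_sub, sub_apply] at this ⊢
  rw [← this]; ring

lemma sum_hess_diagDir (h : ContDiff ℝ (⊤ : ℕ∞) φ) (x : E3) :
    ∑ a : ((Fin 3 × Fin 3 × Bool) × (Fin 3 × Fin 3 × Bool)) × Bool,
      (((Fintype.card (Fin 3 × Fin 3 × Bool) : ℝ) ^ 2)⁻¹ * 4⁻¹) *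
        hess φ x (cond a.2 (diagDir a.1.1 + diagDir a.1.2) (diagDir a.1.1 - diagDir a.1.2))
          (cond a.2 (diagDir a.1.1 + diagDir a.1.2) (diagDir a.1.1 - diagDir a.1.2))
      = 2 / 3 * ∑ i, pd (pd φ i) i x := by
  have h1 : ∑ k, hess φ x (diagDir k) (diagDir k) = 12 * ∑ i, pd (pd φ i) i x := by
    simp only [pd_pd_eq_hess h, Fintype.sum_prod_type, Fintype.sum_bool, diagDir, cond_true,
      cond_false, hess_add_add h, hess_sub_sub h, Fin.sum_univ_three]
    ring
  have hc : (Fintype.card (Fin 3 × Fin 3 × Bool) : ℝ) = 18 := by simp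
  rw [← Finset.mul_sum, Fintype.sum_prod_type]
  simp only [Fintype.sum_bool, cond_true, cond_false, hess_add_add h, hess_sub_sub h]
  rw [Fintype.sum_prod_type]
  have h2 : ∀ k l : Fin 3 × Fin 3 × Bool, hess φ x (diagDir k) (diagDir k)
      + 2 * hess φ x (diagDir k) (diagDir l) + hess φ x (diagDir l) (diagDir l)
      + (hess φ x (diagDir k) (diagDir k)
      - 2 * hess φ x (diagDir k) (diagDir l) + hess φ x (diagDir l) (diagDir l))
      = 2 * hess φ x (diagDir k) (diagDir k) + 2 * hess φ x (diagDir l) (diagDir l) := by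
    intro k l; ring
  simp only [h2, Finset.sum_add_distrib, ← Finset.mul_sum, Finset.sum_const, Finset.card_univ,
    nsmul_eq_mul, h1, hc]
  ring

lemma abs_integral_hess_diagDir_mul_le {q p : ℝ} (hqp : q.HolderConjugate p) :
    ∃ C : ℝ, 0 < C ∧ ∀ (φ g : E3 → ℝ), ContDiff ℝ (⊤ : ℕ∞) φ → HasCompactSupport φ →
      Measurable g → MemLp g 2 → Integrable g → ∀ k,
      ENNReal.ofReal |∫ x, hess φ x (diagDir k) (diagDir k) * g x| ≤ ENNReal.ofReal C *
        ((∫⁻ x, ENNReal.ofReal (|∑ i, pd (pd φ i) i x| ^ q))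
          + ∫⁻ x, ENNReal.ofReal (|g x| ^ p)) := by
  obtain ⟨C, hC, hmain⟩ := abs_integral_halfDiff_mul_le (ι := Fin 3 × Fin 3 × Bool) hqp
  refine ⟨C, hC, fun φ g h hs mg hg2 hg1 k => ?_⟩
  set t : ℕ → ℝ := fun n => 1 / ((n : ℝ) + 1)
  have hl : Filter.Tendsto (fun n => ENNReal.ofReal |∫ x, (∑ _a : Unit, 4⁻¹ *
      sndQuot φ ((2 : ℝ) • diagDir k) (t n) x) * g x|) Filter.atTop
      (nhds (ENNReal.ofReal |∫ x, hess φ x (diagDir k) (diagDir k) * g x|)) := by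
    refine (ENNReal.continuous_ofReal.tendsto _).comp (Filter.Tendsto.abs ?_)
    convert tendsto_integral_sndQuot_mul h hs (fun _ : Unit => 4⁻¹)
      (fun _ => (2 : ℝ) • diagDir k) hg1 using 4 with x
    simp only [Finset.univ_unique, Finset.sum_singleton, hess, map_smul,
      smul_apply, smul_eq_mul]
    ring
  have hr := tendsto_lintegral_sndQuot_rpow h hs
    (fun _ => ((Fintype.card (Fin 3 × Fin 3 × Bool) : ℝ) ^ 2)⁻¹ * 4⁻¹)
    (fun a : ((Fin 3 × Fin 3 × Bool) × (Fin 3 × Fin 3 × Bool)) × Bool =>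
      cond a.2 (diagDir a.1.1 + diagDir a.1.2) (diagDir a.1.1 - diagDir a.1.2)) hqp.pos
  simp only [sum_hess_diagDir h] at hr
  have hr' := ENNReal.Tendsto.const_mul (a := ENNReal.ofReal C)
    (hr.add_const (∫⁻ x, ENNReal.ofReal (|g x| ^ p))) (Or.inr ENNReal.ofReal_ne_top)
  refine (le_of_tendsto_of_tendsto' hl hr' fun n => ?_).trans ?_
  · have mφ : Measurable fun y => (t n ^ 2)⁻¹ * φ y := (h.continuous.measurable).const_mul _
    have lφ : MemLp (fun y => (t n ^ 2)⁻¹ * φ y) 2 :=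
      (h.continuous.memLp_of_hasCompactSupport hs).const_mul _
    have := hmain (fun k => t n • diagDir k) k _ g mφ mg lφ hg2
    simp only [symMean_symMean_sub_eq_sndQuot] at this
    refine le_trans (le_of_eq ?_) this
    have e := integral_halfDiff_mul (t n • diagDir k)
      (memLp_halfDiff (t n • diagDir k) lφ) hg2
    rw [← neg_eq_iff_eq_neg.2 e, abs_neg]
    simp only [halfDiff_halfDiff_eq_sndQuot, Finset.univ_unique, Finset.sum_singleton]
  · gcongr ENNReal.ofReal C * (?_ + _)
    refine lintegral_mono fun x => ENNReal.ofReal_le_ofReal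
      (Real.rpow_le_rpow (abs_nonneg _) ?_ hqp.nonneg)
    rw [abs_mul]
    refine mul_le_of_le_one_left (abs_nonneg _) ?_
    rw [abs_of_pos] <;> norm_num

lemma abs_integral_pd_pd_mul_le {q p : ℝ} (hqp : q.HolderConjugate p) :
    ∃ C : ℝ, 0 < C ∧ ∀ (φ g : E3 → ℝ), ContDiff ℝ (⊤ : ℕ∞) φ → HasCompactSupport φ →
      Measurable g → MemLp g 2 → Integrable g → ∀ i j,
      ENNReal.ofReal |∫ x, pd (pd φ j) i x * g x| ≤ ENNReal.ofReal C *
        ((∫⁻ x, ENNReal.ofReal (|∑ i, pd (pd φ i) i x| ^ q))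
          + ∫⁻ x, ENNReal.ofReal (|g x| ^ p)) := by
  obtain ⟨C, hC, hmain⟩ := abs_integral_hess_diagDir_mul_le hqp
  refine ⟨C, hC, fun φ g h hs mg hg2 hg1 i j => ?_⟩
  have hint : ∀ v, Integrable fun x => hess φ x v v * g x := fun v => by
    obtain ⟨B, hB⟩ := (hasCompactSupport_hess hs v v).exists_bound_of_continuous
      (continuous_hess h v v)
    exact hg1.bdd_mul (continuous_hess h v v).aestronglyMeasurable (Filter.Eventually.of_forall hB)
  have e : ∫ x, pd (pd φ j) i x * g x = 4⁻¹ * ((∫ x, hess φ x (diagDir (i, j, true))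
      (diagDir (i, j, true)) * g x) - ∫ x, hess φ x (diagDir (i, j, false))
      (diagDir (i, j, false)) * g x) := by
    rw [← integral_sub (hint _) (hint _), ← integral_const_mul]
    refine integral_congr_ae (Filter.Eventually.of_forall fun x => ?_)
    simp only [diagDir, cond_true, cond_false, hess_add_add h, hess_sub_sub h, pd_pd_eq_hess h]
    ring
  have h1 := hmain φ g h hs mg hg2 hg1 (i, j, true)
  have h2 := hmain φ g h hs mg hg2 hg1 (i, j, false)
  refine le_trans ?_ (max_le h1 h2)
  rw [← ENNReal.ofReal_max, e]
  refine ENNReal.ofReal_le_ofReal ?_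
  set a := ∫ x, hess φ x (diagDir (i, j, true)) (diagDir (i, j, true)) * g x
  set b := ∫ x, hess φ x (diagDir (i, j, false)) (diagDir (i, j, false)) * g x
  rw [abs_mul, abs_of_pos (by norm_num : (0 : ℝ) < 4⁻¹)]
  have := abs_sub a b
  have := le_max_left |a| |b|
  have := le_max_right |a| |b|
  linarith [abs_nonneg a]

end SecondOrderEstimate

section DoubleDivergence

lemma exists_bound_pd_pd {φ : E3 → ℝ} (h : ContDiff ℝ (⊤ : ℕ∞) φ) (hs : HasCompactSupport φ)
    (i j : Fin 3) : ∃ B, ∀ x, ‖pd (pd φ j) i x‖ ≤ B := by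
  simp only [pd_pd_eq_hess h]
  exact (hasCompactSupport_hess hs _ _).exists_bound_of_continuous (continuous_hess h _ _)

lemma continuous_pd_pd {φ : E3 → ℝ} (h : ContDiff ℝ (⊤ : ℕ∞) φ) (i j : Fin 3) :
    Continuous (pd (pd φ j) i) := by
  have : pd (pd φ j) i = _ := funext (pd_pd_eq_hess h i j)
  rw [this]
  exact continuous_hess h _ _

lemma abs_setIntegral_pd_pd_mul_le {q p : ℝ} (hqp : q.HolderConjugate p) :
    ∃ C : ℝ, 0 < C ∧ ∀ (φ g : E3 → ℝ) (S : Set E3), ContDiff ℝ (⊤ : ℕ∞) φ →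
      HasCompactSupport φ → Measurable g → MeasurableSet S → volume S ≠ ∞ → IntegrableOn g S →
      ∀ i j, ENNReal.ofReal |∫ x in S, g x * pd (pd φ j) i x| ≤ ENNReal.ofReal C *
        ((∫⁻ x, ENNReal.ofReal (|∑ i, pd (pd φ i) i x| ^ q))
          + ∫⁻ x in S, ENNReal.ofReal (|g x| ^ p)) := by
  obtain ⟨C, hC, hmain⟩ := abs_integral_pd_pd_mul_le hqp
  refine ⟨C, hC, fun φ g S h hs mg mS hS hg i j => ?_⟩
  obtain ⟨B, hB⟩ := exists_bound_pd_pd h hs i j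
  have hB0 : 0 ≤ B := (norm_nonneg _).trans (hB 0)
  set T : ℕ → Set E3 := fun n => S ∩ {x | |g x| ≤ n}
  have mT : ∀ n, MeasurableSet (T n) := fun n =>
    mS.inter (measurableSet_le (by fun_prop) measurable_const)
  set gn : ℕ → E3 → ℝ := fun n => (T n).indicator g
  have mgn : ∀ n, Measurable (gn n) := fun n => mg.indicator (mT n)
  have hTS : ∀ n, volume (T n) ≠ ∞ := fun n => measure_ne_top_of_subset inter_subset_left hS
  have hgn : ∀ n, ∀ r : ℝ≥0∞, MemLp (gn n) r := fun n r => by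
    refine MemLp.mono (g := (T n).indicator fun _ => (n : ℝ))
      (memLp_indicator_const r (mT n) _ (Or.inr (hTS n))) (mgn n).aestronglyMeasurable
      (Filter.Eventually.of_forall fun x => ?_)
    by_cases hx : x ∈ T n
    · simp only [gn, indicator_of_mem hx, Real.norm_eq_abs, Nat.abs_cast]
      exact hx.2
    · simp [gn, indicator_of_notMem hx]
  have hlim : Filter.Tendsto (fun n => ∫ x, pd (pd φ j) i x * gn n x) Filter.atTop
      (nhds (∫ x in S, g x * pd (pd φ j) i x)) := by
    rw [← integral_indicator mS]
    refine tendsto_integral_of_dominated_convergence (fun x => B * |S.indicator g x|)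
      (fun n => ?_) ((integrable_indicator_iff mS).2 hg |>.abs.const_mul B) (fun n => ?_) ?_
    · exact (continuous_pd_pd h i j).aestronglyMeasurable.mul (mgn n).aestronglyMeasurable
    · refine Filter.Eventually.of_forall fun x => ?_
      rw [norm_mul]
      refine mul_le_mul (hB x) ?_ (norm_nonneg _) hB0
      by_cases hx : x ∈ T n
      · simp only [gn, indicator_of_mem hx, indicator_of_mem hx.1, Real.norm_eq_abs, le_refl]
      · simp [gn, indicator_of_notMem hx]
    · refine Filter.Eventually.of_forall fun x => ?_
      obtain ⟨N, hN⟩ := exists_nat_ge |g x|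
      refine tendsto_const_nhds.congr' ?_
      filter_upwards [Filter.eventually_ge_atTop N] with n hn
      by_cases hx : x ∈ S
      · have : x ∈ T n := ⟨hx, hN.trans (by exact_mod_cast hn)⟩
        simp only [gn, indicator_of_mem hx, indicator_of_mem this, mul_comm]
      · have : x ∉ T n := fun h => hx h.1
        simp only [gn, indicator_of_notMem hx, indicator_of_notMem this, mul_zero]
  refine le_of_tendsto' ((ENNReal.continuous_ofReal.tendsto _).comp hlim.abs) fun n => ?_
  refine (hmain φ (gn n) h hs (mgn n) (hgn n 2) (memLp_one_iff_integrable.1 (hgn n 1)) i j).trans ?_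
  gcongr ENNReal.ofReal C * (_ + ?_)
  rw [← lintegral_indicator mS]
  refine lintegral_mono fun x => ?_
  by_cases hx : x ∈ T n
  · simp only [gn, indicator_of_mem hx, indicator_of_mem hx.1, le_refl]
  · simp [gn, indicator_of_notMem hx, Real.zero_rpow hqp.symm.ne_zero]

lemma integrableOn_norm_of_lintegral_rpow {p : ℝ} (hp : 1 < p) {A : E3 → Fin 3 → Fin 3 → ℝ}
    {S : Set E3} (mA : Measurable A) (hS : volume S ≠ ∞)
    (hA : ∫⁻ x in S, ENNReal.ofReal (‖A x‖ ^ p) < ∞) : IntegrableOn (fun x => ‖A x‖) S := by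
  have : IsFiniteMeasure (volume.restrict S) := ⟨by simpa using hS.lt_top⟩
  have h1 : Integrable (fun x => ‖A x‖ ^ p) (volume.restrict S) := by
    refine ⟨(mA.norm.pow_const p).aestronglyMeasurable, ?_⟩
    rw [hasFiniteIntegral_iff_ofReal (Filter.Eventually.of_forall fun x => by positivity)]
    exact hA
  refine Integrable.mono' ((integrable_const (1 : ℝ)).add h1) (by fun_prop)
    (Filter.Eventually.of_forall fun x => ?_)
  rw [norm_norm, Pi.add_apply]
  rcases le_total ‖A x‖ 1 with h | h
  · linarith [Real.rpow_nonneg (norm_nonneg (A x)) p]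
  · linarith [Real.self_le_rpow_of_one_le h hp.le]

lemma abs_apply_le_norm (M : Fin 3 → Fin 3 → ℝ) (i j : Fin 3) : |M i j| ≤ ‖M‖ :=
  (norm_le_pi_norm (M i) j).trans (norm_le_pi_norm M i)

lemma abs_setIntegral_contraction_le {q p : ℝ} (hqp : q.HolderConjugate p) :
    ∃ C : ℝ, 0 < C ∧ ∀ (φ : E3 → ℝ) (A : E3 → Fin 3 → Fin 3 → ℝ) (S : Set E3),
      ContDiff ℝ (⊤ : ℕ∞) φ → HasCompactSupport φ → Measurable A → MeasurableSet S →
      volume S ≠ ∞ → ∫⁻ x in S, ENNReal.ofReal (‖A x‖ ^ p) < ∞ →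
      ENNReal.ofReal |∫ x in S, ∑ i, ∑ j, A x i j * pd (pd φ j) i x| ≤ ENNReal.ofReal C *
        ((∫⁻ x, ENNReal.ofReal (|∑ i, pd (pd φ i) i x| ^ q))
          + ∫⁻ x in S, ENNReal.ofReal (‖A x‖ ^ p)) := by
  obtain ⟨C, hC, hmain⟩ := abs_setIntegral_pd_pd_mul_le hqp
  refine ⟨9 * C, by positivity, fun φ A S h hs mA mS hS hA => ?_⟩
  have mAij : ∀ i j, Measurable fun x => A x i j := fun i j => by fun_prop
  have hAij : ∀ i j, IntegrableOn (fun x => A x i j) S := fun i j =>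
    (integrableOn_norm_of_lintegral_rpow hqp.symm.lt mA hS hA).mono'
      (mAij i j).aestronglyMeasurable
      (Filter.Eventually.of_forall fun x => abs_apply_le_norm (A x) i j)
  have hint : ∀ i j, IntegrableOn (fun x => A x i j * pd (pd φ j) i x) S := fun i j => by
    obtain ⟨B, hB⟩ := exists_bound_pd_pd h hs i j
    exact (hAij i j).mul_bdd (continuous_pd_pd h i j).aestronglyMeasurable
      (Filter.Eventually.of_forall hB)
  set X := ENNReal.ofReal C * ((∫⁻ x, ENNReal.ofReal (|∑ i, pd (pd φ i) i x| ^ q))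
          + ∫⁻ x in S, ENNReal.ofReal (‖A x‖ ^ p)) with hX
  have hb : ∀ i j, ENNReal.ofReal |∫ x in S, A x i j * pd (pd φ j) i x| ≤ X := fun i j => by
    refine (hmain φ (fun x => A x i j) S h hs (mAij i j) mS hS (hAij i j) i j).trans ?_
    rw [hX]
    gcongr ENNReal.ofReal C * (_ + ?_)
    exact lintegral_mono fun x => ENNReal.ofReal_le_ofReal
      (Real.rpow_le_rpow (abs_nonneg _) (abs_apply_le_norm _ _ _) hqp.symm.nonneg)
  rw [integral_finsetSum _ fun i _ => integrable_finsetSum _ fun j _ => hint i j]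
  calc _ ≤ ENNReal.ofReal (∑ i, ∑ j, |∫ x in S, A x i j * pd (pd φ j) i x|) := by
        refine ENNReal.ofReal_le_ofReal ((Finset.abs_sum_le_sum_abs _ _).trans
          (Finset.sum_le_sum fun i _ => ?_))
        rw [integral_finsetSum _ fun j _ => hint i j]
        exact Finset.abs_sum_le_sum_abs _ _
    _ = ∑ i, ∑ j, ENNReal.ofReal |∫ x in S, A x i j * pd (pd φ j) i x| := by
        rw [ENNReal.ofReal_sum_of_nonneg fun _ _ => Finset.sum_nonneg fun _ _ => abs_nonneg _]
        exact Finset.sum_congr rfl fun i _ => ENNReal.ofReal_sum_of_nonneg fun _ _ => abs_nonneg _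
    _ ≤ ∑ i : Fin 3, ∑ j : Fin 3, X := by gcongr with i _ j _; exact hb i j
    _ = _ := by
        simp only [Finset.sum_const, Finset.card_univ, Fintype.card_fin, nsmul_eq_mul]
        rw [ENNReal.ofReal_mul (by norm_num), mul_assoc, ← hX, ← mul_assoc]
        norm_num

end DoubleDivergence

section Superposition

variable {Ω : Type*} [MeasurableSpace Ω] {ν : Measure Ω} {w : Ω → ℝ} {τ : Ω → E3}

/-- Weighted superposition of the translates `g (· - τ ω)`. -/
def superpose (ν : Measure Ω) (w : Ω → ℝ) (τ : Ω → E3) {F : Type*} [NormedAddCommGroup F]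
    [NormedSpace ℝ F] (g : E3 → F) (x : E3) : F :=
  ∫ ω, w ω • g (x - τ ω) ∂ν

variable {F : Type*} [NormedAddCommGroup F] [NormedSpace ℝ F]

lemma aestronglyMeasurable_superpose_integrand (hw : Integrable w ν) (hτ : Measurable τ)
    {g : E3 → F} (hg : Continuous g) (x : E3) :
    AEStronglyMeasurable (fun ω => w ω • g (x - τ ω)) ν :=
  hw.aestronglyMeasurable.smul
    (hg.comp_aestronglyMeasurable (hτ.const_sub x).aestronglyMeasurable)

lemma integrable_superpose_integrand (hw : Integrable w ν) (hτ : Measurable τ)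
    {g : E3 → F} (hg : Continuous g) (hs : HasCompactSupport g) (x : E3) :
    Integrable (fun ω => w ω • g (x - τ ω)) ν := by
  obtain ⟨C, hC⟩ := hs.exists_bound_of_continuous hg
  refine (hw.norm.mul_const C).mono' (aestronglyMeasurable_superpose_integrand hw hτ hg x)
    (Filter.Eventually.of_forall fun ω => ?_)
  rw [norm_smul]
  gcongr
  exact hC _

lemma hasFDerivAt_superpose (hw : Integrable w ν) (hτ : Measurable τ)
    {g : E3 → F} (hg : ContDiff ℝ (⊤ : ℕ∞) g) (hs : HasCompactSupport g) (x : E3) :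
    HasFDerivAt (superpose ν w τ g) (superpose ν w τ (fderiv ℝ g) x) x := by
  have hg' := contDiff_fderiv_top hg
  obtain ⟨C, hC⟩ := (hs.fderiv ℝ).exists_bound_of_continuous hg'.continuous
  refine hasFDerivAt_integral_of_dominated_of_fderiv_le (s := univ)
    (F' := fun x ω => w ω • fderiv ℝ g (x - τ ω)) (bound := fun ω => ‖w ω‖ * C) Filter.univ_mem
    (Filter.Eventually.of_forall (aestronglyMeasurable_superpose_integrand hw hτ hg.continuous))
    (integrable_superpose_integrand hw hτ hg.continuous hs x)
    (aestronglyMeasurable_superpose_integrand hw hτ hg'.continuous x)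
    (Filter.Eventually.of_forall fun ω y _ => ?_) (hw.norm.mul_const C)
    (Filter.Eventually.of_forall fun ω y _ => ?_)
  · rw [norm_smul]
    gcongr
    exact hC _
  · have := (hasFDerivAt_of_contDiff_top hg (y - τ ω)).comp y ((hasFDerivAt_id y).sub_const (τ ω))
    exact this.const_smul (w ω)

lemma contDiff_superpose (hw : Integrable w ν) (hτ : Measurable τ)
    {g : E3 → F} (hg : ContDiff ℝ (⊤ : ℕ∞) g) (hs : HasCompactSupport g) :
    ContDiff ℝ (⊤ : ℕ∞) (superpose ν w τ g) := by
  rw [contDiff_infty]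
  intro n
  induction n generalizing F with
  | zero =>
    exact contDiff_zero.2 (continuous_iff_continuousAt.2 fun x =>
      (hasFDerivAt_superpose hw hτ hg hs x).continuousAt)
  | succ n ih =>
    have h := hasFDerivAt_superpose hw hτ hg hs
    rw [Nat.cast_succ]
    refine contDiff_succ_iff_fderiv.2 ⟨fun x => (h x).differentiableAt, by simp, ?_⟩
    rw [funext fun x => (h x).fderiv]
    exact ih (contDiff_fderiv_top hg) (hs.fderiv ℝ)

lemma map_superpose {G : Type*} [NormedAddCommGroup G] [NormedSpace ℝ G] (L : G ≃ₗᵢ[ℝ] F)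
    (g : E3 → G) (x : E3) :
    L (superpose ν w τ g x) = superpose ν w τ (L ∘ g) x := by
  refine (L.toContinuousLinearEquiv.integral_comp_comm _).symm.trans ?_
  simp [superpose]

lemma contDiff_iteratedFDeriv_top {g : E3 → F} (hg : ContDiff ℝ (⊤ : ℕ∞) g) (d : ℕ) :
    ContDiff ℝ (⊤ : ℕ∞) (iteratedFDeriv ℝ d g) :=
  hg.iteratedFDeriv_right (by norm_cast)

lemma iteratedFDeriv_superpose (hw : Integrable w ν) (hτ : Measurable τ)
    {g : E3 → F} (hg : ContDiff ℝ (⊤ : ℕ∞) g) (hs : HasCompactSupport g) (d : ℕ) :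
    iteratedFDeriv ℝ d (superpose ν w τ g) = superpose ν w τ (iteratedFDeriv ℝ d g) := by
  induction d with
  | zero =>
    funext x
    exact map_superpose (continuousMultilinearCurryFin0 ℝ E3 F).symm g x
  | succ d ih =>
    funext x
    rw [iteratedFDeriv_succ_eq_comp_left, iteratedFDeriv_succ_eq_comp_left, ih]
    simp only [Function.comp_apply]
    rw [(hasFDerivAt_superpose hw hτ (contDiff_iteratedFDeriv_top hg d)
      (hs.iteratedFDeriv (𝕜 := ℝ) d) x).fderiv]
    exact map_superpose (ν := ν) (w := w) (τ := τ) (F := E3 [×(d + 1)]→L[ℝ] F)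
      (G := E3 →L[ℝ] E3 [×d]→L[ℝ] F)
      (continuousMultilinearCurryLeftEquiv ℝ (fun _ : Fin (d + 1) => E3) F).symm _ x

lemma pd_superpose (hw : Integrable w ν) (hτ : Measurable τ)
    {g : E3 → ℝ} (hg : ContDiff ℝ (⊤ : ℕ∞) g) (hs : HasCompactSupport g) (i : Fin 3) :
    pd (superpose ν w τ g) i = superpose ν w τ (pd g i) := by
  funext x
  simp only [pd, (hasFDerivAt_superpose hw hτ hg hs x).fderiv]
  simp only [superpose]
  rw [ContinuousLinearMap.integral_apply
    (integrable_superpose_integrand hw hτ (contDiff_fderiv_top hg).continuous (hs.fderiv ℝ) x)]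
  rfl

end Superposition

section Mollifier

/-- `ρ` is a smooth even mollifier supported in the ball of radius `η`, and `k` is a smooth
function with the same support property and `∇k(z) = -ρ(z) z`. -/
structure MollifierPair (η : ℝ) (ρ k : E3 → ℝ) : Prop where
  contDiff_left : ContDiff ℝ (⊤ : ℕ∞) ρ
  contDiff_right : ContDiff ℝ (⊤ : ℕ∞) k
  zero_left : ∀ z, η ≤ ‖z‖ → ρ z = 0
  zero_right : ∀ z, η ≤ ‖z‖ → k z = 0
  even : ∀ z, ρ (-z) = ρ z
  integral_eq : ∫ z, ρ z = 1
  fderiv_right : ∀ z v, fderiv ℝ k z v = -ρ z * inner ℝ z v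

lemma hasCompactSupport_of_zero_of_le_norm {F : Type*} [Zero F] {η : ℝ} {f : E3 → F}
    (h : ∀ z, η ≤ ‖z‖ → f z = 0) : HasCompactSupport f :=
  HasCompactSupport.intro (isCompact_closedBall 0 η) fun z hz => h z (by
    simp only [mem_closedBall, dist_zero_right, not_le] at hz
    exact hz.le)

lemma exists_mollifierPair {η : ℝ} (hη : 0 < η) : ∃ ρ k, MollifierPair η ρ k := by
  set θ : ℝ → ℝ := fun t => Real.smoothTransition (1 - t / η ^ 2) with hθ
  have cθ : ContDiff ℝ (⊤ : ℕ∞) θ := Real.smoothTransition.contDiff.comp (by fun_prop)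
  have θ0 : ∀ t, η ^ 2 ≤ t → θ t = 0 := fun t ht =>
    Real.smoothTransition.zero_of_nonpos (by
      rw [sub_nonpos, le_div_iff₀ (by positivity), one_mul]; exact ht)
  set B : ℝ → ℝ := fun t => ∫ r in (η ^ 2)..t, θ r with hB
  have dB : ∀ t, HasDerivAt B (θ t) t := fun t =>
    intervalIntegral.integral_hasDerivAt_right (cθ.continuous.intervalIntegrable _ _)
      (cθ.continuous.stronglyMeasurableAtFilter _ _) cθ.continuous.continuousAt
  have cB : ContDiff ℝ (⊤ : ℕ∞) B := by
    refine contDiff_infty_iff_deriv.2 ⟨fun t => (dB t).differentiableAt, ?_⟩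
    rw [funext fun t => (dB t).deriv]
    exact cθ
  have B0 : ∀ t, η ^ 2 ≤ t → B t = 0 := fun t ht => by
    refine (intervalIntegral.integral_congr fun r hr => ?_).trans
      intervalIntegral.integral_zero
    rw [uIcc_of_le ht] at hr
    exact θ0 r hr.1
  have sq_le : ∀ z : E3, η ≤ ‖z‖ → η ^ 2 ≤ ‖z‖ ^ 2 := fun z hz =>
    pow_le_pow_left₀ hη.le hz 2
  set ρ : E3 → ℝ := fun z => θ (‖z‖ ^ 2) with hρ
  have cρ : ContDiff ℝ (⊤ : ℕ∞) ρ := cθ.comp (contDiff_norm_sq ℝ)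
  have ρ0 : ∀ z, η ≤ ‖z‖ → ρ z = 0 := fun z hz => θ0 _ (sq_le z hz)
  have hpos : 0 < ∫ z, ρ z := by
    refine cρ.continuous.integral_pos_of_hasCompactSupport_nonneg_nonzero
      (hasCompactSupport_of_zero_of_le_norm ρ0) (fun z => Real.smoothTransition.nonneg _)
      (x := 0) ?_
    simp [hρ, hθ]
  set c := ∫ z, ρ z
  refine ⟨fun z => c⁻¹ * ρ z, fun z => -c⁻¹ * (2⁻¹ * B (‖z‖ ^ 2)), contDiff_const.mul cρ,
    contDiff_const.mul (contDiff_const.mul (cB.comp (contDiff_norm_sq ℝ))),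
    fun z hz => by simp [ρ0 z hz], fun z hz => by simp [B0 _ (sq_le z hz)],
    fun z => by simp [hρ], ?_, fun z v => ?_⟩
  · rw [integral_const_mul, inv_mul_cancel₀ hpos.ne']
  · have h1 := (dB (‖z‖ ^ 2)).comp_hasFDerivAt z (hasStrictFDerivAt_norm_sq z).hasFDerivAt
    have h2 := (h1.const_mul (2⁻¹ : ℝ)).const_mul (-c⁻¹)
    have h3 : fderiv ℝ (fun z => -c⁻¹ * (2⁻¹ * B (‖z‖ ^ 2))) z = _ := h2.fderiv
    rw [h3]
    simp [hρ]
    ring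

variable {η : ℝ} {ρ k ψ : E3 → ℝ}

lemma MollifierPair.hasCompactSupport_left (h : MollifierPair η ρ k) : HasCompactSupport ρ :=
  hasCompactSupport_of_zero_of_le_norm h.zero_left

lemma MollifierPair.hasCompactSupport_right (h : MollifierPair η ρ k) : HasCompactSupport k :=
  hasCompactSupport_of_zero_of_le_norm h.zero_right

lemma fderiv_apply_eq_sum (f : E3 → ℝ) (x z : E3) :
    fderiv ℝ f x z = ∑ i, z i * pd f i x := by
  have hz : z = ∑ i, z i • (EuclideanSpace.single i (1 : ℝ) : E3) := by
    ext j; simp [Pi.single_apply]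
  conv_lhs => rw [hz]
  simp [pd]

lemma contDiff_pd (hψ : ContDiff ℝ (⊤ : ℕ∞) ψ) (i : Fin 3) : ContDiff ℝ (⊤ : ℕ∞) (pd ψ i) :=
  (contDiff_fderiv_top hψ).clm_apply contDiff_const

lemma hasCompactSupport_pd (hs : HasCompactSupport ψ) (i : Fin 3) : HasCompactSupport (pd ψ i) :=
  hs.fderiv_apply ℝ _

lemma MollifierPair.integral_dilate_fderiv (h : MollifierPair η ρ k)
    (hψ : ContDiff ℝ (⊤ : ℕ∞) ψ) (x : E3) (s : ℝ) :
    ∫ z, ρ z * fderiv ℝ ψ (x - s • z) (-z)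
      = s * ∫ z, k z * ∑ i, pd (pd ψ i) i (x - s • z) := by
  have cp := fun i => contDiff_pd hψ i
  have cpp := fun i => (contDiff_pd (cp i) i).continuous
  have ck := h.contDiff_right
  have kc := h.hasCompactSupport_right
  have dcomp : ∀ i z, HasFDerivAt (fun z => pd ψ i (x - s • z))
      ((fderiv ℝ (pd ψ i) (x - s • z)).comp (-(s • ContinuousLinearMap.id ℝ E3))) z := fun i z =>
    (hasFDerivAt_of_contDiff_top (cp i) _).comp z
      (((hasFDerivAt_id z).const_smul s).const_sub x)
  have pdcomp : ∀ i z, fderiv ℝ (fun z => pd ψ i (x - s • z)) z (EuclideanSpace.single i 1)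
      = -s * pd (pd ψ i) i (x - s • z) := fun i z => by
    rw [(dcomp i z).fderiv]
    simp [pd]
  have i1 : ∀ i, Integrable fun z => pd k i z * pd ψ i (x - s • z) := fun i => by
    refine Continuous.integrable_of_hasCompactSupport ?_ ((hasCompactSupport_pd kc i).mul_right)
    have := (contDiff_pd ck i).continuous
    have := (cp i).continuous
    fun_prop
  have i2 : ∀ i, Integrable fun z => k z * pd (pd ψ i) i (x - s • z) := fun i => by
    refine Continuous.integrable_of_hasCompactSupport ?_ (kc.mul_right)
    have := cpp i
    have := ck.continuous
    fun_prop
  have i3 : ∀ i, Integrable fun z => k z * pd ψ i (x - s • z) := fun i => by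
    refine Continuous.integrable_of_hasCompactSupport ?_ (kc.mul_right)
    have := (cp i).continuous
    have := ck.continuous
    fun_prop
  have ibp : ∀ i, ∫ z, pd k i z * pd ψ i (x - s • z)
      = s * ∫ z, k z * pd (pd ψ i) i (x - s • z) := fun i => by
    have := integral_mul_fderiv_eq_neg_fderiv_mul_of_integrable (μ := volume) (f := k)
      (g := fun z => pd ψ i (x - s • z)) (v := EuclideanSpace.single i 1) (i1 i)
      (by
        simp only [pdcomp]
        refine ((i2 i).const_mul (-s)).congr (Filter.Eventually.of_forall fun z => ?_)
        ring) (i3 i)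
      (fun z _ => (hasFDerivAt_of_contDiff_top ck z).differentiableAt)
      (fun z _ => (dcomp i z).differentiableAt)
    simp only [pdcomp] at this
    change ∫ z, fderiv ℝ k z (EuclideanSpace.single i 1) * pd ψ i (x - s • z) = _
    rw [← neg_eq_iff_eq_neg.2 this, ← integral_neg, ← integral_const_mul]
    refine integral_congr_ae (Filter.Eventually.of_forall fun z => ?_)
    ring
  calc ∫ z, ρ z * fderiv ℝ ψ (x - s • z) (-z)
      = ∫ z, ∑ i, pd k i z * pd ψ i (x - s • z) := by
        refine integral_congr_ae (Filter.Eventually.of_forall fun z => ?_)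
        simp only [fderiv_apply_eq_sum ψ, Finset.mul_sum]
        refine Finset.sum_congr rfl fun i _ => ?_
        have : pd k i z = -ρ z * z i := by
          simp [pd, h.fderiv_right, EuclideanSpace.inner_single_right]
        rw [this, PiLp.neg_apply]
        ring
    _ = ∑ i, s * ∫ z, k z * pd (pd ψ i) i (x - s • z) := by
        rw [integral_finsetSum _ fun i _ => i1 i]
        exact Finset.sum_congr rfl fun i _ => ibp i
    _ = _ := by
        simp only [Finset.mul_sum]
        rw [integral_finsetSum _ fun i _ => i2 i, Finset.mul_sum]

lemma MollifierPair.hasDerivAt_dilate (h : MollifierPair η ρ k)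
    (hψ : ContDiff ℝ (⊤ : ℕ∞) ψ) (hs : HasCompactSupport ψ) (x : E3) (s : ℝ) :
    HasDerivAt (fun s : ℝ => ∫ z, ρ z * ψ (x - s • z))
      (s * ∫ z, k z * ∑ i, pd (pd ψ i) i (x - s • z)) s := by
  rw [← h.integral_dilate_fderiv hψ]
  have cψ := hψ.continuous
  have cψ' := (contDiff_fderiv_top hψ).continuous
  have cρ := h.contDiff_left.continuous
  have ρc := h.hasCompactSupport_left
  obtain ⟨C, hC⟩ := (hs.fderiv ℝ).exists_bound_of_continuous cψ'
  refine (hasDerivAt_integral_of_dominated_loc_of_deriv_le (𝕜 := ℝ) (μ := volume) (s := univ)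
    (x₀ := s) (F := fun (s : ℝ) (z : E3) => ρ z * ψ (x - s • z))
    (F' := fun (s : ℝ) (z : E3) => ρ z * fderiv ℝ ψ (x - s • z) (-z))
    (bound := fun z => ‖ρ z‖ * (C * ‖z‖)) Filter.univ_mem
    (Filter.Eventually.of_forall fun s => Continuous.aestronglyMeasurable (by fun_prop))
    (Continuous.integrable_of_hasCompactSupport (by fun_prop) ρc.mul_right)
    (Continuous.aestronglyMeasurable (by fun_prop))
    (Filter.Eventually.of_forall fun z s _ => ?_)
    (Continuous.integrable_of_hasCompactSupport (by fun_prop) ρc.norm.mul_right)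
    (Filter.Eventually.of_forall fun z s _ => ?_)).2
  · rw [norm_mul]
    gcongr
    refine (ContinuousLinearMap.le_opNorm _ _).trans ?_
    rw [norm_neg]
    gcongr
    exact hC _
  · have h1 : HasDerivAt (fun s : ℝ => x - s • z) (-z) s := by
      simpa using ((hasDerivAt_id s).smul_const z).const_sub x
    exact ((hasFDerivAt_of_contDiff_top hψ _).comp_hasDerivAt s h1).const_mul _

end Mollifier

section Parametrix

variable {η : ℝ} {ρ k ψ : E3 → ℝ}

/-- Smooth average over dilates of the kernel `k`: a parametrix of the Laplacian. -/
def parametrix (k ψ : E3 → ℝ) : E3 → ℝ :=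
  superpose ((volume.restrict (Icc (0 : ℝ) 1)).prod volume)
    (fun ω : ℝ × E3 => ω.1 * k ω.2) (fun ω => ω.1 • ω.2) ψ

lemma MollifierPair.integrable_weight (h : MollifierPair η ρ k) :
    Integrable (fun ω : ℝ × E3 => ω.1 * k ω.2)
      ((volume.restrict (Icc (0 : ℝ) 1)).prod volume) :=
  Integrable.mul_prod (f := fun s : ℝ => s)
    (continuous_id.integrableOn_Icc)
    (h.contDiff_right.continuous.integrable_of_hasCompactSupport h.hasCompactSupport_right)

lemma measurable_smul_pair : Measurable fun ω : ℝ × E3 => ω.1 • ω.2 := by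
  fun_prop

lemma MollifierPair.contDiff_parametrix (h : MollifierPair η ρ k)
    (hψ : ContDiff ℝ (⊤ : ℕ∞) ψ) (hs : HasCompactSupport ψ) :
    ContDiff ℝ (⊤ : ℕ∞) (parametrix k ψ) :=
  contDiff_superpose h.integrable_weight measurable_smul_pair hψ hs

lemma MollifierPair.tsupport_parametrix_subset (h : MollifierPair η ρ k) {xo : E3} {r : ℝ}
    (h0 : ∀ x, r < dist x xo → ψ x = 0) :
    tsupport (parametrix k ψ) ⊆ closedBall xo (r + η) := by
  refine closure_minimal (fun x hx => ?_) isClosed_closedBall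
  by_contra hx'
  refine hx ?_
  have hd : r + η < dist x xo := by simpa using hx'
  refine (integral_congr_ae ?_).trans (integral_zero _ _)
  have : ∀ᵐ ω ∂((volume.restrict (Icc (0 : ℝ) 1)).prod (volume : Measure E3)),
      ω.1 ∈ Icc (0 : ℝ) 1 :=
    Measure.quasiMeasurePreserving_fst.ae (ae_restrict_mem measurableSet_Icc)
  filter_upwards [this] with ω hω
  by_cases hz : η ≤ ‖ω.2‖
  · simp [h.zero_right _ hz]
  · have : ‖ω.1 • ω.2‖ ≤ η := by
      rw [norm_smul, Real.norm_eq_abs, abs_of_nonneg hω.1]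
      calc ω.1 * ‖ω.2‖ ≤ 1 * ‖ω.2‖ := by gcongr; exact hω.2
        _ ≤ η := by linarith
    have h1 : dist x xo ≤ ‖ω.1 • ω.2‖ + dist (x - ω.1 • ω.2) xo := by
      refine (dist_triangle x (x - ω.1 • ω.2) xo).trans_eq ?_
      rw [dist_eq_norm x, sub_sub_cancel]
    rw [h0 _ (by linarith), smul_zero]

lemma MollifierPair.laplacian_parametrix (h : MollifierPair η ρ k)
    (hψ : ContDiff ℝ (⊤ : ℕ∞) ψ) (hs : HasCompactSupport ψ) (x : E3) :
    ∑ i, pd (pd (parametrix k ψ) i) i x = (∫ z, ρ z * ψ (x - z)) - ψ x := by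
  have e : ∀ i, pd (pd (parametrix k ψ) i) i = superpose _ _ _ (pd (pd ψ i) i) := fun i => by
    rw [parametrix, pd_superpose h.integrable_weight measurable_smul_pair hψ hs,
      pd_superpose h.integrable_weight measurable_smul_pair (contDiff_pd hψ i)
        (hasCompactSupport_pd hs i)]
  have int := fun i => integrable_superpose_integrand h.integrable_weight measurable_smul_pair
    (contDiff_pd (contDiff_pd hψ i) i).continuous
    (hasCompactSupport_pd (hasCompactSupport_pd hs i) i) x
  simp only [e, superpose]
  rw [← integral_finsetSum _ fun i _ => int i, integral_prod _ (integrable_finsetSum _ fun i _ => int i)]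
  have key : ∀ s : ℝ, ∫ z, ∑ i, (s * k z) • pd (pd ψ i) i (x - s • z)
      = s * ∫ z, k z * ∑ i, pd (pd ψ i) i (x - s • z) := fun s => by
    rw [← integral_const_mul]
    refine integral_congr_ae (Filter.Eventually.of_forall fun z => ?_)
    simp only [smul_eq_mul, Finset.mul_sum, mul_assoc]
  simp only [key]
  rw [integral_Icc_eq_integral_Ioc, ← intervalIntegral.integral_of_le zero_le_one,
    intervalIntegral.integral_eq_sub_of_hasDerivAt
      (fun s _ => h.hasDerivAt_dilate hψ hs x s)]
  · simp [integral_mul_const, h.integral_eq]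
  · rw [intervalIntegrable_iff_integrableOn_Icc_of_le zero_le_one]
    have := (integrable_finsetSum Finset.univ fun i _ => int i).integral_prod_left
    refine this.congr (Filter.Eventually.of_forall fun s => ?_)
    exact key s

end Parametrix

section Remainder

variable {η : ℝ} {ρ k ψ R : E3 → ℝ}

lemma MollifierPair.integral_sub_superpose_mul (h : MollifierPair η ρ k) (hR : Integrable R)
    (hψ : ContDiff ℝ (⊤ : ℕ∞) ψ) (hs : HasCompactSupport ψ) :
    ∫ x, (R x - superpose volume R id ρ x) * ψ x
      = -∫ x, R x * ∑ i, pd (pd (parametrix k ψ) i) i x := by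
  have cρ := h.contDiff_left.continuous
  have ρc := h.hasCompactSupport_left
  have cψ := hψ.continuous
  obtain ⟨Cψ, hCψ⟩ := hs.exists_bound_of_continuous cψ
  obtain ⟨Cρ, hCρ⟩ := ρc.exists_bound_of_continuous cρ
  have iψ : Integrable ψ := cψ.integrable_of_hasCompactSupport hs
  have i1 : Integrable fun x => R x * ψ x :=
    hR.mul_bdd cψ.aestronglyMeasurable (Filter.Eventually.of_forall hCψ)
  have i2 : Integrable fun x => superpose volume R id ρ x * ψ x :=
    Continuous.integrable_of_hasCompactSupport
      ((contDiff_superpose hR measurable_id h.contDiff_left ρc).continuous.mul cψ) hs.mul_left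
  have ip : Integrable (fun ω : E3 × E3 => (R ω.1 * ψ ω.2) * ρ (ω.2 - ω.1))
      (volume.prod volume) :=
    (hR.mul_prod iψ).mul_bdd (c := Cρ) (Continuous.aestronglyMeasurable (by fun_prop))
      (Filter.Eventually.of_forall fun ω => hCρ _)
  have conv : ∀ x, R x * ∫ z, ρ z * ψ (x - z) = ∫ y, (R x * ψ y) * ρ (y - x) := fun x => by
    rw [← integral_sub_left_eq_self (fun z => ρ z * ψ (x - z)) volume x, ← integral_const_mul]
    refine integral_congr_ae (Filter.Eventually.of_forall fun y => ?_)
    simp only [sub_sub_cancel]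
    rw [← h.even (x - y), neg_sub]
    ring
  have i3 : Integrable fun x => R x * ∫ z, ρ z * ψ (x - z) := by
    simp only [conv]
    exact ip.integral_prod_left
  have swap : ∫ x, R x * ∫ z, ρ z * ψ (x - z) = ∫ x, superpose volume R id ρ x * ψ x := by
    simp only [conv]
    rw [integral_integral_swap ip]
    refine integral_congr_ae (Filter.Eventually.of_forall fun y => ?_)
    simp only [superpose, ← integral_mul_const]
    refine integral_congr_ae (Filter.Eventually.of_forall fun x => ?_)
    simp only [smul_eq_mul, id]
    ring
  simp only [h.laplacian_parametrix hψ hs, sub_mul, mul_sub]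
  rw [integral_sub i1 i2, integral_sub i3 i1, swap]
  ring

lemma MollifierPair.exists_lintegral_laplacian_parametrix_le (h : MollifierPair η ρ k)
    {q p : ℝ} (hqp : q.HolderConjugate p) (xo : E3) (r : ℝ) :
    ∃ C : ℝ≥0, ∀ ψ : E3 → ℝ, ContDiff ℝ (⊤ : ℕ∞) ψ → (∀ x, r < dist x xo → ψ x = 0) →
      ∫⁻ x, ENNReal.ofReal (|∑ i, pd (pd (parametrix k ψ) i) i x| ^ q)
        ≤ C * ∫⁻ x, ENNReal.ofReal (|ψ x| ^ q) := by
  have cρ := h.contDiff_left.continuous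
  have hq := hqp.pos
  have hp := hqp.symm.pos
  set N : ℝ≥0∞ := ∫⁻ z, ENNReal.ofReal |ρ z| ^ p with hN
  have Nfin : N ≠ ∞ := by
    have h1 : Integrable fun z => |ρ z| ^ p :=
      Continuous.integrable_of_hasCompactSupport
        (cρ.abs.rpow_const fun _ => Or.inr hp.le)
        (h.hasCompactSupport_left.comp_left (g := fun t => |t| ^ p)
          (by simp [Real.zero_rpow hp.ne']))
    have h2 := h1.lintegral_lt_top.ne
    convert h2 using 2
    funext z
    rw [ENNReal.ofReal_rpow_of_nonneg (abs_nonneg _) hp.le]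
  set V : ℝ≥0∞ := volume (closedBall xo (r + η))
  have Vfin : V ≠ ∞ := measure_closedBall_lt_top.ne
  set K : ℝ≥0∞ := 2 ^ (q - 1) * (V * N ^ (q / p) + 1)
  have Kfin : K ≠ ∞ := by
    refine ENNReal.mul_ne_top (ENNReal.rpow_ne_top_of_nonneg hqp.sub_one_pos.le (by simp))
      (ENNReal.add_ne_top.2 ⟨ENNReal.mul_ne_top Vfin
        (ENNReal.rpow_ne_top_of_nonneg (by positivity) Nfin), by simp⟩)
  refine ⟨K.toNNReal, fun ψ hψ h0 => ?_⟩
  rw [ENNReal.coe_toNNReal Kfin]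
  have cψ := hψ.continuous
  have hs : HasCompactSupport ψ := HasCompactSupport.intro (isCompact_closedBall xo r)
    fun x hx => h0 x (by simpa using hx)
  set I : ℝ≥0∞ := ∫⁻ x, ENNReal.ofReal (|ψ x| ^ q)
  set conv : E3 → ℝ := fun x => ∫ z, ρ z * ψ (x - z)
  have conv_le : ∀ x, ENNReal.ofReal (|conv x| ^ q)
      ≤ (closedBall xo (r + η)).indicator (fun _ => N ^ (q / p) * I) x := fun x => by
    by_cases hx : x ∈ closedBall xo (r + η)
    · rw [indicator_of_mem hx, ← ENNReal.ofReal_rpow_of_nonneg (abs_nonneg _) hq.le]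
      have h1 : ENNReal.ofReal |conv x|
          ≤ ∫⁻ z, ENNReal.ofReal |ρ z| * ENNReal.ofReal |ψ (x - z)| := by
        rw [← Real.norm_eq_abs, ofReal_norm]
        refine (enorm_integral_le_lintegral_enorm _).trans_eq (lintegral_congr fun z => ?_)
        rw [enorm_mul, ← ofReal_norm, ← ofReal_norm, Real.norm_eq_abs, Real.norm_eq_abs]
      have h2 := ENNReal.lintegral_mul_le_Lp_mul_Lq volume hqp.symm
        (f := fun z => ENNReal.ofReal |ρ z|) (g := fun z => ENNReal.ofReal |ψ (x - z)|)
        cρ.abs.measurable.ennreal_ofReal.aemeasurable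
        (Continuous.measurable (by fun_prop)).ennreal_ofReal.aemeasurable
      have h3 : ∫⁻ z, ENNReal.ofReal |ψ (x - z)| ^ q = I := by
        rw [lintegral_sub_left_eq_self (fun z => ENNReal.ofReal |ψ z| ^ q)]
        exact lintegral_congr fun z => ENNReal.ofReal_rpow_of_nonneg (abs_nonneg _) hq.le
      rw [h3] at h2
      refine (ENNReal.rpow_le_rpow (h1.trans h2) hq.le).trans_eq ?_
      rw [ENNReal.mul_rpow_of_nonneg _ _ hq.le, ← ENNReal.rpow_mul, ← ENNReal.rpow_mul,
        one_div_mul_cancel hq.ne', ENNReal.rpow_one]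
      congr 2
      ring
    · have hd : r + η < dist x xo := by simpa using hx
      have : conv x = 0 := by
        refine (integral_congr_ae (Filter.Eventually.of_forall fun z => ?_)).trans
          (integral_zero _ _)
        by_cases hz : η ≤ ‖z‖
        · simp [h.zero_left z hz]
        · have h1 : dist x xo ≤ ‖z‖ + dist (x - z) xo := by
            refine (dist_triangle x (x - z) xo).trans_eq ?_
            rw [dist_eq_norm x, sub_sub_cancel]
          simp [h0 (x - z) (by linarith)]
      rw [indicator_of_notMem hx, this]
      simp [Real.zero_rpow hq.ne']
  calc ∫⁻ x, ENNReal.ofReal (|∑ i, pd (pd (parametrix k ψ) i) i x| ^ q)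
      ≤ ∫⁻ x, 2 ^ (q - 1) * ((closedBall xo (r + η)).indicator (fun _ => N ^ (q / p) * I) x
          + ENNReal.ofReal (|ψ x| ^ q)) := by
        refine lintegral_mono fun x => ?_
        rw [h.laplacian_parametrix hψ hs]
        refine le_trans ?_ (mul_le_mul_right (add_le_add_left (conv_le x) _) _)
        rw [← ENNReal.ofReal_rpow_of_nonneg (abs_nonneg _) hq.le,
          ← ENNReal.ofReal_rpow_of_nonneg (abs_nonneg _) hq.le,
          ← ENNReal.ofReal_rpow_of_nonneg (abs_nonneg _) hq.le]
        refine le_trans (ENNReal.rpow_le_rpow ?_ hq.le)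
          (ENNReal.rpow_add_le_mul_rpow_add_rpow _ _ hqp.lt.le)
        rw [← ENNReal.ofReal_add (abs_nonneg _) (abs_nonneg _)]
        exact ENNReal.ofReal_le_ofReal (abs_sub _ _)
    _ = K * I := by
        rw [lintegral_const_mul' _ _ (ENNReal.rpow_ne_top_of_nonneg hqp.sub_one_pos.le (by simp)),
          lintegral_add_left (measurable_const.indicator measurableSet_closedBall),
          lintegral_indicator measurableSet_closedBall, setLIntegral_const]
        ring

end Remainder

section Duality

variable {f w : E3 → ℝ} {xo : E3} {r δ M : ℝ}

lemma exists_contDiff_approximation (hδ : 0 < δ) (hw : Measurable w)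
    (hM : ∀ x, |w x| ≤ M) (h0 : ∀ x, r < dist x xo → w x = 0) :
    ∃ ψ : ℕ → E3 → ℝ, (∀ n, ContDiff ℝ (⊤ : ℕ∞) (ψ n)) ∧ (∀ n x, |ψ n x| ≤ M) ∧
      (∀ n x, r + δ < dist x xo → ψ n x = 0) ∧
      ∀ᵐ x, Filter.Tendsto (fun n => ψ n x) Filter.atTop (nhds (w x)) := by
  have hw_int : LocallyIntegrable w :=
    (locallyIntegrable_const M).mono hw.aestronglyMeasurable
      (Filter.Eventually.of_forall fun x => (hM x).trans (le_abs_self M))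
  let φ : ℕ → ContDiffBump (0 : E3) := fun n =>
    { rIn := δ / (n + 1) / 2
      rOut := δ / (n + 1)
      rIn_pos := by positivity
      rIn_lt_rOut := half_lt_self (by positivity) }
  refine ⟨fun n => convolution ((φ n).normed volume) w (ContinuousLinearMap.lsmul ℝ ℝ) volume,
    fun n => (φ n).hasCompactSupport_normed.contDiff_convolution_left _ (φ n).contDiff_normed
      hw_int, fun n x => ?_, fun n x hx => ?_, ?_⟩
  · rw [← Real.norm_eq_abs]
    refine (norm_integral_le_of_norm_le ((φ n).integrable_normed.mul_const M)
      (Filter.Eventually.of_forall fun t => ?_)).trans_eq ?_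
    · simp only [ContinuousLinearMap.lsmul_apply, smul_eq_mul, norm_mul, Real.norm_eq_abs,
        abs_of_nonneg ((φ n).nonneg_normed t)]
      gcongr
      · exact (φ n).nonneg_normed t
      · exact hM _
    · rw [integral_mul_const, (φ n).integral_normed, one_mul]
  · refine (integral_congr_ae (Filter.Eventually.of_forall fun t => ?_)).trans
      (integral_zero _ _)
    simp only [ContinuousLinearMap.lsmul_apply, smul_eq_mul, mul_eq_zero]
    by_cases ht : ‖t‖ < δ
    · right
      refine h0 _ ?_
      have h1 : dist x xo ≤ ‖t‖ + dist (x - t) xo := by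
        refine (dist_triangle x (x - t) xo).trans_eq ?_
        rw [dist_eq_norm x, sub_sub_cancel]
      linarith
    · left
      rw [← Function.notMem_support, (φ n).support_normed_eq]
      have : δ / (n + 1) ≤ δ := div_le_self hδ.le (by linarith [n.cast_nonneg (α := ℝ)])
      simp only [mem_ball, dist_zero_right, not_lt]
      change δ / (n + 1) ≤ ‖t‖
      linarith
  · refine ContDiffBump.ae_convolution_tendsto_right_of_locallyIntegrable (K := 2) ?_
      (Filter.Eventually.of_forall fun n => ?_) hw_int
    · change Filter.Tendsto (fun n : ℕ => δ / ((n : ℝ) + 1)) _ _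
      simpa [div_eq_mul_inv] using
        (tendsto_one_div_add_atTop_nhds_zero_nat (𝕜 := ℝ)).const_mul δ
    · change δ / (n + 1) ≤ 2 * (δ / (n + 1) / 2)
      linarith

lemma abs_integral_mul_le_of_forall_contDiff {q : ℝ} (hq : 0 < q) {c Λ : ℝ≥0∞} (hc : c ≠ ∞)
    (hδ : 0 < δ) (hf : LocallyIntegrable f)
    (H : ∀ ψ : E3 → ℝ, ContDiff ℝ (⊤ : ℕ∞) ψ → (∀ x, r + δ < dist x xo → ψ x = 0) →
      ENNReal.ofReal |∫ x, f x * ψ x| ≤ c * ((∫⁻ x, ENNReal.ofReal (|ψ x| ^ q)) + Λ))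
    (hw : Measurable w) (hM : ∀ x, |w x| ≤ M) (h0 : ∀ x, r < dist x xo → w x = 0) :
    ENNReal.ofReal |∫ x, f x * w x| ≤ c * ((∫⁻ x, ENNReal.ofReal (|w x| ^ q)) + Λ) := by
  obtain ⟨ψ, hψ, hψM, hψ0, hlim⟩ := exists_contDiff_approximation hδ hw hM h0
  set B := closedBall xo (r + δ)
  have mB : MeasurableSet B := measurableSet_closedBall
  have out : ∀ n x, x ∉ B → ψ n x = 0 := fun n x hx => hψ0 n x (by simpa [B] using hx)
  have M0 : 0 ≤ M := (abs_nonneg _).trans (hM xo)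
  have cψ := fun n => (hψ n).continuous
  have t1 : Filter.Tendsto (fun n => ∫ x, f x * ψ n x) Filter.atTop (nhds (∫ x, f x * w x)) := by
    refine tendsto_integral_of_dominated_convergence (B.indicator fun x => ‖f x‖ * M)
      (fun n => hf.aestronglyMeasurable.mul (cψ n).aestronglyMeasurable)
      ((integrable_indicator_iff mB).2
        ((hf.integrableOn_isCompact (isCompact_closedBall _ _)).norm.mul_const M)) (fun n => Filter.Eventually.of_forall fun x => ?_)
      (hlim.mono fun x hx => hx.const_mul _)
    by_cases hx : x ∈ B
    · rw [indicator_of_mem hx, norm_mul]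
      gcongr
      exact hψM n x
    · simp [indicator_of_notMem hx, out n x hx]
  have t2 : Filter.Tendsto (fun n => ∫⁻ x, ENNReal.ofReal (|ψ n x| ^ q)) Filter.atTop
      (nhds (∫⁻ x, ENNReal.ofReal (|w x| ^ q))) := by
    refine tendsto_lintegral_of_dominated_convergence (B.indicator fun _ => ENNReal.ofReal (M ^ q))
      (fun n => ((cψ n).abs.rpow_const fun _ => Or.inr hq.le).measurable.ennreal_ofReal)
      (fun n => Filter.Eventually.of_forall fun x => ?_) ?_
      (hlim.mono fun x hx => ENNReal.tendsto_ofReal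
        (hx.abs.rpow_const (Or.inr hq.le)))
    · by_cases hx : x ∈ B
      · rw [indicator_of_mem hx]
        exact ENNReal.ofReal_le_ofReal
          (Real.rpow_le_rpow (abs_nonneg _) (hψM n x) hq.le)
      · simp [indicator_of_notMem hx, out n x hx, Real.zero_rpow hq.ne']
    · rw [lintegral_indicator mB, setLIntegral_const]
      exact ENNReal.mul_ne_top ENNReal.ofReal_ne_top measure_closedBall_lt_top.ne
  exact le_of_tendsto_of_tendsto' (ENNReal.tendsto_ofReal t1.abs)
    (ENNReal.Tendsto.const_mul (t2.add tendsto_const_nhds) (Or.inr hc))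
    fun n => H (ψ n) (hψ n) (hψ0 n)

lemma exists_setLIntegral_rpow_le_of_forall_contDiff {q p : ℝ} (hqp : q.HolderConjugate p)
    {c : ℝ} (hc : 0 < c) :
    ∃ K : ℝ, 0 < K ∧ ∀ (f : E3 → ℝ) (xo : E3) (r δ : ℝ) (Λ : ℝ≥0∞), 0 < δ → Measurable f →
      LocallyIntegrable f → Λ ≠ ∞ →
      (∀ ψ : E3 → ℝ, ContDiff ℝ (⊤ : ℕ∞) ψ → (∀ x, r + δ < dist x xo → ψ x = 0) →
        ENNReal.ofReal |∫ x, f x * ψ x|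
          ≤ ENNReal.ofReal c * ((∫⁻ x, ENNReal.ofReal (|ψ x| ^ q)) + Λ)) →
      ∫⁻ x in ball xo r, ENNReal.ofReal (|f x| ^ p) ≤ ENNReal.ofReal K * Λ := by
  have hq := hqp.pos
  have hp := hqp.symm.pos
  have hp1 := hqp.symm.sub_one_pos
  have hq1 := hqp.sub_one_pos
  set ε : ℝ := (1 / (2 * c)) ^ (1 / (q - 1)) with hε
  have ε0 : 0 < ε := by positivity
  have hεq : c * ε ^ q = ε / 2 := by
    have h1 : ε ^ (q - 1) = 1 / (2 * c) := by
      rw [hε, ← Real.rpow_mul (by positivity), one_div_mul_cancel hq1.ne', Real.rpow_one]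
    have h2 : ε ^ q = ε ^ (q - 1) * ε := by
      rw [← Real.rpow_add_one ε0.ne', sub_add_cancel]
    rw [h2, h1]
    field_simp
  refine ⟨2 * c / ε, by positivity, fun f xo r δ Λ hδ mf hf hΛ H => ?_⟩
  set S : ℕ → Set E3 := fun n => ball xo r ∩ {x | |f x| ≤ n} with hS
  have mS : ∀ n, MeasurableSet (S n) := fun n =>
    measurableSet_ball.inter (measurableSet_le mf.abs measurable_const)
  have Smono : Monotone S := fun m n hmn x hx =>
    ⟨hx.1, (show |f x| ≤ m from hx.2).trans (Nat.cast_le.2 hmn)⟩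
  have Sunion : ⋃ n, S n = ball xo r := by
    refine Subset.antisymm (iUnion_subset fun n => inter_subset_left) fun x hx => ?_
    obtain ⟨n, hn⟩ := exists_nat_ge |f x|
    exact mem_iUnion.2 ⟨n, hx, hn⟩
  rw [← Sunion, setLIntegral_iUnion_of_directed _ Smono.directed_le]
  refine iSup_le fun n => ?_
  set J := ∫ x in S n, |f x| ^ p
  have intJ : IntegrableOn (fun x => |f x| ^ p) (S n) := by
    refine Measure.integrableOn_of_bounded (M := (n : ℝ) ^ p)
      ((measure_mono inter_subset_left).trans_lt measure_ball_lt_top).ne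
      (mf.abs.pow_const p).aestronglyMeasurable ?_
    filter_upwards [ae_restrict_mem (mS n)] with x hx
    rw [Real.norm_of_nonneg (by positivity)]
    exact Real.rpow_le_rpow (abs_nonneg _) hx.2 hp.le
  have J0 : 0 ≤ J := integral_nonneg fun x => by positivity
  set w : E3 → ℝ := (S n).indicator fun x => ε * (SignType.sign (f x) * |f x| ^ (p - 1)) with hw
  have mw : Measurable w := by
    refine Measurable.indicator ?_ (mS n)
    refine measurable_const.mul (Measurable.mul ?_ (mf.abs.pow_const _))
    have : (fun x => ((SignType.sign (f x) : SignType) : ℝ))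
        = fun x => if 0 < f x then 1 else if f x < 0 then -1 else 0 := by
      funext x
      rw [sign_apply]
      split_ifs <;> simp
    rw [this]
    exact Measurable.ite (measurableSet_lt measurable_const mf) measurable_const
      (Measurable.ite (measurableSet_lt mf measurable_const) measurable_const measurable_const)
  have sgn_le : ∀ t : ℝ, |((SignType.sign t : SignType) : ℝ)| ≤ 1 := fun t => by
    rw [sign_apply]
    split_ifs <;> simp
  have abs_w : ∀ x ∈ S n, |w x| ≤ ε * |f x| ^ (p - 1) := fun x hx => by
    rw [hw, indicator_of_mem hx, abs_mul, abs_mul, abs_of_pos ε0,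
      abs_of_nonneg (by positivity : 0 ≤ |f x| ^ (p - 1))]
    gcongr
    exact mul_le_of_le_one_left (by positivity) (sgn_le _)
  have w0 : ∀ x ∉ S n, w x = 0 := fun x hx => indicator_of_notMem hx _
  have key := abs_integral_mul_le_of_forall_contDiff hq ENNReal.ofReal_ne_top hδ hf H mw
    (M := ε * (n : ℝ) ^ (p - 1))
    (fun x => by
      by_cases hx : x ∈ S n
      · exact (abs_w x hx).trans (by gcongr; exact hx.2)
      · rw [w0 x hx, abs_zero]
        positivity)
    (fun x hx => w0 x fun h => by
      have := h.1
      rw [mem_ball] at this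
      linarith)
  have e1 : ∫ x, f x * w x = ε * J := by
    rw [← integral_const_mul, ← integral_indicator (mS n)]
    refine integral_congr_ae (Filter.Eventually.of_forall fun x => ?_)
    by_cases hx : x ∈ S n
    · simp only [hw, indicator_of_mem hx]
      have : |f x| ^ p = |f x| * |f x| ^ (p - 1) := by
        rw [mul_comm, ← Real.rpow_add_one' (abs_nonneg _) (by simpa using hp.ne'), sub_add_cancel]
      rw [this, ← self_mul_sign]
      ring
    · simp [hw, indicator_of_notMem hx]
  have e2 : ∫⁻ x, ENNReal.ofReal (|w x| ^ q) ≤ ENNReal.ofReal (ε ^ q * J) := by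
    rw [← integral_const_mul, ofReal_integral_eq_lintegral_ofReal (intJ.const_mul _)
      (Filter.Eventually.of_forall fun x => by positivity), ← lintegral_indicator (mS n)]
    refine lintegral_mono fun x => ?_
    by_cases hx : x ∈ S n
    · rw [indicator_of_mem hx]
      refine ENNReal.ofReal_le_ofReal
        ((Real.rpow_le_rpow (abs_nonneg _) (abs_w x hx) hq.le).trans_eq ?_)
      rw [Real.mul_rpow ε0.le (by positivity), ← Real.rpow_mul (abs_nonneg _)]
      congr 2
      have := hqp.mul_eq_add
      linarith
    · simp [w0 x hx, Real.zero_rpow hq.ne']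
  rw [e1, abs_of_nonneg (by positivity)] at key
  replace key := key.trans (mul_le_mul_right (add_le_add_left e2 Λ) _)
  lift Λ to ℝ≥0 using hΛ
  rw [← ofReal_integral_eq_lintegral_ofReal intJ
    (Filter.Eventually.of_forall fun x => by positivity)]
  change ENNReal.ofReal J ≤ _
  rw [← ENNReal.ofReal_coe_nnreal, ← ENNReal.ofReal_add (by positivity) (by positivity),
    ← ENNReal.ofReal_mul hc.le, ENNReal.ofReal_le_ofReal_iff (by positivity)] at key
  rw [← ENNReal.ofReal_coe_nnreal, ← ENNReal.ofReal_mul (by positivity)]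
  refine ENNReal.ofReal_le_ofReal ?_
  rw [div_mul_eq_mul_div, le_div_iff₀ ε0]
  have : c * (ε ^ q * J + Λ) = ε / 2 * J + c * Λ := by rw [← hεq]; ring
  linarith

end Duality

section SmoothPart

variable {η : ℝ} {ρ k ψ R : E3 → ℝ} {S : Set E3} {q : ℕ}

lemma abs_setIntegral_mul_le_integral_abs (hR : IntegrableOn R S) (h1 : ∀ x, |ψ x| ≤ 1) :
    |∫ x in S, R x * ψ x| ≤ ∫ x in S, |R x| := by
  rw [← Real.norm_eq_abs]
  refine norm_integral_le_of_norm_le hR.abs (Filter.Eventually.of_forall fun x => ?_)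
  rw [norm_mul]
  exact mul_le_of_le_one_right (abs_nonneg _) (h1 x)

lemma abs_setIntegral_mul_le_negSobNorm (hR : IntegrableOn R S)
    (hψ : ContDiff ℝ (⊤ : ℕ∞) ψ) (hsupp : tsupport ψ ⊆ S)
    (h1 : ∀ j ≤ q, ∀ x, ‖iteratedFDeriv ℝ j ψ x‖ ≤ 1) :
    |∫ x in S, R x * ψ x| ≤ negSobNorm S q R := by
  refine le_csSup ⟨∫ x in S, |R x|, ?_⟩ ⟨ψ, hψ, hsupp, h1, rfl⟩
  rintro _ ⟨φ, -, -, hφ, rfl⟩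
  exact abs_setIntegral_mul_le_integral_abs hR fun x => by
    simpa using hφ 0 (Nat.zero_le q) x

lemma negSobNorm_nonneg : 0 ≤ negSobNorm S q R := by
  refine Real.sSup_nonneg ?_
  rintro _ ⟨φ, -, -, -, rfl⟩
  exact abs_nonneg _

lemma abs_setIntegral_mul_le_mul_negSobNorm (hR : IntegrableOn R S)
    (hψ : ContDiff ℝ (⊤ : ℕ∞) ψ) (hsupp : tsupport ψ ⊆ S) {M : ℝ} (hM0 : 0 ≤ M)
    (hM : ∀ j ≤ q, ∀ x, ‖iteratedFDeriv ℝ j ψ x‖ ≤ M) :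
    |∫ x in S, R x * ψ x| ≤ M * negSobNorm S q R := by
  rcases hM0.eq_or_lt with rfl | hpos
  · have : ∀ x, ψ x = 0 := fun x => by simpa using hM 0 (Nat.zero_le q) x
    simp [this]
  · have key := abs_setIntegral_mul_le_negSobNorm (q := q) (ψ := fun x => M⁻¹ • ψ x) hR
      (hψ.const_smul M⁻¹)
      ((tsupport_smul_subset_right (fun _ => M⁻¹) ψ).trans hsupp) fun j hj x => by
        rw [iteratedFDeriv_const_smul_apply' (hψ.of_le (by exact_mod_cast le_top)).contDiffAt,
          norm_smul,
          Real.norm_of_nonneg (inv_nonneg.2 hM0), inv_mul_le_iff₀ hpos, mul_one]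
        exact hM j hj x
    have e : ∫ x in S, R x * M⁻¹ • ψ x = M⁻¹ * ∫ x in S, R x * ψ x := by
      rw [← integral_const_mul]
      refine integral_congr_ae (Filter.Eventually.of_forall fun x => ?_)
      simp only [smul_eq_mul]
      ring
    rwa [e, abs_mul, abs_of_nonneg (inv_nonneg.2 hM0), inv_mul_le_iff₀ hpos] at key

lemma MollifierPair.exists_norm_iteratedFDeriv_superpose_le (h : MollifierPair η ρ k)
    (d q : ℕ) :
    ∃ K : ℝ, 0 < K ∧ ∀ (R : E3 → ℝ) (S : Set E3) (x : E3), MeasurableSet S →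
      IntegrableOn R S → closedBall x η ⊆ S →
      ‖iteratedFDeriv ℝ d (superpose volume (S.indicator R) id ρ) x‖ ≤ K * negSobNorm S q R := by
  have ρc := h.hasCompactSupport_left
  set g := iteratedFDeriv ℝ d ρ with hg
  have cg : ContDiff ℝ (⊤ : ℕ∞) g := contDiff_iteratedFDeriv_top h.contDiff_left d
  have gc : HasCompactSupport g := ρc.iteratedFDeriv (𝕜 := ℝ) d
  choose b hb using fun j => (gc.iteratedFDeriv (𝕜 := ℝ) j).exists_bound_of_continuous
    (contDiff_iteratedFDeriv_top cg j).continuous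
  have b0 : ∀ j, 0 ≤ b j := fun j => (norm_nonneg _).trans (hb j 0)
  refine ⟨∑ j ∈ Finset.range (q + 1), b j + 1,
    add_pos_of_nonneg_of_pos (Finset.sum_nonneg fun j _ => b0 j) one_pos,
    fun R S x mS hR hS => ?_⟩
  set K := ∑ j ∈ Finset.range (q + 1), b j + 1
  have bK : ∀ j ≤ q, b j ≤ K := fun j hj =>
    (Finset.single_le_sum (fun j _ => b0 j)
      (Finset.mem_range.2 (Nat.lt_succ_of_le hj))).trans (le_add_of_nonneg_right zero_le_one)
  have K0 : 0 ≤ K := (b0 0).trans (bK 0 (Nat.zero_le q))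
  have hR' : Integrable (S.indicator R) := (integrable_indicator_iff mS).2 hR
  have gsupp : tsupport g ⊆ closedBall 0 η := by
    refine (tsupport_iteratedFDeriv_subset d).trans
      (closure_minimal (fun z hz => ?_) isClosed_closedBall)
    by_contra hz'
    exact hz (h.zero_left z (by
      simp only [mem_closedBall, dist_zero_right, not_le] at hz'
      exact hz'.le))
  rw [iteratedFDeriv_superpose hR' measurable_id h.contDiff_left ρc]
  refine ContinuousMultilinearMap.opNorm_le_bound (mul_nonneg K0 negSobNorm_nonneg) fun v => ?_
  set L := ContinuousMultilinearMap.apply ℝ (fun _ : Fin d => E3) ℝ v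
  set P := ∏ i, ‖v i‖
  have P0 : 0 ≤ P := Finset.prod_nonneg fun i _ => norm_nonneg _
  have Lnorm : ‖L‖ ≤ P := ContinuousLinearMap.opNorm_le_bound _ P0 fun m => by
    rw [mul_comm]
    exact m.le_opNorm v
  have cgx : ContDiff ℝ (⊤ : ℕ∞) fun y => g (x - y) := cg.comp (contDiff_const.sub contDiff_id)
  have e1 : superpose volume (S.indicator R) id g x v = ∫ y in S, R y * L (g (x - y)) := by
    have := L.integral_comp_comm
      (integrable_superpose_integrand hR' measurable_id cg.continuous gc x)
    refine this.symm.trans ?_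
    rw [← integral_indicator mS]
    refine integral_congr_ae (Filter.Eventually.of_forall fun y => ?_)
    by_cases hy : y ∈ S <;> simp [hy]
  rw [e1]
  refine (abs_setIntegral_mul_le_mul_negSobNorm (ψ := fun y => L (g (x - y))) (q := q)
    (M := K * P) hR (L.contDiff.comp cgx) ?_ (mul_nonneg K0 P0)
    fun j hj y => ?_).trans_eq (by ring)
  · refine (closure_minimal (fun y hy => ?_) isClosed_closedBall).trans hS
    by_contra hy'
    refine hy ?_
    have : g (x - y) = 0 := by
      refine image_eq_zero_of_notMem_tsupport fun hm => hy' ?_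
      have := gsupp hm
      rwa [mem_closedBall, dist_zero_right, ← dist_eq_norm, dist_comm] at this
    simp [this]
  · have n1 : ‖iteratedFDeriv ℝ j (fun y => g (x - y)) y‖ ≤ b j := by
      have e2 : (fun y => g (x - y))
          = (fun u => g (x + u)) ∘ (LinearIsometryEquiv.neg ℝ : E3 ≃ₗᵢ[ℝ] E3) := by
        funext y
        simp [sub_eq_add_neg]
      rw [e2, LinearIsometryEquiv.norm_iteratedFDeriv_comp_right, iteratedFDeriv_comp_add_left]
      exact hb j _
    calc ‖iteratedFDeriv ℝ j (fun y => L (g (x - y))) y‖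
        ≤ ‖L‖ * ‖iteratedFDeriv ℝ j (fun y => g (x - y)) y‖ :=
          L.norm_iteratedFDeriv_comp_left cgx.contDiffAt (by exact_mod_cast le_top)
      _ ≤ P * K := by gcongr; exact n1.trans (bK j hj)
      _ = K * P := mul_comm _ _

end SmoothPart

/-- Lemma 2.4 (`L^p` version): if `−ΔR = div div A` in `B̲ ⊃⊃ B̄` with `A ∈ L^p` symmetric,
then `R = R₁ + R₂` on `B̄` with `‖R₁‖_{L^p(B̄)} ≤ C ‖A‖_{L^p(B̲)}` and, for all `d,q`,
`‖∇^d R₂‖_{L^∞(B̄)} ≤ C_{d,q} (‖A‖_{L¹(B̲)} + ‖R‖_{W^{−q,1}(B̲)})`. -/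
theorem pressure_decomposition_Lp (xo xu : E3) (ro ru : ℝ) (hro : 0 < ro) (hru : 0 < ru)
    (hBB : closure (ball xo ro) ⊆ ball xu ru) (p : ℝ) (hp : 1 < p) :
    ∃ C > (0:ℝ), ∃ Cdq : ℕ → ℕ → ℝ, (∀ d q, 0 < Cdq d q) ∧
      ∀ (R : E3 → ℝ) (A : E3 → Fin 3 → Fin 3 → ℝ),
      IntegrableOn R (ball xu ru) →
      (∀ x i j, A x i j = A x j i) →
      Measurable A →
      (∫⁻ x in ball xu ru, ENNReal.ofReal (‖A x‖ ^ p)) < ⊤ →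
      (∀ ψ : E3 → ℝ, ContDiff ℝ (⊤ : ℕ∞) ψ → tsupport ψ ⊆ ball xu ru →
        -(∫ x in ball xu ru, R x * (∑ i, pd (pd ψ i) i x))
          = ∫ x in ball xu ru, ∑ i, ∑ j, A x i j * pd (pd ψ j) i x) →
      ∃ R₁ R₂ : E3 → ℝ,
        ContDiffOn ℝ (⊤ : ℕ∞) R₂ (ball xo ro) ∧
        (∀ᵐ x : E3, x ∈ ball xo ro → R x = R₁ x + R₂ x) ∧
        (∫⁻ x in ball xo ro, ENNReal.ofReal (|R₁ x| ^ p)) ^ (1/p)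
          ≤ ENNReal.ofReal C * (∫⁻ x in ball xu ru, ENNReal.ofReal (‖A x‖ ^ p)) ^ (1/p) ∧
        ∀ d q : ℕ, ∀ x ∈ ball xo ro,
          ‖iteratedFDerivWithin ℝ d R₂ (ball xo ro) x‖
            ≤ Cdq d q * ((∫ x in ball xu ru, ‖A x‖) + negSobNorm (ball xu ru) q R) := by
  have hp0 : 0 < p := one_pos.trans hp
  rw [closure_ball xo hro.ne'] at hBB
  obtain ⟨δ, hδ, hδB⟩ := (isCompact_closedBall xo ro).exists_cthickening_subset_open
    isOpen_ball hBB
  rw [cthickening_closedBall hδ.le hro.le] at hδB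
  set η := δ / 2 with hη
  have η0 : 0 < η := half_pos hδ
  obtain ⟨ρ, k, hρ⟩ := exists_mollifierPair η0
  have hqp : (p.conjExponent).HolderConjugate p := (Real.HolderConjugate.conjExponent hp).symm
  obtain ⟨C₁, C₁0, hC₁⟩ := abs_setIntegral_contraction_le hqp
  obtain ⟨C₂, hC₂⟩ := hρ.exists_lintegral_laplacian_parametrix_le hqp xo (ro + η)
  obtain ⟨K, K0, hK⟩ := exists_setLIntegral_rpow_le_of_forall_contDiff hqp
    (c := C₁ * (C₂ + 1)) (by positivity)
  choose Cdq Cdq0 hCdq using hρ.exists_norm_iteratedFDeriv_superpose_le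
  refine ⟨K ^ (1 / p), by positivity, Cdq, Cdq0, fun R A hR _ hA hAp hRA => ?_⟩
  set S := ball xu ru
  have mS : MeasurableSet S := measurableSet_ball
  have hR' : Integrable (S.indicator R) := (integrable_indicator_iff mS).2 hR
  set R₂ := superpose volume (S.indicator R) id ρ
  have cR₂ : ContDiff ℝ (⊤ : ℕ∞) R₂ :=
    contDiff_superpose hR' measurable_id hρ.contDiff_left hρ.hasCompactSupport_left
  set R' := hR'.1.mk _
  have hR'ae : S.indicator R =ᵐ[volume] R' := hR'.1.ae_eq_mk
  have mR' : Measurable R' := hR'.1.stronglyMeasurable_mk.measurable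
  have sub : closedBall xo (ro + η + η) ⊆ S :=
    (closedBall_subset_closedBall (by linarith)).trans hδB
  refine ⟨fun x => R' x - R₂ x, R₂, cR₂.contDiffOn, ?_, ?_, fun d q x hx => ?_⟩
  · filter_upwards [hR'ae] with x hx hxo
    have hxS : x ∈ S := hBB (ball_subset_closedBall hxo)
    rw [sub_add_cancel, ← hx, indicator_of_mem hxS]
  · have key := hK (fun x => R' x - R₂ x) xo ro η _ η0 (mR'.sub cR₂.continuous.measurable)
      (((integrable_congr hR'ae).1 hR').locallyIntegrable.sub cR₂.continuous.locallyIntegrable)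
      hAp.ne fun ψ hψ h0 => ?_
    · refine (ENNReal.rpow_le_rpow key (by positivity)).trans_eq ?_
      rw [ENNReal.mul_rpow_of_nonneg _ _ (by positivity),
        ENNReal.ofReal_rpow_of_nonneg K0.le (by positivity)]
    · have hs : HasCompactSupport ψ := HasCompactSupport.intro (isCompact_closedBall xo (ro + η))
        fun x hx => h0 x (by simpa using hx)
      have cφ := hρ.contDiff_parametrix hψ hs
      have hsupp := hρ.tsupport_parametrix_subset h0
      have φc : HasCompactSupport (parametrix k ψ) :=
        (isCompact_closedBall _ _).of_isClosed_subset (isClosed_tsupport _) hsupp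
      have e : ∫ x, (R' x - R₂ x) * ψ x
          = ∫ x in S, ∑ i, ∑ j, A x i j * pd (pd (parametrix k ψ) j) i x := by
        rw [← hRA _ cφ (hsupp.trans sub)]
        refine (integral_congr_ae ?_).trans ((hρ.integral_sub_superpose_mul hR' hψ hs).trans ?_)
        · filter_upwards [hR'ae] with x hx
          rw [hx]
        · rw [← integral_indicator mS]
          congr 2
          funext x
          by_cases hx : x ∈ S <;> simp [hx]
      rw [e]
      refine (hC₁ _ A S cφ φc hA mS measure_ball_lt_top.ne hAp).trans ?_
      rw [ENNReal.ofReal_mul C₁0.le, mul_assoc, ENNReal.ofReal_add C₂.coe_nonneg zero_le_one,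
        ENNReal.ofReal_coe_nnreal, ENNReal.ofReal_one]
      refine mul_le_mul_right ?_ _
      rw [mul_add]
      refine add_le_add ((hC₂ ψ hψ h0).trans ?_) (le_mul_of_one_le_left' le_add_self)
      exact mul_le_mul_left le_self_add _
  · rw [iteratedFDerivWithin_of_isOpen d isOpen_ball hx]
    refine (hCdq d q R S x mS hR (fun y hy => sub ?_)).trans ?_
    · rw [mem_closedBall] at hy ⊢
      rw [mem_ball] at hx
      linarith [dist_triangle y x xo]
    · exact mul_le_mul_of_nonneg_left
        (le_add_of_nonneg_left (integral_nonneg fun x => norm_nonneg _)) (Cdq0 d q).le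
end
end

section
/- Let B̄ and B̲ be open balls in ℝ³ with the closure of B̄ contained in B̲. Then there exist a constant C > 0 and a family of constants C_{d,q} > 0 (indexed by integers d, q ≥ 0), depending only on B̄, B̲, such that the following holds. Let R ∈ L¹(B̲) and let A : B̲ → ℝ^{3×3} be a symmetric-matrix-valued Lipschitz function with A and ∇A bounded on B̲, satisfying −∫_{B̲} R(x) Δψ(x) dx = ∫_{B̲} Σ_{i,j} A_{ij}(x) ∂ᵢ∂ⱼψ(x) dx for every ψ ∈ C_c^∞(B̲). Then there exist R₁ ∈ L^∞(B̄) and R₂ ∈ C^∞(B̄) with R = R₁ + R₂ almost everywhere on B̄, ess sup_{B̄} |R₁| ≤ C ( ess sup_{B̲} |∇A| + ess sup_{B̲} |A| ), and for all integers d, q ≥ 0: sup_{x ∈ B̄} |∇^d R₂(x)| ≤ C_{d,q} ( ∫_{B̲} |A| dx + N_q(R) ), where N_q(R) := sup { |∫_{B̲} R ψ dx| : ψ ∈ C_c^∞(B̲), sup_x |∇^j ψ(x)| ≤ 1 for all 0 ≤ j ≤ q }. -/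
open MeasureTheory Set Metric
open scoped ENNReal NNReal

noncomputable section

open Filter Topology Convolution

/-- The Laplacian as a sum of iterated partial derivatives. -/
def lap (f : E3 → ℝ) (x : E3) : ℝ := ∑ i, pd (pd f i) i x

theorem contDiff_pd_s8 {f : E3 → ℝ} (hf : ContDiff ℝ (⊤ : ℕ∞) f) (i : Fin 3) :
    ContDiff ℝ (⊤ : ℕ∞) (pd f i) :=
  (hf.fderiv_right (m := (⊤ : ℕ∞)) (by exact_mod_cast le_rfl)).clm_apply contDiff_const

theorem contDiff_lap {f : E3 → ℝ} (hf : ContDiff ℝ (⊤ : ℕ∞) f) :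
    ContDiff ℝ (⊤ : ℕ∞) (lap f) :=
  ContDiff.sum fun i _ => contDiff_pd_s8 (contDiff_pd_s8 hf i) i

theorem tsupport_pd_subset (f : E3 → ℝ) (i : Fin 3) : tsupport (pd f i) ⊆ tsupport f :=
  tsupport_fderiv_apply_subset ℝ _

theorem pd_sub {f g : E3 → ℝ} (hf : Differentiable ℝ f) (hg : Differentiable ℝ g) (i : Fin 3) :
    pd (fun x => f x - g x) i = fun x => pd f i x - pd g i x := by
  funext x
  simp only [pd]
  rw [fderiv_fun_sub (hf x) (hg x)]
  rfl

/-- Chain rule for partial derivatives under an affine change of variables. -/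
theorem pd_comp_affine {f : E3 → ℝ} (hf : Differentiable ℝ f) (c l : ℝ) (a : E3) (i : Fin 3) :
    pd (fun y => c * f (l • (y - a))) i = fun y => (c * l) * pd f i (l • (y - a)) := by
  funext y
  have h1 : HasFDerivAt (fun y : E3 => l • (y - a)) (l • ContinuousLinearMap.id ℝ E3) y :=
    ((hasFDerivAt_id y).sub_const a).const_smul l
  have h2 := ((hf (l • (y - a))).hasFDerivAt.comp y h1).const_mul c
  simp only [pd]
  rw [show (fun y => c * f (l • (y - a)))
    = fun y => c * (f ∘ fun y : E3 => l • (y - a)) y from rfl, h2.fderiv]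
  simp
  ring

theorem lap_comp_affine {f : E3 → ℝ} (hf : ContDiff ℝ (⊤ : ℕ∞) f) (c l : ℝ) (a : E3) (y : E3) :
    lap (fun y => c * f (l • (y - a))) y = c * l ^ 2 * lap f (l • (y - a)) := by
  simp only [lap, Finset.mul_sum]
  refine Finset.sum_congr rfl fun i _ => ?_
  rw [pd_comp_affine (hf.differentiable (by simp)),
    pd_comp_affine ((contDiff_pd_s8 hf i).differentiable (by simp))]
  ring

/-- A smooth function on `ℝ` which equals `1 / √t` for `t ≥ 1`. -/
def invSqrtReg (t : ℝ) : ℝ := Real.smoothTransition (2 * t - 1) * (√t)⁻¹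

theorem contDiff_invSqrtReg : ContDiff ℝ (⊤ : ℕ∞) invSqrtReg := by
  rw [contDiff_iff_contDiffAt]
  intro t
  rcases lt_or_ge t (1 / 2) with ht | ht
  · have : invSqrtReg =ᶠ[𝓝 t] fun _ => 0 := by
      filter_upwards [Iio_mem_nhds ht] with s hs
      have hs : s < 1 / 2 := hs
      simp [invSqrtReg, Real.smoothTransition.zero_of_nonpos (show 2 * s - 1 ≤ 0 by linarith)]
    exact contDiffAt_const.congr_of_eventuallyEq this
  · have h0 : t ≠ 0 := by linarith
    refine ContDiffAt.mul ?_ ?_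
    · exact Real.smoothTransition.contDiff.contDiffAt.comp t
        (ContDiff.contDiffAt (by fun_prop))
    · exact (Real.contDiffAt_sqrt h0).inv (by rw [Real.sqrt_ne_zero']; linarith)

theorem invSqrtReg_of_one_le {t : ℝ} (ht : 1 ≤ t) : invSqrtReg t = (√t)⁻¹ := by
  simp [invSqrtReg, Real.smoothTransition.one_of_one_le (show 1 ≤ 2 * t - 1 by linarith)]

/-- The Coulomb potential `1 / |z|`, smoothed inside the unit ball. -/
def coulombReg (z : E3) : ℝ := invSqrtReg (‖z‖ ^ 2)

theorem contDiff_coulombReg : ContDiff ℝ (⊤ : ℕ∞) coulombReg :=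
  contDiff_invSqrtReg.comp (contDiff_norm_sq ℝ)

theorem coulombReg_of_one_le {z : E3} (hz : 1 ≤ ‖z‖) : coulombReg z = ‖z‖⁻¹ := by
  rw [coulombReg, invSqrtReg_of_one_le (by nlinarith), Real.sqrt_sq (norm_nonneg z)]

theorem contDiff_deriv_invSqrtReg : ContDiff ℝ (⊤ : ℕ∞) (deriv invSqrtReg) :=
  contDiff_invSqrtReg.iterate_deriv 1

theorem pd_coulombReg (i : Fin 3) :
    pd coulombReg i = fun z => 2 * z i * deriv invSqrtReg (‖z‖ ^ 2) := by
  funext z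
  have h1 : HasFDerivAt (fun z : E3 => ‖z‖ ^ 2) (2 • innerSL ℝ z) z :=
    (hasStrictFDerivAt_norm_sq z).hasFDerivAt
  have h2 := (contDiff_invSqrtReg.differentiable (by simp)
    (‖z‖ ^ 2)).hasDerivAt.comp_hasFDerivAt z h1
  simp only [pd]
  rw [show coulombReg = invSqrtReg ∘ fun z : E3 => ‖z‖ ^ 2 from rfl, h2.fderiv]
  simp [EuclideanSpace.inner_single_right]
  ring

theorem lap_coulombReg (z : E3) :
    lap coulombReg z = 6 * deriv invSqrtReg (‖z‖ ^ 2)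
      + 4 * ‖z‖ ^ 2 * deriv (deriv invSqrtReg) (‖z‖ ^ 2) := by
  have key : ∀ i, pd (pd coulombReg i) i z = 2 * deriv invSqrtReg (‖z‖ ^ 2)
      + 4 * (z i) ^ 2 * deriv (deriv invSqrtReg) (‖z‖ ^ 2) := by
    intro i
    have h1 : HasFDerivAt (fun z : E3 => ‖z‖ ^ 2) (2 • innerSL ℝ z) z :=
      (hasStrictFDerivAt_norm_sq z).hasFDerivAt
    have h2 := (contDiff_deriv_invSqrtReg.differentiable (by simp)
      (‖z‖ ^ 2)).hasDerivAt.comp_hasFDerivAt z h1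
    have h3 : HasFDerivAt (fun z : E3 => 2 * z i)
        ((2 : ℝ) • (EuclideanSpace.proj i : E3 →L[ℝ] ℝ)) z :=
      (EuclideanSpace.proj i : E3 →L[ℝ] ℝ).hasFDerivAt.const_mul 2
    have h4 := h3.mul h2
    rw [pd_coulombReg]
    simp only [pd]
    rw [show (fun z : E3 => 2 * z i * deriv invSqrtReg (‖z‖ ^ 2)) =
      (fun z : E3 => 2 * z i) * (deriv invSqrtReg ∘ fun z : E3 => ‖z‖ ^ 2) from rfl, h4.fderiv]
    simp [EuclideanSpace.inner_single_right]
    ring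
  have hn : ‖z‖ ^ 2 = ∑ i, (z i) ^ 2 := by simp [EuclideanSpace.norm_sq_eq]
  simp only [lap, key]
  generalize deriv invSqrtReg (‖z‖ ^ 2) = a
  generalize deriv (deriv invSqrtReg) (‖z‖ ^ 2) = b
  rw [hn]
  simp only [Fin.sum_univ_three]
  ring

theorem lap_coulombReg_of_one_lt {z : E3} (hz : 1 < ‖z‖) : lap coulombReg z = 0 := by
  have hz2 : 1 < ‖z‖ ^ 2 := by nlinarith
  have h1 : ∀ t : ℝ, 1 < t → deriv invSqrtReg t = -(1 / 2) * t ^ (-(3 / 2) : ℝ) := by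
    intro t ht
    have : invSqrtReg =ᶠ[𝓝 t] fun t => t ^ (-(1 / 2) : ℝ) := by
      filter_upwards [Ioi_mem_nhds ht] with s hs
      have hs : 1 < s := hs
      rw [invSqrtReg_of_one_le hs.le, Real.sqrt_eq_rpow, Real.rpow_neg (by linarith)]
    rw [this.deriv_eq, Real.deriv_rpow_const]
    norm_num
  have h2 : deriv (deriv invSqrtReg) (‖z‖ ^ 2) = 3 / 4 * (‖z‖ ^ 2) ^ (-(5 / 2) : ℝ) := by
    have : deriv invSqrtReg =ᶠ[𝓝 (‖z‖ ^ 2)] fun t => -(1 / 2) * t ^ (-(3 / 2) : ℝ) := by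
      filter_upwards [Ioi_mem_nhds hz2] with s hs using h1 s hs
    rw [this.deriv_eq, deriv_const_mul_field, Real.deriv_rpow_const]
    norm_num
    ring
  rw [lap_coulombReg, h1 _ hz2, h2]
  have : (‖z‖ ^ 2) ^ (-(3 / 2) : ℝ) = (‖z‖ ^ 2) * (‖z‖ ^ 2) ^ (-(5 / 2) : ℝ) := by
    nth_rewrite 2 [← Real.rpow_one (‖z‖ ^ 2)]
    rw [← Real.rpow_add (by positivity)]
    norm_num
  rw [this]
  ring

theorem tsupport_lap_coulombReg : tsupport (lap coulombReg) ⊆ closedBall 0 1 := by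
  refine closure_minimal (fun z hz => ?_) isClosed_closedBall
  by_contra h
  exact hz (lap_coulombReg_of_one_lt (by simpa using h))

theorem hasCompactSupport_lap_coulombReg : HasCompactSupport (lap coulombReg) :=
  (isCompact_closedBall 0 1).of_isClosed_subset isClosed_closure tsupport_lap_coulombReg

theorem integral_lap_coulombReg_ne_zero : ∫ z, lap coulombReg z ≠ 0 := by
  set w : ℝ → ℝ := fun r => 6 * deriv invSqrtReg (r ^ 2)
    + 4 * r ^ 2 * deriv (deriv invSqrtReg) (r ^ 2) with hw
  have h1 : ∫ z, lap coulombReg z = ∫ z : E3, w ‖z‖ := by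
    simp only [lap_coulombReg, hw]
  have hd2 : ContDiff ℝ (⊤ : ℕ∞) (deriv (deriv invSqrtReg)) := contDiff_invSqrtReg.iterate_deriv 2
  have hw0 : ∀ r : ℝ, 2 < r → w r = 0 := by
    intro r hr
    have hn : ‖(EuclideanSpace.single (0 : Fin 3) r : E3)‖ = r := by
      simp [abs_of_pos (show (0 : ℝ) < r by linarith)]
    have := lap_coulombReg_of_one_lt (z := EuclideanSpace.single (0 : Fin 3) r)
      (by rw [hn]; linarith)
    rwa [lap_coulombReg, hn] at this
  have h2 : ∫ y in Ioi (0 : ℝ), y ^ 2 • w y = -1 := by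
    have e1 : ∫ y in Ioi (0 : ℝ), y ^ 2 • w y = ∫ y in (0 : ℝ)..2, y ^ 2 • w y := by
      rw [intervalIntegral.integral_of_le (by norm_num)]
      refine (setIntegral_eq_of_subset_of_forall_sdiff_eq_zero measurableSet_Ioi
        (fun y hy => hy.1) fun y hy => ?_)
      have : 2 < y := by
        by_contra h
        exact hy.2 ⟨hy.1, not_lt.1 h⟩
      simp [hw0 y this]
    have e2 : ∀ y : ℝ, HasDerivAt (fun y => 2 * y ^ 3 * deriv invSqrtReg (y ^ 2))
        (y ^ 2 • w y) y := by
      intro y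
      have a1 : HasDerivAt (fun y : ℝ => y ^ 2) (2 * y) y := by
        simpa using hasDerivAt_pow 2 y
      have a2 := (contDiff_deriv_invSqrtReg.differentiable (by simp)
        (y ^ 2)).hasDerivAt.comp y a1
      have a3 : HasDerivAt (fun y : ℝ => 2 * y ^ 3) (2 * (3 * y ^ 2)) y := by
        simpa using (hasDerivAt_pow 3 y).const_mul 2
      refine (a3.mul a2).congr_deriv ?_
      simp [hw]
      ring
    rw [e1, intervalIntegral.integral_eq_sub_of_hasDerivAt (fun y _ => e2 y)]
    · have : deriv invSqrtReg (2 ^ 2) = -(1 / 16) := by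
        have : invSqrtReg =ᶠ[𝓝 (2 ^ 2)] fun t => (√t)⁻¹ := by
          filter_upwards [Ioi_mem_nhds (show (1 : ℝ) < 2 ^ 2 by norm_num)] with s hs
          exact invSqrtReg_of_one_le (le_of_lt hs)
        rw [this.deriv_eq]
        have h := ((hasDerivAt_id' ((2 : ℝ) ^ 2)).sqrt (by norm_num)).inv
          (by rw [Real.sqrt_sq (by norm_num)]; norm_num)
        refine h.deriv.trans ?_
        rw [Real.sqrt_sq (by norm_num)]
        norm_num
      rw [this]
      norm_num
    · refine Continuous.intervalIntegrable ?_ _ _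
      have c1 := contDiff_deriv_invSqrtReg.continuous
      have c2 := hd2.continuous
      simp only [hw]
      fun_prop
  rw [h1, integral_fun_norm_addHaar]
  have h3 : Module.finrank ℝ E3 = 3 := by simp
  rw [h3, show (3 - 1 : ℕ) = 2 from rfl, h2]
  have : 0 < volume.real (ball (0 : E3) 1) :=
    ENNReal.toReal_pos (measure_ball_pos _ _ one_pos).ne' measure_ball_lt_top.ne
  simp only [smul_eq_mul, nsmul_eq_mul]
  norm_num
  exact this.ne'

/-- The difference of two consecutive dyadic rescalings of `coulombReg`; compactly supported. -/
def coulombDiff (z : E3) : ℝ := coulombReg z - 2 * coulombReg ((2 : ℝ) • (z - 0))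

theorem contDiff_coulombDiff : ContDiff ℝ (⊤ : ℕ∞) coulombDiff := by
  have := contDiff_coulombReg
  unfold coulombDiff
  fun_prop

theorem tsupport_coulombDiff : tsupport coulombDiff ⊆ closedBall 0 1 := by
  refine closure_minimal (fun z hz => ?_) isClosed_closedBall
  by_contra h
  have h : 1 < ‖z‖ := by simpa using h
  have h2 : ‖(2 : ℝ) • z‖ = 2 * ‖z‖ := by simp [norm_smul]
  refine hz ?_
  rw [coulombDiff, sub_zero, coulombReg_of_one_le h.le, coulombReg_of_one_le (by linarith), h2]
  have : ‖z‖ ≠ 0 := by linarith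
  field_simp
  ring

theorem lap_coulombDiff (z : E3) :
    lap coulombDiff z = lap coulombReg z - 8 * lap coulombReg ((2 : ℝ) • z) := by
  have hs := contDiff_coulombReg
  have hs2 : ContDiff ℝ (⊤ : ℕ∞) fun z : E3 => 2 * coulombReg ((2 : ℝ) • (z - 0)) := by fun_prop
  have h := lap_comp_affine hs 2 2 0 z
  have : lap coulombDiff z = lap coulombReg z
      - lap (fun z : E3 => 2 * coulombReg ((2 : ℝ) • (z - 0))) z := by
    simp only [lap, ← Finset.sum_sub_distrib]
    refine Finset.sum_congr rfl fun i _ => ?_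
    rw [show coulombDiff = fun z => coulombReg z - 2 * coulombReg ((2 : ℝ) • (z - 0)) from rfl,
      pd_sub (hs.differentiable (by simp)) (hs2.differentiable (by simp)),
      pd_sub ((contDiff_pd_s8 hs i).differentiable (by simp))
        ((contDiff_pd_s8 hs2 i).differentiable (by simp))]
  rw [this, h, sub_zero]
  norm_num

/-- Integration by parts against a Lipschitz matrix field defined on an open set only. -/
theorem abs_integral_hessian_le {U : Set E3} (hU : IsOpen U) {A : E3 → Fin 3 → Fin 3 → ℝ}
    {L : ℝ≥0} {M : ℝ} (hA : LipschitzOnWith L A U)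
    (hM : ∀ᵐ x : E3, x ∈ U → ‖fderiv ℝ A x‖ ≤ M) {ψ : E3 → ℝ}
    (hψ : ContDiff ℝ (⊤ : ℕ∞) ψ) (hc : HasCompactSupport ψ) (hs : tsupport ψ ⊆ U) :
    |∫ x in U, ∑ i, ∑ j, A x i j * pd (pd ψ j) i x| ≤ 3 * M * ∑ j, ∫ x, |pd ψ j x| := by
  have hcp : ∀ {g : E3 → ℝ} (i : Fin 3), HasCompactSupport g → HasCompactSupport (pd g i) :=
    fun i h => h.of_isClosed_subset isClosed_closure (tsupport_pd_subset _ i)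
  have hAij : ∀ i j, ∃ f : E3 → ℝ, LipschitzWith L f ∧ EqOn (fun x => A x i j) f U := by
    intro i j
    have h1 : LipschitzWith 1 (fun B : Fin 3 → Fin 3 → ℝ => B i j) := by
      have h := (LipschitzWith.eval (α := fun _ : Fin 3 => ℝ) j).comp
        (LipschitzWith.eval (α := fun _ : Fin 3 => Fin 3 → ℝ) i)
      rw [one_mul] at h
      exact h
    have h2 := h1.comp_lipschitzOnWith hA
    rw [one_mul] at h2
    exact h2.extend_real
  choose f hfL hfA using hAij
  have hint : ∀ i j, Integrable (fun x => f i j x * pd (pd ψ j) i x) := fun i j =>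
    ((hfL i j).continuous.mul (contDiff_pd_s8
      (contDiff_pd_s8 hψ j) i).continuous).integrable_of_hasCompactSupport (hcp i (hcp j hc)).mul_left
  have hout : ∀ j x, x ∉ U → pd ψ j x = 0 := fun j x hx =>
    image_eq_zero_of_notMem_tsupport fun h => hx (hs (tsupport_pd_subset _ _ h))
  have e1 : ∫ x in U, ∑ i, ∑ j, A x i j * pd (pd ψ j) i x
      = ∑ i, ∑ j, ∫ x, f i j x * pd (pd ψ j) i x := by
    have : ∫ x in U, ∑ i, ∑ j, A x i j * pd (pd ψ j) i x
        = ∫ x in U, ∑ i, ∑ j, f i j x * pd (pd ψ j) i x := by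
      refine setIntegral_congr_fun hU.measurableSet fun x hx => ?_
      simp only [← hfA _ _ hx]
    rw [this, setIntegral_eq_integral_of_forall_compl_eq_zero, integral_finsetSum]
    · refine Finset.sum_congr rfl fun i _ => ?_
      rw [integral_finsetSum _ fun j _ => hint i j]
    · exact fun i _ => integrable_finsetSum _ fun j _ => hint i j
    · intro x hx
      refine Finset.sum_eq_zero fun i _ => Finset.sum_eq_zero fun j _ => ?_
      rw [image_eq_zero_of_notMem_tsupport fun h =>
        hx (hs (tsupport_pd_subset _ _ (tsupport_pd_subset _ _ h))), mul_zero]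
  have hline : ∀ i j, ∀ᵐ x : E3, x ∈ U →
      |lineDeriv ℝ (f i j) x (EuclideanSpace.single i 1)| ≤ M := by
    intro i j
    filter_upwards [hM, hA.ae_differentiableWithinAt_of_mem (μ := volume)] with x h1 h2 hx
    have hd : HasFDerivAt A (fderiv ℝ A x) x :=
      ((h2 hx).differentiableAt (hU.mem_nhds hx)).hasFDerivAt
    have h3 : HasFDerivAt (f i j) ((ContinuousLinearMap.proj (R := ℝ) (φ := fun _ : Fin 3 => ℝ) j ∘L
        ContinuousLinearMap.proj (R := ℝ) (φ := fun _ : Fin 3 => Fin 3 → ℝ) i) ∘L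
        fderiv ℝ A x) x := by
      refine HasFDerivAt.congr_of_eventuallyEq (f := fun x => A x i j) ?_ ?_
      · exact ((ContinuousLinearMap.proj (R := ℝ) (φ := fun _ : Fin 3 => ℝ) j ∘L
          ContinuousLinearMap.proj (R := ℝ) (φ := fun _ : Fin 3 => Fin 3 → ℝ) i).hasFDerivAt).comp
          x hd
      · filter_upwards [hU.mem_nhds hx] with y hy using (hfA i j hy).symm
    rw [(h3.hasLineDerivAt _).lineDeriv]
    calc |(fderiv ℝ A x (EuclideanSpace.single i 1)) i j|
        ≤ ‖fderiv ℝ A x (EuclideanSpace.single i 1)‖ :=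
          (norm_le_pi_norm (fderiv ℝ A x (EuclideanSpace.single i 1) i) j).trans
            (norm_le_pi_norm (fderiv ℝ A x (EuclideanSpace.single i 1)) i)
      _ ≤ ‖fderiv ℝ A x‖ * ‖(EuclideanSpace.single i 1 : E3)‖ :=
          ContinuousLinearMap.le_opNorm _ _
      _ ≤ M := by simpa using h1 hx
  have e2 : ∀ i j, |∫ x, f i j x * pd (pd ψ j) i x| ≤ M * ∫ x, |pd ψ j x| := by
    intro i j
    have hg := contDiff_pd_s8 hψ j
    obtain ⟨D, hD⟩ := ContDiff.lipschitzWith_of_hasCompactSupport (hcp j hc) hg (by simp)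
    have h := (hfL i j).integral_lineDeriv_mul_eq (μ := volume) hD (hcp j hc)
      (EuclideanSpace.single i 1)
    have h' : ∫ x, lineDeriv ℝ (pd ψ j) x (-EuclideanSpace.single i 1) * f i j x
        = -∫ x, f i j x * pd (pd ψ j) i x := by
      rw [← integral_neg]
      refine integral_congr_ae (.of_forall fun x => ?_)
      simp only
      rw [(((hg.differentiable (by simp)) x).hasFDerivAt.hasLineDerivAt _).lineDeriv, map_neg]
      simp only [pd]
      ring
    rw [← abs_neg, ← h', ← h, ← integral_const_mul]
    refine (Real.norm_eq_abs _).symm.trans_le <| norm_integral_le_of_norm_le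
      ((hg.continuous.integrable_of_hasCompactSupport (hcp j hc)).abs.const_mul M) ?_
    filter_upwards [hline i j] with x hx
    by_cases hxU : x ∈ U
    · rw [norm_mul, Real.norm_eq_abs, Real.norm_eq_abs]
      exact mul_le_mul_of_nonneg_right (hx hxU) (abs_nonneg _)
    · simp [hout j x hxU]
  rw [e1]
  calc |∑ i, ∑ j, ∫ x, f i j x * pd (pd ψ j) i x|
      ≤ ∑ i : Fin 3, ∑ j, M * ∫ x, |pd ψ j x| := by
        refine (Finset.abs_sum_le_sum_abs _ _).trans (Finset.sum_le_sum fun i _ => ?_)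
        exact (Finset.abs_sum_le_sum_abs _ _).trans (Finset.sum_le_sum fun j _ => e2 i j)
    _ = 3 * M * ∑ j, ∫ x, |pd ψ j x| := by
        simp [← Finset.mul_sum]
        ring

theorem integral_comp_affine (g : E3 → ℝ) {l : ℝ} (hl : 0 < l) (x : E3) :
    ∫ y, g (l • (y - x)) = (l ^ 3)⁻¹ * ∫ y, g y := by
  rw [integral_sub_right_eq_self (fun y => g (l • y)) x,
    Measure.integral_comp_smul_of_nonneg _ _ _ (hR := hl.le)]
  simp

/-- Rescalings of a continuous compactly supported kernel converge at Lebesgue points. -/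
theorem ae_tendsto_integral_mul_rescale {f : E3 → ℝ} (hf : Integrable f) {k : E3 → ℝ}
    (hk : Continuous k) (hks : tsupport k ⊆ closedBall 0 1) {l : ℕ → ℝ} (hl : ∀ n, 0 < l n)
    (hlim : Tendsto l atTop atTop) :
    ∀ᵐ x : E3, Tendsto (fun n => ∫ y, f y * (l n ^ 3 * k (l n • (y - x)))) atTop
      (𝓝 ((∫ y, k y) * f x)) := by
  have hkc : HasCompactSupport k :=
    (isCompact_closedBall 0 1).of_isClosed_subset isClosed_closure hks
  obtain ⟨S, hS⟩ := hkc.exists_bound_of_continuous hk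
  have hki : Integrable k := hk.integrable_of_hasCompactSupport hkc
  filter_upwards [IsUnifLocDoublingMeasure.ae_tendsto_average_norm_sub volume
    hf.locallyIntegrable 1] with x hx
  have hlinv : Tendsto (fun n => (l n)⁻¹) atTop (𝓝[>] 0) := tendsto_inv_atTop_nhdsGT_zero.comp hlim
  have h := hx (fun _ => x) (fun n => (l n)⁻¹) hlinv
    (.of_forall fun n => mem_closedBall_self (by simpa using (hl n).le))
  rw [tendsto_iff_norm_sub_tendsto_zero]
  have h0 := h.const_mul (S * volume.real (closedBall (0 : E3) 1))
  rw [mul_zero] at h0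
  refine squeeze_zero (fun _ => norm_nonneg _) (fun n => ?_) h0
  have hln := hl n
  have hkn : Integrable fun y => l n ^ 3 * k (l n • (y - x)) :=
    (((hki.comp_smul hln.ne').comp_sub_right x)).const_mul _
  have e1 : (∫ y, k y) * f x = ∫ y, f x * (l n ^ 3 * k (l n • (y - x))) := by
    rw [integral_const_mul, integral_const_mul, integral_comp_affine k hln]
    field_simp
  have hfk : Integrable fun y => f y * (l n ^ 3 * k (l n • (y - x))) := by
    refine hf.mul_bdd (c := l n ^ 3 * S) hkn.aestronglyMeasurable (.of_forall fun y => ?_)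
    rw [norm_mul, Real.norm_of_nonneg (by positivity)]
    gcongr
    exact hS _
  rw [e1, ← integral_sub hfk (hkn.const_mul _)]
  have hvol : volume.real (closedBall x (l n)⁻¹)
      = (l n ^ 3)⁻¹ * volume.real (closedBall (0 : E3) 1) := by
    rw [Measure.real, Measure.addHaar_closedBall' _ _ (by positivity)]
    simp [Measure.real]
    left
    positivity
  have hvpos : 0 < volume.real (closedBall (0 : E3) 1) :=
    ENNReal.toReal_pos (measure_closedBall_pos _ _ one_pos).ne' measure_closedBall_lt_top.ne
  rw [setAverage_eq, hvol, smul_eq_mul]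
  have e2 : S * volume.real (closedBall (0 : E3) 1) *
      (((l n ^ 3)⁻¹ * volume.real (closedBall (0 : E3) 1))⁻¹ *
        ∫ y in closedBall x (l n)⁻¹, ‖f y - f x‖)
      = ∫ y in closedBall x (l n)⁻¹, l n ^ 3 * S * ‖f y - f x‖ := by
    rw [integral_const_mul]
    field_simp
  have hI : IntegrableOn (fun y => l n ^ 3 * S * ‖f y - f x‖) (closedBall x (l n)⁻¹) :=
    ((hf.integrableOn.sub (integrableOn_const measure_closedBall_lt_top.ne)).norm.const_mul _)
  rw [e2, ← integral_indicator measurableSet_closedBall]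
  refine norm_integral_le_of_norm_le (hI.integrable_indicator measurableSet_closedBall)
    (.of_forall fun y => ?_)
  rw [← sub_mul, norm_mul, norm_mul, Real.norm_of_nonneg (show 0 ≤ l n ^ 3 by positivity)]
  by_cases hy : y ∈ closedBall x (l n)⁻¹
  · rw [indicator_of_mem hy]
    have := hS (l n • (y - x))
    calc ‖f y - f x‖ * (l n ^ 3 * ‖k (l n • (y - x))‖) ≤ ‖f y - f x‖ * (l n ^ 3 * S) := by gcongr
      _ = _ := by ring
  · rw [indicator_of_notMem hy, image_eq_zero_of_notMem_tsupport (f := k)]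
    · simp
    · intro hmem
      have := hks hmem
      rw [mem_closedBall_zero_iff, norm_smul, Real.norm_of_nonneg hln.le] at this
      exact hy (by rw [mem_closedBall, dist_eq_norm, ← one_div, le_div_iff₀ hln]; linarith)

theorem bddAbove_negSobNorm {U : Set E3} {R : E3 → ℝ} (hR : IntegrableOn R U)
    (q : ℕ) : BddAbove {r : ℝ | ∃ ψ : E3 → ℝ, ContDiff ℝ (⊤ : ℕ∞) ψ ∧ tsupport ψ ⊆ U ∧
    (∀ j : ℕ, j ≤ q → ∀ x, ‖iteratedFDeriv ℝ j ψ x‖ ≤ 1) ∧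
    r = |∫ x in U, R x * ψ x|} := by
  refine ⟨∫ x in U, ‖R x‖, ?_⟩
  rintro r ⟨ψ, -, -, hψ, rfl⟩
  refine (Real.norm_eq_abs _).symm.trans_le <|
    norm_integral_le_of_norm_le hR.norm (.of_forall fun x => ?_)
  rw [norm_mul]
  have := hψ 0 (Nat.zero_le q) x
  rw [norm_iteratedFDeriv_zero] at this
  exact mul_le_of_le_one_right (norm_nonneg _) this

theorem abs_integral_le_negSobNorm {U : Set E3} {R : E3 → ℝ}
    (hR : IntegrableOn R U) {q : ℕ} {ψ : E3 → ℝ} (hψ : ContDiff ℝ (⊤ : ℕ∞) ψ)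
    (hs : tsupport ψ ⊆ U) {S : ℝ} (hS : 0 ≤ S)
    (hψS : ∀ j ≤ q, ∀ x, ‖iteratedFDeriv ℝ j ψ x‖ ≤ S) :
    |∫ x in U, R x * ψ x| ≤ S * negSobNorm U q R := by
  rcases hS.eq_or_lt with rfl | hS
  · have : ∀ x, ψ x = 0 := fun x => by simpa using hψS 0 (Nat.zero_le q) x
    simp [this]
  · have hm : |∫ x in U, R x * (S⁻¹ • ψ) x| ≤ negSobNorm U q R := by
      refine le_csSup (bddAbove_negSobNorm hR q) ⟨S⁻¹ • ψ, contDiff_const.smul hψ, ?_, ?_, rfl⟩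
      · exact (closure_mono (Function.support_const_smul_subset _ _)).trans hs
      · intro j hj x
        rw [iteratedFDeriv_const_smul_apply (hψ.contDiffAt.of_le (by exact_mod_cast le_top)),
          norm_smul, Real.norm_of_nonneg (by positivity), inv_mul_le_one₀ hS]
        exact hψS j hj x
    have : ∫ x in U, R x * (S⁻¹ • ψ) x = S⁻¹ * ∫ x in U, R x * ψ x := by
      rw [← integral_const_mul]
      refine integral_congr_ae (.of_forall fun x => ?_)
      simp
      ring
    rw [this, abs_mul, abs_of_pos (by positivity), inv_mul_le_iff₀ hS] at hm
    exact hm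

/-- All derivatives of a mollification are controlled by a negative-order norm. -/
theorem abs_iteratedFDeriv_convolution_le {U : Set E3} (hU : IsOpen U) {R : E3 → ℝ}
    (hR : IntegrableOn R U) {x : E3} {δ : ℝ} (hx : closedBall x δ ⊆ U) (q d : ℕ) :
    ∀ (k : E3 → ℝ) (S : ℝ), 0 ≤ S → ContDiff ℝ (⊤ : ℕ∞) k → tsupport k ⊆ closedBall 0 δ →
      (∀ j ≤ q + d, ∀ z, ‖iteratedFDeriv ℝ j k z‖ ≤ S) → ∀ v : Fin d → E3,
      |iteratedFDeriv ℝ d (U.indicator R ⋆[ContinuousLinearMap.mul ℝ ℝ, volume] k) x v|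
        ≤ S * negSobNorm U q R * ∏ i, ‖v i‖ := by
  induction d with
  | zero =>
    intro k S hS hk hks hkS v
    have hsub : ∀ y, k (x - y) = (k ∘ LinearIsometryEquiv.neg ℝ) (y - x) := fun y => by simp
    have e : (U.indicator R ⋆[ContinuousLinearMap.mul ℝ ℝ, volume] k) x
        = ∫ y in U, R y * k (x - y) := by
      rw [convolution_def, ← integral_indicator hU.measurableSet]
      refine integral_congr_ae (.of_forall fun y => ?_)
      by_cases hy : y ∈ U <;> simp [hy]
    simp only [iteratedFDeriv_zero_apply, Finset.univ_eq_empty, Finset.prod_empty, mul_one, e]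
    refine abs_integral_le_negSobNorm hR (by fun_prop) (closure_minimal ?_ ?_ |>.trans hx) hS ?_
    · intro y hy
      have := hks (subset_tsupport _ (show x - y ∈ Function.support k from hy))
      rwa [mem_closedBall_zero_iff, ← dist_eq_norm, dist_comm] at this
    · exact isClosed_closedBall
    · intro j hj y
      simp only [hsub]
      rw [iteratedFDeriv_comp_sub, LinearIsometryEquiv.norm_iteratedFDeriv_comp_right]
      exact hkS j hj _
  | succ d ih =>
    intro k S hS hk hks hkS v
    have hkc : HasCompactSupport k :=
      (isCompact_closedBall 0 δ).of_isClosed_subset isClosed_closure hks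
    have hloc : LocallyIntegrable (U.indicator R) :=
      (hR.integrable_indicator hU.measurableSet).locallyIntegrable
    set e := v (Fin.last d)
    have hF : ContDiff ℝ (⊤ : ℕ∞) (U.indicator R ⋆[ContinuousLinearMap.mul ℝ ℝ, volume] k) :=
      hkc.contDiff_convolution_right _ hloc hk
    have hke : ContDiff ℝ (⊤ : ℕ∞) (fun z => fderiv ℝ k z e) :=
      (hk.fderiv_right (m := (⊤ : ℕ∞)) (by exact_mod_cast le_rfl)).clm_apply contDiff_const
    have h1 : ∀ y, fderiv ℝ (U.indicator R ⋆[ContinuousLinearMap.mul ℝ ℝ, volume] k) y e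
        = (U.indicator R ⋆[ContinuousLinearMap.mul ℝ ℝ, volume] fun z => fderiv ℝ k z e) y := by
      intro y
      rw [(hkc.hasFDerivAt_convolution_right (ContinuousLinearMap.mul ℝ ℝ) hloc
        (hk.of_le (by simp)) y).fderiv]
      exact convolution_precompR_apply (ContinuousLinearMap.mul ℝ ℝ) hloc
        (hkc.fderiv ℝ) (hk.continuous_fderiv (by simp)) y e
    have h2 : iteratedFDeriv ℝ (d + 1) (U.indicator R ⋆[ContinuousLinearMap.mul ℝ ℝ, volume] k) x v
        = iteratedFDeriv ℝ d (U.indicator R ⋆[ContinuousLinearMap.mul ℝ ℝ, volume]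
          fun z => fderiv ℝ k z e) x (Fin.init v) := by
      rw [iteratedFDeriv_succ_apply_right, ← funext h1]
      have hcd : ContDiffAt ℝ d
          (fderiv ℝ (U.indicator R ⋆[ContinuousLinearMap.mul ℝ ℝ, volume] k)) x :=
        (hF.fderiv_right (m := d) (by exact_mod_cast le_top)).contDiffAt
      have := (ContinuousLinearMap.apply ℝ ℝ e).iteratedFDeriv_comp_left hcd le_rfl
      exact (congrArg (fun T => T (Fin.init v)) this).symm
    rw [h2]
    have h3 := ih (fun z => fderiv ℝ k z e) (‖e‖ * S) (by positivity) hke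
      ((tsupport_fderiv_apply_subset ℝ e).trans hks) (fun j hj z => ?_) (Fin.init v)
    · refine h3.trans (le_of_eq ?_)
      rw [Fin.prod_univ_castSucc]
      simp only [Fin.init, e]
      ring
    · have hcd : ContDiffAt ℝ j (fderiv ℝ k) z :=
        (hk.fderiv_right (m := j) (by exact_mod_cast le_top)).contDiffAt
      refine (norm_iteratedFDeriv_clm_apply_const hcd le_rfl).trans ?_
      rw [norm_iteratedFDeriv_fderiv]
      gcongr
      exact hkS _ (by omega) z

theorem exists_iteratedFDeriv_bound {k : E3 → ℝ} (hk : ContDiff ℝ (⊤ : ℕ∞) k)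
    (hkc : HasCompactSupport k) (n : ℕ) :
    ∃ S : ℝ, 0 ≤ S ∧ ∀ j ≤ n, ∀ z, ‖iteratedFDeriv ℝ j k z‖ ≤ S := by
  have h : ∀ j, ∃ S : ℝ, ∀ z, ‖iteratedFDeriv ℝ j k z‖ ≤ S := fun j =>
    (hkc.iteratedFDeriv j).exists_bound_of_continuous
      (hk.continuous_iteratedFDeriv (by exact_mod_cast le_top))
  choose S hS using h
  have hS0 : ∀ j, 0 ≤ S j := fun j => (norm_nonneg _).trans (hS j 0)
  refine ⟨∑ j ∈ Finset.range (n + 1), S j, Finset.sum_nonneg fun j _ => hS0 j, fun j hj z => ?_⟩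
  exact (hS j z).trans (Finset.single_le_sum (f := S) (fun i _ => hS0 i)
    (Finset.mem_range.2 (by omega)))

theorem tsupport_rescale_subset {k : E3 → ℝ} (hk : tsupport k ⊆ closedBall 0 1) {c l : ℝ}
    (hl : 0 < l) (x : E3) : tsupport (fun y => c * k (l • (y - x))) ⊆ closedBall x l⁻¹ := by
  refine closure_minimal (fun y hy => ?_) isClosed_closedBall
  have := hk (subset_tsupport _ (right_ne_zero_of_mul hy))
  rw [mem_closedBall_zero_iff, norm_smul, Real.norm_of_nonneg hl.le] at this
  rw [mem_closedBall, dist_eq_norm, ← one_div, le_div_iff₀ hl]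
  linarith

/-- `‖∇ coulombDiff‖_{L¹}`, summed over the components. -/
def coulombDiffGradNorm : ℝ := ∑ j, ∫ x, |pd coulombDiff j x|

theorem coulombDiffGradNorm_nonneg : 0 ≤ coulombDiffGradNorm :=
  Finset.sum_nonneg fun _ _ => integral_nonneg fun _ => abs_nonneg _

/-- Passing from scale `1 / l` to scale `1 / (2 l)` changes the mollification of `R` by at most a
multiple of `‖∇A‖_∞ / l`. -/
theorem dist_mollification_double_le {U : Set E3} (hU : IsOpen U) {R : E3 → ℝ}
    {A : E3 → Fin 3 → Fin 3 → ℝ} (hR : IntegrableOn R U) {L : ℝ≥0} {M : ℝ}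
    (hA : LipschitzOnWith L A U) (hM : ∀ᵐ x : E3, x ∈ U → ‖fderiv ℝ A x‖ ≤ M)
    (heq : ∀ ψ : E3 → ℝ, ContDiff ℝ (⊤ : ℕ∞) ψ → tsupport ψ ⊆ U →
        -(∫ x in U, R x * (∑ i, pd (pd ψ i) i x))
          = ∫ x in U, ∑ i, ∑ j, A x i j * pd (pd ψ j) i x)
    {x : E3} {l : ℝ} (hl : 0 < l) (hx : closedBall x l⁻¹ ⊆ U) :
    dist (∫ y, U.indicator R y * (l ^ 3 * lap coulombReg (l • (y - x))))
      (∫ y, U.indicator R y * ((2 * l) ^ 3 * lap coulombReg ((2 * l) • (y - x))))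
      ≤ 3 * M * (l⁻¹ * coulombDiffGradNorm) := by
  set ψ : E3 → ℝ := fun y => l * coulombDiff (l • (y - x)) with hψdef
  have hcd := contDiff_coulombDiff
  have hψ : ContDiff ℝ (⊤ : ℕ∞) ψ := by fun_prop
  have hs : tsupport ψ ⊆ closedBall x l⁻¹ := tsupport_rescale_subset tsupport_coulombDiff hl x
  have hc : HasCompactSupport ψ :=
    (isCompact_closedBall x l⁻¹).of_isClosed_subset isClosed_closure hs
  have hgrad : ∑ j, ∫ y, |pd ψ j y| = l⁻¹ * coulombDiffGradNorm := by
    rw [coulombDiffGradNorm, Finset.mul_sum]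
    refine Finset.sum_congr rfl fun j _ => ?_
    rw [hψdef, pd_comp_affine (hcd.differentiable (by simp))]
    simp only [abs_mul, integral_const_mul]
    rw [integral_comp_affine (fun z => |pd coulombDiff j z|) hl x, abs_of_pos hl]
    field_simp
  have hint : ∀ {s : ℝ}, 0 < s →
      Integrable fun y => U.indicator R y * (s ^ 3 * lap coulombReg (s • (y - x))) := by
    intro s hs
    have hcont : Continuous fun y : E3 => s ^ 3 * lap coulombReg (s • (y - x)) := by
      have := (contDiff_lap contDiff_coulombReg).continuous
      fun_prop
    obtain ⟨S, hS⟩ := hasCompactSupport_lap_coulombReg.exists_bound_of_continuous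
      (contDiff_lap contDiff_coulombReg).continuous
    refine (hR.integrable_indicator hU.measurableSet).mul_bdd (c := s ^ 3 * S)
      hcont.aestronglyMeasurable (.of_forall fun y => ?_)
    rw [norm_mul, Real.norm_of_nonneg (by positivity)]
    gcongr
    exact hS _
  have hlap : ∫ y in U, R y * (∑ i, pd (pd ψ i) i y)
      = (∫ y, U.indicator R y * (l ^ 3 * lap coulombReg (l • (y - x))))
        - ∫ y, U.indicator R y * ((2 * l) ^ 3 * lap coulombReg ((2 * l) • (y - x))) := by
    rw [← integral_sub (hint hl) (hint (by positivity)), ← integral_indicator hU.measurableSet]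
    refine integral_congr_ae (.of_forall fun y => ?_)
    have h := lap_comp_affine hcd l l x y
    rw [lap_coulombDiff, smul_smul] at h
    change lap ψ y = _ at h
    by_cases hy : y ∈ U
    · simp only [indicator_of_mem hy]
      change R y * lap ψ y = _
      rw [h]
      ring
    · simp [hy]
  have h := heq ψ hψ (hs.trans hx)
  rw [Real.dist_eq, ← hlap, ← abs_neg, h, ← hgrad]
  exact abs_integral_hessian_le hU hA hM hψ hc (hs.trans hx)

/-- Lemma 2.4 (Lipschitz version): if `−ΔR = div div A` in `B̲ ⊃⊃ B̄` with `A` a symmetric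
Lipschitz matrix field with `A`, `∇A` bounded, then `R = R₁ + R₂` on `B̄` with
`‖R₁‖_{L^∞(B̄)} ≤ C (‖∇A‖_{L^∞(B̲)} + ‖A‖_{L^∞(B̲)})` and, for all `d,q`,
`‖∇^d R₂‖_{L^∞(B̄)} ≤ C_{d,q} (‖A‖_{L¹(B̲)} + ‖R‖_{W^{−q,1}(B̲)})`. -/
theorem pressure_decomposition_Lipschitz (xo xu : E3) (ro ru : ℝ)
    (hro : 0 < ro) (hru : 0 < ru) (hBB : closure (ball xo ro) ⊆ ball xu ru) :
    ∃ C > (0:ℝ), ∃ Cdq : ℕ → ℕ → ℝ, (∀ d q, 0 < Cdq d q) ∧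
      ∀ (R : E3 → ℝ) (A : E3 → Fin 3 → Fin 3 → ℝ),
      IntegrableOn R (ball xu ru) →
      (∀ x i j, A x i j = A x j i) →
      (∃ L : ℝ≥0, LipschitzOnWith L A (ball xu ru)) →
      (∃ M : ℝ, ∀ x ∈ ball xu ru, ‖A x‖ ≤ M) →
      (∃ M : ℝ, ∀ x ∈ ball xu ru, ‖fderiv ℝ A x‖ ≤ M) →
      (∀ ψ : E3 → ℝ, ContDiff ℝ (⊤ : ℕ∞) ψ → tsupport ψ ⊆ ball xu ru →
        -(∫ x in ball xu ru, R x * (∑ i, pd (pd ψ i) i x))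
          = ∫ x in ball xu ru, ∑ i, ∑ j, A x i j * pd (pd ψ j) i x) →
      ∃ R₁ R₂ : E3 → ℝ,
        ContDiffOn ℝ (⊤ : ℕ∞) R₂ (ball xo ro) ∧
        (∀ᵐ x : E3, x ∈ ball xo ro → R x = R₁ x + R₂ x) ∧
        essSup (fun x => ENNReal.ofReal |R₁ x|) (volume.restrict (ball xo ro))
          ≤ ENNReal.ofReal C *
            (essSup (fun x => ENNReal.ofReal ‖fderiv ℝ A x‖)
                (volume.restrict (ball xu ru))
              + essSup (fun x => ENNReal.ofReal ‖A x‖)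
                (volume.restrict (ball xu ru))) ∧
        ∀ d q : ℕ, ∀ x ∈ ball xo ro,
          ‖iteratedFDerivWithin ℝ d R₂ (ball xo ro) x‖
            ≤ Cdq d q * ((∫ x in ball xu ru, ‖A x‖) + negSobNorm (ball xu ru) q R) := by
  set U := ball xu ru with hUdef
  have hU : IsOpen U := isOpen_ball
  obtain ⟨δ, hδ, hδU⟩ : ∃ δ, 0 < δ ∧ cthickening δ (closure (ball xo ro)) ⊆ U := by
    refine IsCompact.exists_cthickening_subset_open ?_ hU hBB
    exact isBounded_ball.isCompact_closure
  have hball : ∀ x ∈ ball xo ro, closedBall x δ ⊆ U := fun x hx =>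
    (closedBall_subset_cthickening (subset_closure hx) δ).trans hδU
  set ρ : E3 → ℝ := lap coulombReg with hρ
  have hρs : ContDiff ℝ (⊤ : ℕ∞) ρ := contDiff_lap contDiff_coulombReg
  set m : ℝ := ∫ z, ρ z
  have hm : m ≠ 0 := integral_lap_coulombReg_ne_zero
  set κ : E3 → ℝ := fun z => δ⁻¹ ^ 3 * ρ (δ⁻¹ • (0 - z)) with hκ
  have hκs : ContDiff ℝ (⊤ : ℕ∞) κ := by fun_prop
  have hκt : tsupport κ ⊆ closedBall 0 δ := by
    refine closure_minimal (fun z hz => ?_) isClosed_closedBall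
    have := tsupport_rescale_subset (c := δ⁻¹ ^ 3) tsupport_lap_coulombReg (inv_pos.2 hδ) z
      (subset_tsupport _ (a := 0) hz)
    rwa [inv_inv, mem_closedBall, dist_comm] at this
  have hκc : HasCompactSupport κ :=
    (isCompact_closedBall 0 δ).of_isClosed_subset isClosed_closure hκt
  choose S hS0 hS using fun d q : ℕ => exists_iteratedFDeriv_bound hκs hκc (q + d)
  set c := coulombDiffGradNorm
  have hc : 0 ≤ c := coulombDiffGradNorm_nonneg
  refine ⟨|m⁻¹| * (6 * δ * c) + 1, by positivity, fun d q => |m⁻¹| * S d q + 1,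
    fun d q => by have := hS0 d q; positivity, ?_⟩
  rintro R A hR - ⟨L, hL⟩ - ⟨M₀, hM₀⟩ heq
  set f := U.indicator R
  have hf : Integrable f := hR.integrable_indicator hU.measurableSet
  set E := essSup (fun x => ENNReal.ofReal ‖fderiv ℝ A x‖) (volume.restrict U)
  have hE : E ≠ ⊤ := by
    refine ((essSup_le_of_ae_le (ENNReal.ofReal M₀) ?_).trans_lt ENNReal.ofReal_lt_top).ne
    filter_upwards [ae_restrict_mem hU.measurableSet] with x hx
    exact ENNReal.ofReal_le_ofReal (hM₀ x hx)
  set M := E.toReal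
  have hM : ∀ᵐ x : E3, x ∈ U → ‖fderiv ℝ A x‖ ≤ M := by
    rw [← ae_restrict_iff' hU.measurableSet]
    filter_upwards [ENNReal.ae_le_essSup (μ := volume.restrict U)
      fun x => ENNReal.ofReal ‖fderiv ℝ A x‖] with x hx
    exact (ENNReal.ofReal_le_iff_le_toReal hE).1 hx
  set F : E3 → ℝ := f ⋆[ContinuousLinearMap.mul ℝ ℝ, volume] κ
  have hF : ContDiff ℝ (⊤ : ℕ∞) F := hκc.contDiff_convolution_right _ hf.locallyIntegrable hκs
  have hR₁ : ∀ᵐ x : E3, x ∈ ball xo ro → |R x - m⁻¹ * F x| ≤ |m⁻¹| * (6 * δ * c) * M := by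
    have hl : ∀ n : ℕ, (0 : ℝ) < 2 ^ n * δ⁻¹ := fun n => by positivity
    have hlim : Tendsto (fun n : ℕ => (2 : ℝ) ^ n * δ⁻¹) atTop atTop :=
      (tendsto_pow_atTop_atTop_of_one_lt one_lt_two).atTop_mul_const (inv_pos.2 hδ)
    filter_upwards [ae_tendsto_integral_mul_rescale hf hρs.continuous tsupport_lap_coulombReg
      hl hlim] with x hx hxo
    have hstep : ∀ n : ℕ, dist (∫ y, f y * ((2 ^ n * δ⁻¹) ^ 3 * ρ ((2 ^ n * δ⁻¹) • (y - x))))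
        (∫ y, f y * ((2 ^ (n + 1) * δ⁻¹) ^ 3 * ρ ((2 ^ (n + 1) * δ⁻¹) • (y - x))))
        ≤ 6 * δ * c * M / 2 / 2 ^ n := by
      intro n
      have hsub : closedBall x (2 ^ n * δ⁻¹)⁻¹ ⊆ U := by
        refine (closedBall_subset_closedBall ?_).trans (hball x hxo)
        rw [mul_inv, inv_inv]
        exact mul_le_of_le_one_left hδ.le (inv_le_one_of_one_le₀ (one_le_pow₀ one_le_two))
      have h := dist_mollification_double_le hU hR hL hM heq (hl n) hsub
      rw [show 2 * (2 ^ n * δ⁻¹) = 2 ^ (n + 1) * δ⁻¹ by ring] at h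
      refine h.trans (le_of_eq ?_)
      rw [mul_inv, inv_inv]
      field_simp
      ring
    have h := dist_le_of_le_geometric_two_of_tendsto₀ hstep hx
    have h0 : ∫ y, f y * ((2 ^ 0 * δ⁻¹) ^ 3 * ρ ((2 ^ 0 * δ⁻¹) • (y - x))) = F x := by
      simp [F, convolution_def, hκ]
      simp only [← smul_neg, neg_sub]
    have hxU : x ∈ U := hBB (subset_closure hxo)
    have hfx : f x = R x := indicator_of_mem hxU R
    rw [h0, hfx, dist_comm, Real.dist_eq] at h
    calc |R x - m⁻¹ * F x| = |m⁻¹| * |m * R x - F x| := by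
          rw [← abs_mul]
          congr 1
          field_simp
      _ ≤ |m⁻¹| * (6 * δ * c * M) := by gcongr
      _ = _ := by ring
  refine ⟨fun x => R x - m⁻¹ * F x, fun x => m⁻¹ * F x, (contDiff_const.mul hF).contDiffOn,
    .of_forall fun x _ => by ring, ?_, ?_⟩
  · refine essSup_le_of_ae_le _ ?_
    rw [EventuallyLE, ae_restrict_iff' measurableSet_ball]
    filter_upwards [hR₁] with x hx hxo
    calc ENNReal.ofReal |R x - m⁻¹ * F x|
        ≤ ENNReal.ofReal ((|m⁻¹| * (6 * δ * c) + 1) * M) := by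
          refine ENNReal.ofReal_le_ofReal ((hx hxo).trans ?_)
          have : 0 ≤ M := ENNReal.toReal_nonneg
          gcongr
          linarith
      _ = ENNReal.ofReal (|m⁻¹| * (6 * δ * c) + 1) * E := by
          rw [ENNReal.ofReal_mul (by positivity), ENNReal.ofReal_toReal hE]
      _ ≤ _ := by gcongr; exact le_self_add
  · intro d q x hx
    have hN : 0 ≤ negSobNorm U q R := by
      simpa using abs_integral_le_negSobNorm hR (q := q) (ψ := fun _ => 0) contDiff_const
        (by simp [tsupport]) zero_le_one fun j _ x => by simp [iteratedFDeriv_fun_zero]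
    have hA0 : 0 ≤ ∫ x in U, ‖A x‖ := integral_nonneg fun _ => norm_nonneg _
    have hS0' := hS0 d q
    have hb : ‖iteratedFDeriv ℝ d F x‖ ≤ S d q * negSobNorm U q R :=
      ContinuousMultilinearMap.opNorm_le_bound (by positivity) fun v =>
        abs_iteratedFDeriv_convolution_le hU hR (hball x hx) q d κ (S d q) hS0' hκs hκt
          (hS d q) v
    rw [iteratedFDerivWithin_of_isOpen d isOpen_ball hx]
    have := iteratedFDeriv_const_smul_apply' (a := m⁻¹) (i := d) (x := x)
      (hF.contDiffAt.of_le (by exact_mod_cast le_top))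
    simp only [smul_eq_mul] at this
    rw [this, norm_smul, Real.norm_eq_abs]
    calc |m⁻¹| * ‖iteratedFDeriv ℝ d F x‖ ≤ |m⁻¹| * (S d q * negSobNorm U q R) := by gcongr
      _ = (|m⁻¹| * S d q) * negSobNorm U q R := by ring
      _ ≤ _ := by gcongr <;> linarith
end
end
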